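/- Let c be a nondegenerate comajor of a cubic symmetric lamination whose endpoints are strictly preperiodic under s3 with preperiod at least 2. Then either c is a two-sided limit leaf of C_sCL (approximated by comajors from both sides), or c is an edge of a finite gap H of the lamination C_sCL all of whose edges are limits of comajors disjoint from H. -/

import Mathlib

noncomputable section

open Set Metric

instance : Fact ((0:ℝ) < 1) := ⟨one_pos⟩

/-- The circle `S = ℝ/ℤ`. -/
abbrev S1 : Type := AddCircle (1 : ℝ)

/-- The tripling map `σ₃ : x ↦ 3x (mod 1)`. -/
def s3 : S1 → S1 := fun x => (3 : ℕ) • x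

/-- The antipodal map `x ↦ x + 1/2` (denoted `−x` in the paper). -/
def antip : S1 → S1 := fun x => x + (((1:ℝ)/2 : ℝ) : S1)

/-- A chord of the circle: an unordered pair of points of `S1`. -/
abbrev Chord : Type := Sym2 S1

/-- The image chord of a chord under a circle map. -/
def cmap (f : S1 → S1) (ℓ : Chord) : Chord := Sym2.map f ℓ

/-- The length of a chord `{a,b}`: the shorter of the two arcs joining `a` and `b`
(the natural norm on `ℝ/ℤ`). -/
def chordLen : Chord → ℝ :=
  Sym2.lift ⟨fun a b => ‖a - b‖, fun a b => norm_sub_rev a b⟩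

/-- The standard embedding of the circle `ℝ/ℤ` into `ℂ` (onto the unit circle). -/
def toC (x : S1) : ℂ :=
  Complex.exp (2 * Real.pi * Complex.I * (((AddCircle.equivIco 1 0 x : Set.Ico (0:ℝ) (0+1)) : ℝ) : ℂ))

/-- The geometric chord in the closed unit disk of `ℂ` determined by an
unordered pair of circle points. -/
def chordSet : Chord → Set ℂ :=
  Sym2.lift ⟨fun a b => segment ℝ (toC a) (toC b), fun a b => segment_symm ℝ _ _⟩

/-- Two chords cross if their endpoints strictly alternate on the circle. -/
def Crosses (ℓ₁ ℓ₂ : Chord) : Prop :=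
  (∃ a b c d : ℝ, a < b ∧ b < c ∧ c < d ∧ d < a + 1 ∧
    ℓ₁ = s(((a : ℝ) : S1), ((c : ℝ) : S1)) ∧ ℓ₂ = s(((b : ℝ) : S1), ((d : ℝ) : S1))) ∨
  (∃ a b c d : ℝ, a < b ∧ b < c ∧ c < d ∧ d < a + 1 ∧
    ℓ₂ = s(((a : ℝ) : S1), ((c : ℝ) : S1)) ∧ ℓ₁ = s(((b : ℝ) : S1), ((d : ℝ) : S1)))

/-- A critical chord: nondegenerate with degenerate `σ₃`-image. -/
def IsCritical (ℓ : Chord) : Prop := ¬ ℓ.IsDiag ∧ (cmap s3 ℓ).IsDiag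

/-- The union in `ℂ` of all the chords of a family. -/
def unionSet (L : Set Chord) : Set ℂ := ⋃ ℓ ∈ L, chordSet ℓ

def openDisk : Set ℂ := Metric.ball (0:ℂ) 1
def closedDisk : Set ℂ := Metric.closedBall (0:ℂ) 1

/-- A lamination: a family of pairwise non-crossing chords whose union is closed. -/
structure IsLamination (L : Set Chord) : Prop where
  nocross : ∀ ℓ₁ ∈ L, ∀ ℓ₂ ∈ L, ¬ Crosses ℓ₁ ℓ₂
  closed : IsClosed (unionSet L)

/-- A sibling collection: three pairwise disjoint chords with the same
nondegenerate `σ₃`-image. -/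
def IsSiblingCollection (ℓ₁ ℓ₂ ℓ₃ : Chord) : Prop :=
  Disjoint (chordSet ℓ₁) (chordSet ℓ₂) ∧ Disjoint (chordSet ℓ₁) (chordSet ℓ₃) ∧
  Disjoint (chordSet ℓ₂) (chordSet ℓ₃) ∧
  ¬ (cmap s3 ℓ₁).IsDiag ∧ cmap s3 ℓ₂ = cmap s3 ℓ₁ ∧ cmap s3 ℓ₃ = cmap s3 ℓ₁

/-- A `σ₃`-invariant lamination. -/
structure IsInvLam (L : Set Chord) extends IsLamination L : Prop where
  forward : ∀ ℓ ∈ L, cmap s3 ℓ ∈ L ∨ (cmap s3 ℓ).IsDiag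
  backward : ∀ ℓ ∈ L, ∃ ℓ' ∈ L, cmap s3 ℓ' = ℓ
  siblings : ∀ ℓ ∈ L, ¬ (cmap s3 ℓ).IsDiag →
    ∃ ℓ₂ ∈ L, ∃ ℓ₃ ∈ L, IsSiblingCollection ℓ ℓ₂ ℓ₃

/-- A cubic symmetric lamination. -/
structure IsCubicSymLam (L : Set Chord) extends IsInvLam L : Prop where
  symm : ∀ ℓ ∈ L, cmap antip ℓ ∈ L

/-- A major: a leaf whose length is closest to `1/3` among all leaves. -/
def IsMajor (L : Set Chord) (M : Chord) : Prop :=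
  M ∈ L ∧ ∀ ℓ ∈ L, |1/3 - chordLen M| ≤ |1/3 - chordLen ℓ|

/-- A minor: the `σ₃`-image of a major. -/
def IsMinor (L : Set Chord) (m : Chord) : Prop := ∃ M, IsMajor L M ∧ m = cmap s3 M

/-- A comajor: a short (or degenerate) sibling of a major, disjoint from all majors. -/
def IsComajor (L : Set Chord) (c : Chord) : Prop :=
  (chordLen c < 1/6 ∨ c.IsDiag) ∧ (¬ c.IsDiag → c ∈ L) ∧
  (∃ M, IsMajor L M ∧ cmap s3 c = cmap s3 M) ∧
  (∀ M, IsMajor L M → Disjoint (chordSet c) (chordSet M))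

/-- The cubic symmetric comajor lamination: all comajors of all cubic symmetric
laminations. -/
def CsCL : Set Chord := {c | ∃ L, IsCubicSymLam L ∧ IsComajor L c}

/-- A chord is periodic if some positive iterate of `σ₃` fixes it. -/
def ChordPeriodic (c : Chord) : Prop := ∃ p, 1 ≤ p ∧ cmap (s3^[p]) c = c

/-- A comajor is co-periodic if its image is periodic but it is not. -/
def CoPeriodic (c : Chord) : Prop := ChordPeriodic (cmap s3 c) ∧ ¬ ChordPeriodic c

/-- The point of the unit circle in `ℂ` with argument `2πt`. -/
def circPt (t : ℝ) : ℂ := toC ((t : ℝ) : S1)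

/-- The (closed) arc of the circle in `ℂ` from angle `u` to angle `v` (traversed
positively), as a subset of `ℂ`. -/
def arcSet (u v : ℝ) : Set ℂ := circPt '' Set.Icc u v

/-- The unordered arc between angles `u` and `v`. -/
def arcSetU (u v : ℝ) : Set ℂ := circPt '' Set.uIcc u v

/-- The closed region `R(n)` bounded by the chord from angle `a` to angle `a+t`
(with `t` the length of the chord) and the corresponding (shorter) arc `H(n)`:
the convex hull of that arc. -/
def regionUnder (a t : ℝ) : Set ℂ := convexHull ℝ (arcSet a (a + t))

/-- `Under m n` (`m ≺ n`): `m` is contained in the region `R(n)`. -/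
def Under (m n : Chord) : Prop :=
  ∃ a t : ℝ, 0 ≤ t ∧ t < 1/2 ∧ t = chordLen n ∧
    n = s(((a : ℝ) : S1), ((a + t : ℝ) : S1)) ∧ chordSet m ⊆ regionUnder a t

/-- The (closed) strip `C(ℓ)` between the medium/long chord `ℓ` from angle `a` to
angle `a+t` (with `1/6 < t ≤ 1/2` its length) and its medium/long sibling
`ℓ' = {a+1/3, a+t-1/3}`. -/
def stripSet (a t : ℝ) : Set ℂ :=
  convexHull ℝ (arcSetU (a + t) (a + 1/3) ∪ arcSetU (a + t - 1/3) a)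

/-- The short strips `SH(ℓ) = C(ℓ) ∪ −C(ℓ)`. -/
def SHSet (a t : ℝ) : Set ℂ := stripSet a t ∪ stripSet (a + 1/2) t

/-- For a short chord `c` from angle `a` to angle `a+t` (`0 ≤ t < 1/6`), the strip
`C(M_c)` between the two medium/long chords `M_c = {a+2/3, a+t+1/3}` and
`M'_c = {a+1/3, a+t+2/3}` having the same `σ₃`-image as `c`. -/
def QStrip (a t : ℝ) : Set ℂ :=
  convexHull ℝ (arcSet (a + 1/3) (a + t + 1/3) ∪ arcSet (a + 2/3) (a + t + 2/3))

/-- A legal (symmetric) pair `{c, −c}`. -/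
def IsLegalPair (c : Chord) : Prop :=
  c.IsDiag ∨
  ∃ a t : ℝ, 0 < t ∧ t < 1/6 ∧ t = chordLen c ∧
    c = s(((a : ℝ) : S1), ((a + t : ℝ) : S1)) ∧
    (∀ i j : ℕ,
      ¬ Crosses (cmap (s3^[i]) c) (cmap (s3^[j]) c) ∧
      ¬ Crosses (cmap (s3^[i]) c) (cmap (s3^[j]) (cmap antip c)) ∧
      ¬ Crosses (cmap (s3^[i]) (cmap antip c)) (cmap (s3^[j]) (cmap antip c))) ∧
    (∀ i : ℕ, 1 ≤ i →
      chordSet (cmap (s3^[i]) c) ∩ interior (QStrip a t ∪ QStrip (a + 1/2) t) = ∅)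

/-- A gap of a lamination: the closure of a connected component of the complement,
in the open unit disk, of the union of the leaves. -/
def IsGapOf (L : Set Chord) (G : Set ℂ) : Prop :=
  ∃ z ∈ openDisk \ unionSet L, G = closure (connectedComponentIn (openDisk \ unionSet L) z)

/-- The vertices of a gap: its points on the circle. -/
def gapVerts (G : Set ℂ) : Set S1 := {x : S1 | toC x ∈ G}

/-- The image of a gap: the convex hull of the `σ₃`-image of its vertex set. -/
def gapImage (G : Set ℂ) : Set ℂ := convexHull ℝ (toC '' (s3 '' gapVerts G))

/-- Iterated gap images. -/
def gapIter (n : ℕ) (G : Set ℂ) : Set ℂ := gapImage^[n] G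

/-- An edge of a gap: a nondegenerate chord contained in its boundary. -/
def IsEdgeOf (G : Set ℂ) (ℓ : Chord) : Prop := ¬ ℓ.IsDiag ∧ chordSet ℓ ⊆ frontier G

/-- The (first return) map `σ₃^p` on the gap `G` has degree greater than one:
some edge of the image gap has (at least) two disjoint preimage edges in `G`. -/
def GapDegreeGE2 (G : Set ℂ) (p : ℕ) : Prop :=
  ∃ m e₁ e₂ : Chord, IsEdgeOf (gapIter p G) m ∧ e₁ ≠ e₂ ∧
    IsEdgeOf G e₁ ∧ IsEdgeOf G e₂ ∧ Disjoint (chordSet e₁) (chordSet e₂) ∧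
    cmap (s3^[p]) e₁ = m ∧ cmap (s3^[p]) e₂ = m

/-- `L` has a periodic infinite gap of degree greater than one (hyperbolicity). -/
def HasHyperbolicGap (L : Set Chord) : Prop :=
  ∃ G p, IsGapOf L G ∧ (gapVerts G).Infinite ∧ 1 ≤ p ∧ gapIter p G = G ∧ GapDegreeGE2 G p

/-- Two circle points are joined by a finite concatenation of leaves of `L`. -/
def ChainJoined (L : Set Chord) : S1 → S1 → Prop :=
  Relation.ReflTransGen (fun x y => ∃ ℓ ∈ L, x ∈ ℓ ∧ y ∈ ℓ)

/-- A q-lamination: points joined by finite concatenations of leaves are vertices of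
a single leaf or finite gap. -/
def IsQLam (L : Set Chord) : Prop :=
  ∀ x y : S1, ChainJoined L x y →
    x = y ∨ (∃ ℓ ∈ L, x ∈ ℓ ∧ y ∈ ℓ) ∨
    (∃ G, IsGapOf L G ∧ (gapVerts G).Finite ∧ toC x ∈ G ∧ toC y ∈ G)

/-- A periodic point of `σ₃`. -/
def PerPt (x : S1) : Prop := ∃ p, 1 ≤ p ∧ s3^[p] x = x

/-- An eventually periodic point of `σ₃`. -/
def EvPerPt (x : S1) : Prop := ∃ k, PerPt (s3^[k] x)

/-- `x` is strictly preperiodic of preperiod `k ≥ 1` and period `p`. -/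
def StrictPreper (x : S1) (k p : ℕ) : Prop :=
  1 ≤ k ∧ 1 ≤ p ∧ s3^[p] (s3^[k] x) = s3^[k] x ∧
  (∀ j < k, ¬ PerPt (s3^[j] x)) ∧
  (∀ q, 1 ≤ q → s3^[q] (s3^[k] x) = s3^[k] x → p ≤ q)

/-- A periodic point of type B: of period `2n` with `σ₃ⁿ(x) = −x`. -/
def TypeB (x : S1) : Prop :=
  ∃ n, 1 ≤ n ∧ Function.minimalPeriod s3 x = 2 * n ∧ s3^[n] x = antip x

/-- `c` is a two-sided limit of chords of the family `A`: within every complementary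
component of the disk minus `c` there are chords of `A` converging to `c`. -/
def TwoSidedLimitOf (A : Set Chord) (c : Chord) : Prop :=
  ∀ z ∈ closedDisk \ chordSet c, ∀ ε : ℝ, 0 < ε →
    ∃ d ∈ A, d ≠ c ∧ chordSet d ⊆ connectedComponentIn (closedDisk \ chordSet c) z ∧
      Metric.hausdorffDist (chordSet d) (chordSet c) < ε

/-- The chord `n` weakly separates the chords `ℓ₁` and `ℓ₂`. -/
def WeaklySep (n ℓ₁ ℓ₂ : Chord) : Prop :=
  ∃ z₁ ∈ chordSet ℓ₁ \ chordSet n, ∃ z₂ ∈ chordSet ℓ₂ \ chordSet n,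
    chordSet ℓ₁ \ chordSet n ⊆ connectedComponentIn (closedDisk \ chordSet n) z₁ ∧
    chordSet ℓ₂ \ chordSet n ⊆ connectedComponentIn (closedDisk \ chordSet n) z₂ ∧
    connectedComponentIn (closedDisk \ chordSet n) z₁ ≠
      connectedComponentIn (closedDisk \ chordSet n) z₂

/-- The (non-diameter, non-fixed) chord `ℓ` moves in under the circle map `h`. -/
def MovesIn (h : S1 → S1) (ℓ : Chord) : Prop := cmap h ℓ ≠ ℓ ∧ Under (cmap h ℓ) ℓ

/-- The chord `ℓ` moves out under the circle map `h`. -/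
def MovesOut (h : S1 → S1) (ℓ : Chord) : Prop := cmap h ℓ ≠ ℓ ∧ ¬ Under (cmap h ℓ) ℓ

namespace SymLam

/-- The representative of a circle point in `[0,1)`. -/
def rep (x : S1) : ℝ := (AddCircle.equivIco 1 0 x : Set.Ico (0:ℝ) (0+1))

lemma rep_nonneg (x : S1) : 0 ≤ rep x := (AddCircle.equivIco 1 0 x).2.1

lemma rep_lt_one (x : S1) : rep x < 1 := by
  have := (AddCircle.equivIco 1 0 x).2.2
  simpa [rep] using this

@[simp] lemma coe_rep (x : S1) : ((rep x : ℝ) : S1) = x := AddCircle.coe_equivIco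

lemma coe_eq_zero_iff {s : ℝ} : (s : S1) = 0 ↔ ∃ n : ℤ, s = n := by
  rw [AddCircle.coe_eq_zero_iff]
  simp [eq_comm]

lemma coe_eq_coe_iff {s u : ℝ} : (s : S1) = (u : S1) ↔ ∃ n : ℤ, s = u + n := by
  rw [← sub_eq_zero, ← AddCircle.coe_sub, coe_eq_zero_iff]
  simp only [sub_eq_iff_eq_add']

lemma rep_coe {s : ℝ} (h0 : 0 ≤ s) (h1 : s < 1) : rep (s : S1) = s := by
  unfold rep
  rw [AddCircle.equivIco_coe_of_mem]
  simpa using ⟨h0, h1⟩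

lemma rep_eq {x : S1} {s : ℝ} (hx : x = (s : S1)) (h0 : 0 ≤ s) (h1 : s < 1) : rep x = s := by
  rw [hx, rep_coe h0 h1]

lemma rep_injective : Function.Injective rep := fun x y h => by
  rw [← coe_rep x, ← coe_rep y, h]

@[simp] lemma rep_zero : rep 0 = 0 := by
  simpa using rep_coe (s := 0) le_rfl one_pos

lemma rep_eq_zero {x : S1} : rep x = 0 ↔ x = 0 :=
  ⟨fun h => rep_injective (by simpa using h), fun h => by simp [h]⟩

lemma exists_rep_coe (s : ℝ) : ∃ n : ℤ, rep (s : S1) = s + n :=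
  coe_eq_coe_iff.1 (by simp)

lemma norm_coe_of_abs_le {s : ℝ} (h : |s| ≤ 1 / 2) : ‖(s : S1)‖ = |s| := by
  rw [AddCircle.norm_coe_eq_abs_iff 1 one_ne_zero]
  simpa using h

lemma norm_eq_min (x : S1) : ‖x‖ = min (rep x) (1 - rep x) := by
  have h0 := rep_nonneg x
  have h1 := rep_lt_one x
  rcases le_total (rep x) (1 / 2) with h | h
  · rw [min_eq_left (by linarith)]
    conv_lhs => rw [← coe_rep x]
    rw [norm_coe_of_abs_le (by rw [abs_of_nonneg h0]; exact h), abs_of_nonneg h0]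
  · rw [min_eq_right (by linarith)]
    have : x = ((rep x - 1 : ℝ) : S1) := by
      simp [show ((1 : ℝ) : S1) = 0 from AddCircle.coe_period 1]
    conv_lhs => rw [this]
    rw [norm_coe_of_abs_le (by rw [abs_of_nonpos (by linarith)]; linarith),
      abs_of_nonpos (by linarith)]
    ring

lemma norm_coe_of_le_one {s : ℝ} (h : |s| ≤ 1) : ‖(s : S1)‖ = min |s| (1 - |s|) := by
  have key : ∀ u : ℝ, 0 ≤ u → u ≤ 1 → ‖(u : S1)‖ = min u (1 - u) := by
    intro u h0 h1
    rcases h1.lt_or_eq with h1 | rfl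
    · rw [norm_eq_min, rep_coe h0 h1]
    · have h1 : ((1 : ℝ) : S1) = 0 := AddCircle.coe_period 1
      simp [h1]
  rcases le_total 0 s with h0 | h0
  · rw [abs_of_nonneg h0] at *; exact key s h0 h
  · rw [abs_of_nonpos h0] at *
    rw [← key _ (by linarith) h, AddCircle.coe_neg, norm_neg]

lemma sign_sin {s : ℝ} (h : |s| < 1) :
    SignType.sign (Real.sin (Real.pi * s)) = SignType.sign s := by
  rw [abs_lt] at h
  have hp := Real.pi_pos
  rcases lt_trichotomy s 0 with h0 | rfl | h0
  · rw [sign_neg h0, sign_neg]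
    apply Real.sin_neg_of_neg_of_neg_pi_lt <;> nlinarith
  · simp
  · rw [sign_pos h0, sign_pos]
    apply Real.sin_pos_of_pos_of_lt_pi <;> nlinarith

lemma sin_shift (s u : ℝ) (m n : ℤ) :
    Real.sin (Real.pi * ((s + m) - (u + n))) = (-1) ^ (m - n) * Real.sin (Real.pi * (s - u)) := by
  rw [← Real.sin_add_int_mul_pi]
  congr 1; push_cast; ring

/-- The chords `{x,z}` and `{y,w}` cross. -/
def Xs (x z y w : S1) : Prop :=
  (rep y - rep x) * (rep y - rep z) * ((rep w - rep x) * (rep w - rep z)) < 0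

lemma abs_rep_sub_lt (x y : S1) : |rep x - rep y| < 1 := by
  rw [abs_lt]; constructor <;> linarith [rep_nonneg x, rep_nonneg y, rep_lt_one x, rep_lt_one y]

lemma Xs_lift {X Z Y W : ℝ} (h1 : |Y - X| < 1) (h2 : |Y - Z| < 1) (h3 : |W - X| < 1)
    (h4 : |W - Z| < 1) :
    Xs X Z Y W ↔ (Y - X) * (Y - Z) * ((W - X) * (W - Z)) < 0 := by
  unfold Xs
  rw [← sign_eq_neg_one_iff, ← sign_eq_neg_one_iff]
  simp only [sign_mul]
  rw [← sign_sin h1, ← sign_sin h2, ← sign_sin h3, ← sign_sin h4]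
  rw [← sign_sin (abs_rep_sub_lt Y X), ← sign_sin (abs_rep_sub_lt Y Z),
    ← sign_sin (abs_rep_sub_lt W X), ← sign_sin (abs_rep_sub_lt W Z)]
  simp only [← sign_mul]
  obtain ⟨x, hx⟩ := exists_rep_coe X
  obtain ⟨y, hy⟩ := exists_rep_coe Y
  obtain ⟨z, hz⟩ := exists_rep_coe Z
  obtain ⟨w, hw⟩ := exists_rep_coe W
  rw [hx, hy, hz, hw]
  simp only [sin_shift]
  have e : ((-1 : ℝ)) ^ (y - x) * (-1) ^ (y - z) * ((-1) ^ (w - x) * (-1) ^ (w - z)) = 1 := by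
    rw [← zpow_add₀ (by norm_num), ← zpow_add₀ (by norm_num), ← zpow_add₀ (by norm_num)]
    apply Even.neg_one_zpow
    exact ⟨y - x - z + w, by ring⟩
  rw [show ∀ a b c d a' b' c' d' : ℝ, (a * a') * (b * b') * ((c * c') * (d * d')) =
    (a * b * (c * d)) * (a' * b' * (c' * d')) by intros; ring, e, one_mul]

/-- `z` lies strictly inside the positively oriented arc from `p` to `q`. -/
def cyc (p z q : S1) : Prop := 0 < rep (z - p) ∧ rep (z - p) < rep (q - p)

lemma cyc_lift {P Z Q : ℝ} (h1 : |Z - P| < 1) (h2 : |Q - Z| < 1) (h3 : |Q - P| < 1) :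
    cyc P Z Q ↔ 0 < (Z - P) * (Q - Z) * (Q - P) := by
  have h : cyc P Z Q ↔ 0 < (rep ((Z : S1) - P) - 0) *
      (rep ((Q : S1) - P) - rep ((Z : S1) - P)) * (rep ((Q : S1) - P) - 0) := by
    unfold cyc
    set u := rep ((Z : S1) - P) with hu
    set v := rep ((Q : S1) - P) with hv
    have hu0 : 0 ≤ u := rep_nonneg _
    have hv0 : 0 ≤ v := rep_nonneg _
    simp only [sub_zero]
    constructor
    · rintro ⟨h, h'⟩
      have := sub_pos.2 h'
      have := h.trans h'
      positivity
    · intro h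
      have hv : 0 < v := by
        rcases hv0.eq_or_lt with e | e
        · rw [← e] at h; simp at h
        · exact e
      have h := pos_of_mul_pos_left h hv.le
      have hu : 0 < u := by
        rcases hu0.eq_or_lt with e | e
        · rw [← e] at h; simp at h
        · exact e
      exact ⟨hu, by linarith [pos_of_mul_pos_right h hu.le]⟩
  rw [h]
  have k1 : |rep ((Z : S1) - P) - 0| < 1 := by
    rw [sub_zero, abs_of_nonneg (rep_nonneg _)]; exact rep_lt_one _
  have k3 : |rep ((Q : S1) - P) - 0| < 1 := by
    rw [sub_zero, abs_of_nonneg (rep_nonneg _)]; exact rep_lt_one _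
  rw [← sign_eq_one_iff, ← sign_eq_one_iff]
  simp only [sign_mul]
  rw [← sign_sin h1, ← sign_sin h2, ← sign_sin h3, ← sign_sin k1, ← sign_sin k3,
    ← sign_sin (abs_rep_sub_lt _ _)]
  simp only [← sign_mul]
  obtain ⟨m, hm⟩ := exists_rep_coe (Z - P)
  obtain ⟨n, hn⟩ := exists_rep_coe (Q - P)
  rw [AddCircle.coe_sub] at hm hn
  rw [hm, hn]
  rw [show Z - P + ↑m - 0 = (Z + m) - (P + (0 : ℤ)) by simp; ring,
    show Q - P + ↑n - 0 = (Q + n) - (P + (0 : ℤ)) by simp; ring,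
    show Q - P + ↑n - (Z - P + ↑m) = (Q + n) - (Z + m) by ring]
  simp only [sin_shift]
  have e : ((-1 : ℝ)) ^ (m - 0) * (-1) ^ (n - m) * (-1) ^ (n - 0) = 1 := by
    rw [← zpow_add₀ (by norm_num), ← zpow_add₀ (by norm_num)]
    apply Even.neg_one_zpow
    exact ⟨n, by ring⟩
  rw [show ∀ a b c a' b' c' : ℝ, (a * a') * (b * b') * (c * c') =
    (a * b * c) * (a' * b' * c') by intros; ring, e, one_mul]

/-! ### Coordinates relative to a base point -/

/-- The coordinate of `x` relative to the base point `a`. -/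
def crd (a x : S1) : ℝ := rep (x - a)

lemma crd_nonneg (a x : S1) : 0 ≤ crd a x := rep_nonneg _
lemma crd_lt_one (a x : S1) : crd a x < 1 := rep_lt_one _
@[simp] lemma crd_self (a : S1) : crd a a = 0 := by simp [crd]
lemma add_crd (a x : S1) : a + (crd a x : S1) = x := by simp [crd]
lemma crd_eq {a x : S1} {s : ℝ} (h : x = a + (s : S1)) (h0 : 0 ≤ s) (h1 : s < 1) :
    crd a x = s := rep_eq (by rw [h]; abel) h0 h1
lemma crd_add {a : S1} {s : ℝ} (h0 : 0 ≤ s) (h1 : s < 1) : crd a (a + (s : S1)) = s :=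
  crd_eq rfl h0 h1
lemma crd_inj {a x y : S1} (h : crd a x = crd a y) : x = y := by
  rw [← add_crd a x, h, add_crd]
lemma crd_eq_zero {a x : S1} : crd a x = 0 ↔ x = a := by
  rw [crd, rep_eq_zero, sub_eq_zero]

lemma Xs_rel (a : S1) {x z y w : S1} {X Z Y W : ℝ} (hx : x = a + (X : S1)) (hz : z = a + (Z : S1))
    (hy : y = a + (Y : S1)) (hw : w = a + (W : S1))
    (h1 : |Y - X| < 1) (h2 : |Y - Z| < 1) (h3 : |W - X| < 1) (h4 : |W - Z| < 1) :
    Xs x z y w ↔ (Y - X) * (Y - Z) * ((W - X) * (W - Z)) < 0 := by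
  have e := Xs_lift (X := rep a + X) (Z := rep a + Z) (Y := rep a + Y) (W := rep a + W)
    (by simpa using h1) (by simpa using h2) (by simpa using h3) (by simpa using h4)
  simp only [add_sub_add_left_eq_sub, AddCircle.coe_add, coe_rep, ← hx, ← hz, ← hy, ← hw] at e
  exact e

lemma cyc_rel (a : S1) {p z q : S1} {P Z Q : ℝ} (hp : p = a + (P : S1)) (hz : z = a + (Z : S1))
    (hq : q = a + (Q : S1)) (h1 : |Z - P| < 1) (h2 : |Q - Z| < 1) (h3 : |Q - P| < 1) :
    cyc p z q ↔ 0 < (Z - P) * (Q - Z) * (Q - P) := by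
  have e := cyc_lift (P := rep a + P) (Z := rep a + Z) (Q := rep a + Q)
    (by simpa using h1) (by simpa using h2) (by simpa using h3)
  simp only [add_sub_add_left_eq_sub, AddCircle.coe_add, coe_rep, ← hp, ← hz, ← hq] at e
  exact e

lemma abs_crd_sub_lt (a x y : S1) : |crd a x - crd a y| < 1 := abs_rep_sub_lt _ _

lemma Xs_crd (a x z y w : S1) : Xs x z y w ↔
    (crd a y - crd a x) * (crd a y - crd a z) * ((crd a w - crd a x) * (crd a w - crd a z)) < 0 :=
  Xs_rel a (add_crd a x).symm (add_crd a z).symm (add_crd a y).symm (add_crd a w).symm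
    (abs_crd_sub_lt _ _ _) (abs_crd_sub_lt _ _ _) (abs_crd_sub_lt _ _ _) (abs_crd_sub_lt _ _ _)

lemma cyc_crd (a p z q : S1) : cyc p z q ↔
    0 < (crd a z - crd a p) * (crd a q - crd a z) * (crd a q - crd a p) :=
  cyc_rel a (add_crd a p).symm (add_crd a z).symm (add_crd a q).symm
    (abs_crd_sub_lt _ _ _) (abs_crd_sub_lt _ _ _) (abs_crd_sub_lt _ _ _)

lemma cyc_base (p z q : S1) : cyc p z q ↔ 0 < crd p z ∧ crd p z < crd p q := Iff.rfl

lemma pos_prod3 {P Z Q : ℝ} : 0 < (Z - P) * (Q - Z) * (Q - P) ↔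
    (P < Z ∧ Z < Q) ∨ (Z < Q ∧ Q < P) ∨ (Q < P ∧ P < Z) := by
  constructor
  · intro h
    rcases lt_trichotomy P Z with a | a | a
    · rcases lt_trichotomy Z Q with b | b | b
      · exact Or.inl ⟨a, b⟩
      · simp [b] at h
      · right; right
        refine ⟨?_, a⟩
        by_contra hc
        push Not at hc
        have := mul_nonneg (mul_nonneg (sub_pos.2 a).le (sub_pos.2 b).le) (sub_nonneg.2 hc)
        linarith
    · simp [a] at h
    · right; left
      by_contra hc
      rw [not_and_or] at hc; push Not at hc
      rcases hc with hc | hc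
      · have := mul_nonneg (mul_nonneg (sub_pos.2 a).le (sub_nonneg.2 hc))
          (by linarith : 0 ≤ P - Q)
        linarith
      · have := mul_nonneg (mul_nonneg (sub_pos.2 a).le (by linarith : 0 ≤ Q - Z))
          (sub_nonneg.2 hc)
        linarith
  · rintro (⟨a, b⟩ | ⟨a, b⟩ | ⟨a, b⟩)
    · have := sub_pos.2 a; have := sub_pos.2 b; have := sub_pos.2 (a.trans b); positivity
    · have := mul_pos (mul_pos (sub_pos.2 (a.trans b)) (sub_pos.2 a)) (sub_pos.2 b); linarith
    · have := mul_pos (mul_pos (sub_pos.2 b) (sub_pos.2 (a.trans b))) (sub_pos.2 a); linarith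

/-- Cyclic order in coordinates relative to any base point. -/
lemma cyc_iff (a p z q : S1) : cyc p z q ↔
    (crd a p < crd a z ∧ crd a z < crd a q) ∨ (crd a z < crd a q ∧ crd a q < crd a p) ∨
      (crd a q < crd a p ∧ crd a p < crd a z) := by
  rw [cyc_crd a, pos_prod3]

lemma Xs_swap_left {x z y w : S1} : Xs x z y w ↔ Xs z x y w := by
  unfold Xs; rw [mul_comm (rep y - rep x), mul_comm (rep w - rep x)]
lemma Xs_swap_right {x z y w : S1} : Xs x z y w ↔ Xs x z w y := by
  unfold Xs; rw [mul_comm ((rep y - rep x) * _)]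
lemma Xs_comm {x z y w : S1} : Xs x z y w ↔ Xs y w x z := by
  unfold Xs
  rw [show (rep y - rep x) * (rep y - rep z) * ((rep w - rep x) * (rep w - rep z)) =
    (rep x - rep y) * (rep x - rep w) * ((rep z - rep y) * (rep z - rep w)) by ring]

lemma neg_prod4 {X Z Y W : ℝ} : (Y - X) * (Y - Z) * ((W - X) * (W - Z)) < 0 ↔
    ((Y - X) * (Y - Z) < 0 ∧ 0 < (W - X) * (W - Z)) ∨
    (0 < (Y - X) * (Y - Z) ∧ (W - X) * (W - Z) < 0) := by
  rw [mul_neg_iff, or_comm]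

lemma neg_prod2 {X Z Y : ℝ} : (Y - X) * (Y - Z) < 0 ↔ (X < Y ∧ Y < Z) ∨ (Z < Y ∧ Y < X) := by
  rw [mul_neg_iff]; simp only [sub_pos, sub_neg]; tauto

lemma pos_prod2 {X Z Y : ℝ} : 0 < (Y - X) * (Y - Z) ↔ (X < Y ∧ Z < Y) ∨ (Y < X ∧ Y < Z) := by
  rw [mul_pos_iff]; simp only [sub_pos, sub_neg]

/-- Crossing in coordinates. -/
lemma Xs_iff (a x z y w : S1) : Xs x z y w ↔
    (((crd a x < crd a y ∧ crd a y < crd a z) ∨ (crd a z < crd a y ∧ crd a y < crd a x)) ∧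
      ((crd a x < crd a w ∧ crd a z < crd a w) ∨ (crd a w < crd a x ∧ crd a w < crd a z))) ∨
    (((crd a x < crd a y ∧ crd a z < crd a y) ∨ (crd a y < crd a x ∧ crd a y < crd a z)) ∧
      ((crd a x < crd a w ∧ crd a w < crd a z) ∨ (crd a z < crd a w ∧ crd a w < crd a x))) := by
  rw [Xs_crd a, neg_prod4, neg_prod2, neg_prod2, pos_prod2, pos_prod2]

/-- Crossing in terms of the cyclic order. -/
lemma Xs_iff_cyc (x z y w : S1) :
    Xs x z y w ↔ (cyc x y z ∧ cyc z w x) ∨ (cyc x w z ∧ cyc z y x) := by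
  rw [Xs_iff x, cyc_iff x x y z, cyc_iff x z w x, cyc_iff x x w z, cyc_iff x z y x]
  have := crd_nonneg x y
  have := crd_nonneg x z
  have := crd_nonneg x w
  rw [crd_self]
  grind

end SymLam

namespace SymLam

lemma coe_one_eq_zero : ((1 : ℝ) : S1) = 0 := AddCircle.coe_period 1

lemma s3_add (a : S1) (X : ℝ) : s3 (a + (X : S1)) = s3 a + ((3 * X : ℝ) : S1) := by
  simp only [s3, smul_add]
  congr 1
  rw [← AddCircle.coe_nsmul]; congr 1; simp

lemma s3_sub (x y : S1) : s3 (x - y) = s3 x - s3 y := by simp only [s3, smul_sub]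

lemma continuous_s3 : Continuous s3 := continuous_nsmul 3

lemma continuous_antip : Continuous antip := continuous_id.add continuous_const

lemma antip_add (a : S1) (X : ℝ) : antip (a + (X : S1)) = a + ((X + 1 / 2 : ℝ) : S1) := by
  simp [antip, add_assoc]

lemma half_add_half : (((1 : ℝ) / 2 : ℝ) : S1) + (((1 : ℝ) / 2 : ℝ) : S1) = 0 := by
  rw [← AddCircle.coe_add, ← coe_one_eq_zero]; norm_num

@[simp] lemma antip_antip (x : S1) : antip (antip x) = x := by
  simp only [antip, add_assoc, half_add_half, add_zero]

lemma s3_antip (x : S1) : s3 (antip x) = antip (s3 x) := by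
  rw [antip, s3_add, antip]
  congr 1
  exact coe_eq_coe_iff.2 ⟨1, by norm_num⟩

/-- The identity or the antipodal map. -/
def sg : Bool → S1 → S1
  | false => id
  | true => antip

@[simp] lemma sg_false (x : S1) : sg false x = x := rfl
@[simp] lemma sg_true (x : S1) : sg true x = antip x := rfl

lemma s3_sg (s : Bool) (x : S1) : s3 (sg s x) = sg s (s3 x) := by
  cases s <;> simp [s3_antip]

lemma iter_sg (s : Bool) (n : ℕ) (x : S1) : s3^[n] (sg s x) = sg s (s3^[n] x) := by
  induction n generalizing x with
  | zero => rfl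
  | succ n ih => rw [Function.iterate_succ_apply, s3_sg, ih, Function.iterate_succ_apply]

lemma sg_sg (s s' : Bool) (x : S1) : sg s (sg s' x) = sg (xor s s') x := by
  cases s <;> cases s' <;> simp

@[simp] lemma sg_sg_self (s : Bool) (x : S1) : sg s (sg s x) = x := by
  cases s <;> simp

lemma sg_injective (s : Bool) : Function.Injective (sg s) := fun x y h => by
  rw [← sg_sg_self s x, h, sg_sg_self]

lemma continuous_sg (s : Bool) : Continuous (sg s) := by
  cases s
  · exact continuous_id
  · exact continuous_antip

lemma sg_sub_sg (s : Bool) (x y : S1) : sg s x - sg s y = x - y := by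
  cases s <;> simp [antip]

lemma cyc_sg (s : Bool) {p z q : S1} : cyc (sg s p) (sg s z) (sg s q) ↔ cyc p z q := by
  unfold cyc; simp only [sg_sub_sg]

lemma Xs_sg (s : Bool) {x z y w : S1} :
    Xs (sg s x) (sg s z) (sg s y) (sg s w) ↔ Xs x z y w := by
  simp only [Xs_iff_cyc, cyc_sg]

lemma norm_rel (a : S1) {x y : S1} {X Y : ℝ} (hx : x = a + (X : S1)) (hy : y = a + (Y : S1))
    (h : |X - Y| ≤ 1) : ‖x - y‖ = min |X - Y| (1 - |X - Y|) := by
  rw [← norm_coe_of_le_one h, hx, hy]; congr 1; simp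

lemma crd_sg (s : Bool) (a x : S1) : crd (sg s a) (sg s x) = crd a x := by
  simp [crd, sg_sub_sg]

lemma norm_crd (a x y : S1) :
    ‖x - y‖ = min |crd a x - crd a y| (1 - |crd a x - crd a y|) :=
  norm_rel a (add_crd a x).symm (add_crd a y).symm (abs_crd_sub_lt a x y).le

/-- How lengths change under tripling. -/
lemma norm_s3 (x y : S1) :
    (‖x - y‖ ≤ 1 / 6 ∧ ‖s3 x - s3 y‖ = 3 * ‖x - y‖) ∨
    (1 / 6 ≤ ‖x - y‖ ∧ ‖s3 x - s3 y‖ = |1 - 3 * ‖x - y‖|) := by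
  rw [← s3_sub]
  generalize x - y = z
  have hz := norm_eq_min z
  have h0 := rep_nonneg z
  have h1 := rep_lt_one z
  have key : ∃ d : ℝ, 0 ≤ d ∧ d ≤ 1 / 2 ∧ ‖z‖ = d ∧ ‖s3 z‖ = ‖((3 * d : ℝ) : S1)‖ := by
    rcases le_total (rep z) (1 / 2) with h | h
    · refine ⟨rep z, h0, h, by rw [hz, min_eq_left (by linarith)], ?_⟩
      conv_lhs => rw [← zero_add z, ← coe_rep z, s3_add]
      simp [s3]
    · refine ⟨1 - rep z, by linarith, by linarith, by rw [hz, min_eq_right (by linarith)], ?_⟩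
      conv_lhs => rw [← zero_add z, ← coe_rep z, s3_add]
      have : ((3 * (1 - rep z) : ℝ) : S1) = -((3 * rep z : ℝ) : S1) := by
        rw [← AddCircle.coe_neg, coe_eq_coe_iff]
        exact ⟨3, by push_cast; ring⟩
      rw [this, norm_neg]
      simp [s3]
  obtain ⟨d, hd0, hd1, hd, hs⟩ := key
  rw [hd, hs]
  rcases le_total d (1 / 6) with h | h
  · left
    refine ⟨h, ?_⟩
    rw [norm_coe_of_abs_le (by rw [abs_of_nonneg (by linarith)]; linarith),
      abs_of_nonneg (by linarith)]
  · right
    refine ⟨h, ?_⟩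
    have : ((3 * d : ℝ) : S1) = ((3 * d - 1 : ℝ) : S1) :=
      coe_eq_coe_iff.2 ⟨1, by push_cast; ring⟩
    rw [this, norm_coe_of_abs_le (by rw [abs_le]; constructor <;> linarith), abs_sub_comm]

lemma Xs_of_sorted {a b c d : ℝ} (h1 : a < b) (h2 : b < c) (h3 : c < d) (h4 : d < a + 1) :
    Xs (a : S1) c b d := by
  rw [Xs_lift]
  · have := sub_pos.2 h1
    have := sub_pos.2 h2
    have := sub_pos.2 (h2.trans h3)
    have := sub_pos.2 h3
    have := mul_pos (mul_pos (sub_pos.2 h1) (sub_pos.2 h2))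
      (mul_pos (sub_pos.2 (h1.trans (h2.trans h3))) (sub_pos.2 h3))
    linarith
  all_goals rw [abs_lt]; constructor <;> linarith

lemma crosses_iff {x z y w : S1} : Crosses s(x, z) s(y, w) ↔ Xs x z y w := by
  constructor
  · rintro (⟨a, b, c, d, h1, h2, h3, h4, e1, e2⟩ | ⟨a, b, c, d, h1, h2, h3, h4, e1, e2⟩)
    · have h := Xs_of_sorted h1 h2 h3 h4
      rcases Sym2.eq_iff.1 e1 with ⟨rfl, rfl⟩ | ⟨rfl, rfl⟩ <;>
      rcases Sym2.eq_iff.1 e2 with ⟨rfl, rfl⟩ | ⟨rfl, rfl⟩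
      · exact h
      · exact Xs_swap_right.1 h
      · exact Xs_swap_left.1 h
      · exact Xs_swap_left.1 (Xs_swap_right.1 h)
    · have h := Xs_comm.1 (Xs_of_sorted h1 h2 h3 h4)
      rcases Sym2.eq_iff.1 e1 with ⟨rfl, rfl⟩ | ⟨rfl, rfl⟩ <;>
      rcases Sym2.eq_iff.1 e2 with ⟨rfl, rfl⟩ | ⟨rfl, rfl⟩
      · exact h
      · exact Xs_swap_left.1 h
      · exact Xs_swap_right.1 h
      · exact Xs_swap_left.1 (Xs_swap_right.1 h)
  · intro h
    rw [Xs_iff x] at h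
    simp only [crd_self] at h
    have := crd_nonneg x y
    have := crd_nonneg x z
    have := crd_nonneg x w
    have hy := crd_lt_one x y
    have hw := crd_lt_one x w
    have e : ∀ u, ((rep x + crd x u : ℝ) : S1) = u := fun u => by simp [add_crd]
    have h' : (0 < crd x y ∧ crd x y < crd x z ∧ crd x z < crd x w) ∨
      (0 < crd x w ∧ crd x w < crd x z ∧ crd x z < crd x y) := by grind
    rcases h' with ⟨a1, a2, a3⟩ | ⟨a1, a2, a3⟩
    · exact Or.inl ⟨rep x, rep x + crd x y, rep x + crd x z, rep x + crd x w, by linarith,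
        by linarith, by linarith, by linarith, by rw [e, coe_rep], by rw [e, e]⟩
    · exact Or.inl ⟨rep x, rep x + crd x w, rep x + crd x z, rep x + crd x y, by linarith,
        by linarith, by linarith, by linarith, by rw [e, coe_rep], by rw [e, e, Sym2.eq_swap]⟩

end SymLam

namespace SymLam

/-- Labels of the pieces into which a short chord and its siblings divide the circle. -/
inductive Pc | A | B | D | K1 | K2 | K3 | K4

/-- The antipodal piece. -/
def Pc.neg : Pc → Pc
  | .A => .D | .B => .B | .D => .A | .K1 => .K3 | .K2 => .K4 | .K3 => .K1 | .K4 => .K2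

/-- Membership of the coordinate `ρ` in the closed piece with a given label. -/
def inC (t : ℝ) : Pc → ℝ → Prop
  | .A, ρ => t + 1/3 ≤ ρ ∧ ρ ≤ 2/3
  | .B, ρ => (t + 1/6 ≤ ρ ∧ ρ ≤ 1/3) ∨ (t + 2/3 ≤ ρ ∧ ρ ≤ 5/6)
  | .D, ρ => ρ ≤ 1/6 ∨ t + 5/6 ≤ ρ
  | .K1, ρ => 1/6 ≤ ρ ∧ ρ ≤ t + 1/6
  | .K2, ρ => 1/3 ≤ ρ ∧ ρ ≤ t + 1/3
  | .K3, ρ => 2/3 ≤ ρ ∧ ρ ≤ t + 2/3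
  | .K4, ρ => 5/6 ≤ ρ ∧ ρ ≤ t + 5/6

/-- The closed pieces determined by the chord `{a, a+t}`. -/
def inP (a : S1) (t : ℝ) (P : Pc) (x : S1) : Prop := inC t P (crd a x)

/-- A lift of a coordinate adapted to a piece. -/
def xl : Pc → ℝ → ℝ
  | .D, ρ => if ρ ≤ 1/6 then ρ else ρ - 1
  | _, ρ => ρ

/-- A lift of the image adapted to a piece. -/
def yl : Pc → ℝ → ℝ
  | .D, ρ => if ρ ≤ 1/6 then 3 * ρ else 3 * ρ - 3
  | .B, ρ => if ρ ≤ 1/3 then 3 * ρ else 3 * ρ - 1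
  | _, ρ => 3 * ρ

lemma coe_sub_one (s : ℝ) : ((s - 1 : ℝ) : S1) = s :=
  coe_eq_coe_iff.2 ⟨-1, by push_cast; ring⟩

lemma xl_spec (a : S1) (P : Pc) (x : S1) : x = a + (xl P (crd a x) : S1) := by
  cases P <;> simp only [xl] <;> try exact (add_crd a x).symm
  split_ifs
  · exact (add_crd a x).symm
  · rw [coe_sub_one]; exact (add_crd a x).symm

lemma s3_crd (a x : S1) : s3 x = s3 a + ((3 * crd a x : ℝ) : S1) := by
  rw [← s3_add, add_crd]

lemma yl_spec (a : S1) (P : Pc) (x : S1) : s3 x = s3 a + (yl P (crd a x) : S1) := by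
  cases P <;> simp only [yl] <;> try exact s3_crd a x
  · split_ifs
    · exact s3_crd a x
    · rw [coe_sub_one]; exact s3_crd a x
  · split_ifs
    · exact s3_crd a x
    · rw [s3_crd a x]; congr 1; exact coe_eq_coe_iff.2 ⟨3, by push_cast; ring⟩

variable {a : S1} {t : ℝ} {P Q : Pc} {x y z w : S1}

lemma lift_facts (ht : 0 < t) (ht' : t < 1/6) (hx : inP a t P x) (hy : inP a t P y) :
    |xl P (crd a x) - xl P (crd a y)| < 1 ∧ |yl P (crd a x) - yl P (crd a y)| < 1 ∧
    (xl P (crd a x) < xl P (crd a y) ↔ yl P (crd a x) < yl P (crd a y)) := by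
  have hx0 := crd_nonneg a x
  have hy0 := crd_nonneg a y
  have hx1 := crd_lt_one a x
  have hy1 := crd_lt_one a y
  unfold inP at hx hy
  generalize crd a x = p at *
  generalize crd a y = q at *
  cases P <;> simp only [inC, xl, yl] at * <;>
  · refine ⟨?_, ?_, ?_⟩
    · rw [abs_lt]; constructor <;> (try split_ifs) <;> grind
    · rw [abs_lt]; constructor <;> (try split_ifs) <;> grind
    · (try split_ifs) <;> grind

lemma Xs_image_iff (ht : 0 < t) (ht' : t < 1/6) (hx : inP a t P x) (hz : inP a t P z)
    (hy : inP a t P y) (hw : inP a t P w) : Xs (s3 x) (s3 z) (s3 y) (s3 w) ↔ Xs x z y w := by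
  have f := fun {u v} hu hv => lift_facts (a := a) (P := P) (x := u) (y := v) ht ht' hu hv
  rw [Xs_rel a (xl_spec a P x) (xl_spec a P z) (xl_spec a P y) (xl_spec a P w) (f hy hx).1
      (f hy hz).1 (f hw hx).1 (f hw hz).1,
    Xs_rel (s3 a) (yl_spec a P x) (yl_spec a P z) (yl_spec a P y) (yl_spec a P w) (f hy hx).2.1
      (f hy hz).2.1 (f hw hx).2.1 (f hw hz).2.1]
  simp only [neg_prod4, neg_prod2, pos_prod2, (f hx hy).2.2, (f hy hx).2.2, (f hx hw).2.2,
    (f hw hx).2.2, (f hz hy).2.2, (f hy hz).2.2, (f hz hw).2.2, (f hw hz).2.2]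

lemma cyc_image_iff (ht : 0 < t) (ht' : t < 1/6) (hx : inP a t P x) (hz : inP a t P z)
    (hy : inP a t P y) : cyc (s3 x) (s3 z) (s3 y) ↔ cyc x z y := by
  have f := fun {u v} hu hv => lift_facts (a := a) (P := P) (x := u) (y := v) ht ht' hu hv
  rw [cyc_rel a (xl_spec a P x) (xl_spec a P z) (xl_spec a P y) (f hz hx).1 (f hy hz).1 (f hy hx).1,
    cyc_rel (s3 a) (yl_spec a P x) (yl_spec a P z) (yl_spec a P y) (f hz hx).2.1 (f hy hz).2.1
      (f hy hx).2.1]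
  simp only [pos_prod3, (f hy hx).2.2, (f hx hz).2.2,
    (f hz hy).2.2]

lemma s3_inj_on (ht : 0 < t) (ht' : t < 1/6) (hx : inP a t P x) (hy : inP a t P y)
    (h : s3 x = s3 y) : x = y := by
  obtain ⟨h1, h2, h3⟩ := lift_facts ht ht' hx hy
  obtain ⟨-, -, h4⟩ := lift_facts ht ht' hy hx
  rw [yl_spec a P x, yl_spec a P y] at h
  obtain ⟨n, hn⟩ := coe_eq_coe_iff.1 (add_left_cancel h)
  have hn0 : n = 0 := by
    rw [hn, add_sub_cancel_left] at h2
    have : |n| < 1 := by exact_mod_cast h2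
    exact Int.abs_lt_one_iff.1 this
  rw [hn0, Int.cast_zero, add_zero] at hn
  have e : xl P (crd a x) = xl P (crd a y) := by
    apply le_antisymm
    · rw [← not_lt, h4, hn]; exact lt_irrefl _
    · rw [← not_lt, h3, hn]; exact lt_irrefl _
  rw [xl_spec a P x, xl_spec a P y, e]

/-- Pairs in different pieces do not cross. -/
lemma not_Xs_of_ne (ht : 0 < t) (ht' : t < 1/6) (hPQ : P ≠ Q) (hx : inP a t P x)
    (hz : inP a t P z) (hy : inP a t Q y) (hw : inP a t Q w) : ¬ Xs x z y w := by
  rw [Xs_iff a]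
  have hx0 := crd_nonneg a x
  have hx1 := crd_lt_one a x
  have hy0 := crd_nonneg a y
  have hy1 := crd_lt_one a y
  have hz0 := crd_nonneg a z
  have hz1 := crd_lt_one a z
  have hw0 := crd_nonneg a w
  have hw1 := crd_lt_one a w
  unfold inP at hx hy hz hw
  generalize crd a x = x at *
  generalize crd a y = y at *
  generalize crd a z = z at *
  generalize crd a w = w at *
  cases P <;> cases Q <;> first | exact absurd rfl hPQ | (simp only [inC] at *; grind)

end SymLam

namespace SymLam

variable {a : S1} {t : ℝ} {P Q : Pc} {x y z w : S1}

/-- The closed arc from `a+u` to `a+v`. -/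
def arcI (a : S1) (u v : ℝ) : Set S1 := (fun s : ℝ => a + (s : S1)) '' Icc u v

lemma isClosed_arcI (a : S1) (u v : ℝ) : IsClosed (arcI a u v) := by
  have : Continuous (fun s : ℝ => a + (s : S1)) :=
    continuous_const.add (AddCircle.continuous_mk' 1)
  exact (isCompact_Icc.image this).isClosed

lemma mem_arcI_iff {u v : ℝ} (h0 : 0 ≤ u) (h1 : v < 1) :
    x ∈ arcI a u v ↔ u ≤ crd a x ∧ crd a x ≤ v := by
  constructor
  · rintro ⟨s, ⟨h2, h3⟩, rfl⟩
    simp only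
    rw [crd_add (by linarith) (by linarith)]; exact ⟨h2, h3⟩
  · intro h; exact ⟨crd a x, h, add_crd a x⟩

lemma mem_arcI_iff_zero {u v : ℝ} (h0 : u < 0) (h0' : 0 ≤ v) (h1 : v < u + 1) :
    x ∈ arcI a u v ↔ crd a x ≤ v ∨ u + 1 ≤ crd a x := by
  constructor
  · rintro ⟨s, ⟨h2, h3⟩, rfl⟩
    simp only
    rcases le_or_gt 0 s with h | h
    · rw [crd_add h (by linarith)]; exact Or.inl h3
    · have : a + (s : S1) = a + ((s + 1 : ℝ) : S1) := by
        rw [AddCircle.coe_add, coe_one_eq_zero, add_zero]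
      rw [this, crd_add (by linarith) (by linarith)]; right; linarith
  · rintro (h | h)
    · exact ⟨crd a x, ⟨by linarith [crd_nonneg a x], h⟩, add_crd a x⟩
    · refine ⟨crd a x - 1, ⟨by linarith, by linarith [crd_lt_one a x]⟩, ?_⟩
      simp only [coe_sub_one]; exact add_crd a x

lemma isClosed_inP (ht : 0 < t) (ht' : t < 1/6) (P : Pc) : IsClosed {x | inP a t P x} := by
  have key : ∀ u v : ℝ, 0 ≤ u → v < 1 → IsClosed {x | u ≤ crd a x ∧ crd a x ≤ v} := by
    intro u v h0 h1
    convert isClosed_arcI a u v using 1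
    ext x; exact (mem_arcI_iff h0 h1).symm
  cases P <;> simp only [inP, inC]
  · exact key _ _ (by linarith) (by norm_num)
  · exact (key _ _ (by linarith) (by norm_num)).union (key _ _ (by linarith) (by norm_num))
  · have := isClosed_arcI a (t - 1/6) (1/6)
    convert this using 1
    ext x
    rw [mem_arcI_iff_zero (by linarith) (by norm_num) (by linarith)]
    simp only [mem_ofPred_eq, show t - 1/6 + 1 = t + 5/6 by ring]
  all_goals exact key _ _ (by norm_num) (by linarith)

/-- Both points lie in a common closed piece. -/
def Good (a : S1) (t : ℝ) (x y : S1) : Prop := ∃ P, inP a t P x ∧ inP a t P y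

lemma Good.symm (h : Good a t x y) : Good a t y x := h.imp fun _ h => ⟨h.2, h.1⟩

lemma good_iff : Good a t x y ↔ (inP a t .A x ∧ inP a t .A y) ∨ (inP a t .B x ∧ inP a t .B y) ∨
    (inP a t .D x ∧ inP a t .D y) ∨ (inP a t .K1 x ∧ inP a t .K1 y) ∨
    (inP a t .K2 x ∧ inP a t .K2 y) ∨ (inP a t .K3 x ∧ inP a t .K3 y) ∨
    (inP a t .K4 x ∧ inP a t .K4 y) := by
  constructor
  · rintro ⟨P, h⟩; cases P <;> simp [h]
  · rintro (h | h | h | h | h | h | h) <;> exact ⟨_, h⟩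

lemma isClosed_good (ht : 0 < t) (ht' : t < 1/6) :
    IsClosed {q : S1 × S1 | Good a t q.1 q.2} := by
  have k : ∀ P, IsClosed {q : S1 × S1 | inP a t P q.1 ∧ inP a t P q.2} := fun P =>
    (isClosed_inP ht ht' P).prod (isClosed_inP ht ht' P)
  have : {q : S1 × S1 | Good a t q.1 q.2} =
    {q | inP a t .A q.1 ∧ inP a t .A q.2} ∪ ({q | inP a t .B q.1 ∧ inP a t .B q.2} ∪
    ({q | inP a t .D q.1 ∧ inP a t .D q.2} ∪ ({q | inP a t .K1 q.1 ∧ inP a t .K1 q.2} ∪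
    ({q | inP a t .K2 q.1 ∧ inP a t .K2 q.2} ∪ ({q | inP a t .K3 q.1 ∧ inP a t .K3 q.2} ∪
    {q | inP a t .K4 q.1 ∧ inP a t .K4 q.2}))))) := by
    ext q; simp only [mem_ofPred_eq, good_iff, mem_union]
  rw [this]
  exact (k _).union ((k _).union ((k _).union ((k _).union ((k _).union ((k _).union (k _))))))

/-- Crossing persists under tripling for pairs in common pieces. -/
lemma Xs_image (ht : 0 < t) (ht' : t < 1/6) (h1 : Good a t x z) (h2 : Good a t y w)
    (h : Xs x z y w) : Xs (s3 x) (s3 z) (s3 y) (s3 w) := by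
  obtain ⟨P, hx, hz⟩ := h1
  obtain ⟨Q, hy, hw⟩ := h2
  by_cases e : P = Q
  · subst e; exact (Xs_image_iff ht ht' hx hz hy hw).2 h
  · exact absurd h (not_Xs_of_ne ht ht' e hx hz hy hw)

lemma crd_antip (ht : 0 ≤ crd a x) : crd a (antip x) = crd a x + 1/2 ∨
    crd a (antip x) = crd a x - 1/2 := by
  have e : antip x = a + ((crd a x + 1/2 : ℝ) : S1) := by rw [← antip_add, add_crd]
  have e' : antip x = a + ((crd a x - 1/2 : ℝ) : S1) := by
    rw [e]; congr 1; exact coe_eq_coe_iff.2 ⟨1, by push_cast; ring⟩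
  have := crd_lt_one a x
  rcases lt_or_ge (crd a x) (1/2) with h | h
  · left; exact crd_eq e (by linarith) (by linarith)
  · right; exact crd_eq e' (by linarith) (by linarith)

lemma inP_antip (ht : 0 < t) (ht' : t < 1/6) (h : inP a t P x) : inP a t P.neg (antip x) := by
  have h0 := crd_nonneg a x
  have h1 := crd_lt_one a x
  have h2 := crd_nonneg a (antip x)
  have h3 := crd_lt_one a (antip x)
  have h4 := crd_antip (crd_nonneg a x)
  unfold inP at *
  generalize crd a x = p at *
  generalize crd a (antip x) = q at *
  cases P <;> simp only [inC, Pc.neg] at * <;> grind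

lemma Pc.neg_neg (P : Pc) : P.neg.neg = P := by cases P <;> rfl

lemma Good.sg (ht : 0 < t) (ht' : t < 1/6) (s : Bool) (h : Good a t x y) :
    Good a t (sg s x) (sg s y) := by
  cases s
  · exact h
  · obtain ⟨P, h1, h2⟩ := h
    exact ⟨P.neg, inP_antip ht ht' h1, inP_antip ht ht' h2⟩

/-- The distance from `1/3` of the length of a pair in a common piece. -/
lemma good_dist (ht : 0 < t) (ht' : t < 1/6) (h : Good a t x y) :
    t ≤ |1/3 - ‖x - y‖| := by
  rw [norm_crd a]
  have hx0 := crd_nonneg a x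
  have hx1 := crd_lt_one a x
  have hy0 := crd_nonneg a y
  have hy1 := crd_lt_one a y
  rw [good_iff] at h
  unfold inP at h
  generalize crd a x = p at *
  generalize crd a y = q at *
  simp only [inC] at h
  rw [le_abs]
  rcases abs_cases (p - q) with ⟨e, _⟩ | ⟨e, _⟩ <;> rw [e] <;>
  rcases min_cases (p - q) (1 - (p - q)) with ⟨e', _⟩ | ⟨e', _⟩ <;>
  rcases min_cases (-(p - q)) (1 - -(p - q)) with ⟨e'', _⟩ | ⟨e'', _⟩ <;> grind

/-- The pairs in common pieces whose length is nearest to `1/3`. -/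
lemma good_dist_eq (ht : 0 < t) (ht' : t < 1/6) (h : Good a t x y)
    (h' : |1/3 - ‖x - y‖| ≤ t) :
    (crd a x = 2/3 ∧ crd a y = t + 1/3) ∨ (crd a y = 2/3 ∧ crd a x = t + 1/3) ∨
    (crd a x = 1/6 ∧ crd a y = t + 5/6) ∨ (crd a y = 1/6 ∧ crd a x = t + 5/6) ∨
    (crd a x = 1/3 ∧ crd a y = t + 2/3) ∨ (crd a y = 1/3 ∧ crd a x = t + 2/3) ∨
    (crd a x = 5/6 ∧ crd a y = t + 1/6) ∨ (crd a y = 5/6 ∧ crd a x = t + 1/6) := by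
  rw [norm_crd a] at h'
  have hx0 := crd_nonneg a x
  have hx1 := crd_lt_one a x
  have hy0 := crd_nonneg a y
  have hy1 := crd_lt_one a y
  rw [good_iff] at h
  unfold inP at h
  generalize crd a x = p at *
  generalize crd a y = q at *
  simp only [inC] at h
  rw [abs_le] at h'
  obtain ⟨h1, h2⟩ := h'
  rcases abs_cases (p - q) with ⟨e, _⟩ | ⟨e, _⟩ <;> rw [e] at h1 h2
  · rcases min_cases (p - q) (1 - (p - q)) with ⟨e', _⟩ | ⟨e', _⟩ <;> rw [e'] at h1 h2 <;> grind
  · rcases min_cases (-(p - q)) (1 - -(p - q)) with ⟨e'', _⟩ | ⟨e'', _⟩ <;> rw [e''] at h1 h2 <;>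
      grind

end SymLam

namespace SymLam

variable {x y z w p q : S1}

/-- Twice the signed area of the triangle `p q w`. -/
def dt (p q w : ℂ) : ℝ := (q.re - p.re) * (w.im - p.im) - (q.im - p.im) * (w.re - p.re)

lemma toC_eq_exp (x : S1) : toC x = Complex.exp (((2 * Real.pi * rep x : ℝ) : ℂ) * Complex.I) := by
  unfold toC rep; congr 1; push_cast; ring

lemma toC_re (x : S1) : (toC x).re = Real.cos (2 * Real.pi * rep x) := by
  rw [toC_eq_exp, Complex.exp_ofReal_mul_I_re]

lemma toC_im (x : S1) : (toC x).im = Real.sin (2 * Real.pi * rep x) := by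
  rw [toC_eq_exp, Complex.exp_ofReal_mul_I_im]

lemma toC_coe (s : ℝ) : toC (s : S1) =
    Complex.exp (((2 * Real.pi * s : ℝ) : ℂ) * Complex.I) := by
  obtain ⟨n, hn⟩ := exists_rep_coe s
  apply Complex.ext
  · rw [toC_re, Complex.exp_ofReal_mul_I_re, hn, mul_add, mul_comm (2 * Real.pi) (n : ℝ),
      Real.cos_add_int_mul_two_pi]
  · rw [toC_im, Complex.exp_ofReal_mul_I_im, hn, mul_add, mul_comm (2 * Real.pi) (n : ℝ),
      Real.sin_add_int_mul_two_pi]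

lemma continuous_toC : Continuous toC := by
  have h : Continuous (toC ∘ (QuotientAddGroup.mk : ℝ → S1)) := by
    have : toC ∘ (QuotientAddGroup.mk : ℝ → S1) = fun s : ℝ =>
        Complex.exp (((2 * Real.pi * s : ℝ) : ℂ) * Complex.I) := funext toC_coe
    rw [this]; fun_prop
  exact continuous_coinduced_dom.2 h

lemma norm_toC (x : S1) : ‖toC x‖ = 1 := by
  rw [toC_eq_exp, Complex.norm_exp_ofReal_mul_I]

lemma toC_mem_closedDisk (x : S1) : toC x ∈ closedDisk := by
  simp [closedDisk, norm_toC]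

lemma sin_sub_sin_dbl (u v : ℝ) : Real.sin (2 * Real.pi * u) - Real.sin (2 * Real.pi * v) =
    2 * Real.sin (Real.pi * (u - v)) * Real.cos (Real.pi * (u + v)) := by
  rw [Real.sin_sub_sin]; congr 2
  · congr 1; ring
  · ring

lemma cos_sub_cos_dbl (u v : ℝ) : Real.cos (2 * Real.pi * u) - Real.cos (2 * Real.pi * v) =
    -2 * Real.sin (Real.pi * (u - v)) * Real.sin (Real.pi * (u + v)) := by
  rw [Real.cos_sub_cos, show (2 * Real.pi * u + 2 * Real.pi * v) / 2 = Real.pi * (u + v) by ring,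
    show (2 * Real.pi * u - 2 * Real.pi * v) / 2 = Real.pi * (u - v) by ring]
  ring

lemma dt_toC (p q z : S1) : dt (toC p) (toC q) (toC z) =
    -4 * (Real.sin (Real.pi * (rep z - rep p)) * Real.sin (Real.pi * (rep q - rep z)) *
      Real.sin (Real.pi * (rep q - rep p))) := by
  unfold dt
  rw [toC_re, toC_re, toC_re, toC_im, toC_im, toC_im, sin_sub_sin_dbl, sin_sub_sin_dbl,
    cos_sub_cos_dbl, cos_sub_cos_dbl]
  have : Real.sin (Real.pi * (rep q - rep z)) =
    Real.sin (Real.pi * (rep q + rep p)) * Real.cos (Real.pi * (rep z + rep p)) -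
    Real.cos (Real.pi * (rep q + rep p)) * Real.sin (Real.pi * (rep z + rep p)) := by
    rw [← Real.sin_sub]; congr 1; ring
  rw [this]; ring

lemma dt_neg_iff : dt (toC p) (toC q) (toC z) < 0 ↔ cyc p z q := by
  have h := cyc_lift (abs_rep_sub_lt z p) (abs_rep_sub_lt q z) (abs_rep_sub_lt q p)
  simp only [coe_rep] at h
  rw [h, dt_toC, ← sign_eq_one_iff, sign_mul, sign_mul, ← sign_sin (abs_rep_sub_lt z p),
    ← sign_sin (abs_rep_sub_lt q z), ← sign_sin (abs_rep_sub_lt q p), ← sign_mul, ← sign_mul,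
    sign_eq_one_iff]
  constructor <;> intro h <;> linarith

lemma dt_swap (p q w : ℂ) : dt q p w = - dt p q w := by unfold dt; ring

lemma dt_pos_iff : 0 < dt (toC p) (toC q) (toC z) ↔ cyc q z p := by
  rw [← dt_neg_iff, dt_swap]; simp

lemma dt_left (p q : ℂ) : dt p q p = 0 := by unfold dt; ring
lemma dt_right (p q : ℂ) : dt p q q = 0 := by unfold dt; ring

lemma dt_comb (p q u v : ℂ) {s s' : ℝ} (h : s + s' = 1) :
    dt p q (s • u + s' • v) = s * dt p q u + s' * dt p q v := by
  have : s' = 1 - s := by linarith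
  subst this
  simp only [dt, Complex.add_re, Complex.add_im, Complex.real_smul, Complex.mul_re, Complex.mul_im,
    Complex.ofReal_re, Complex.ofReal_im]
  ring

lemma dt_segment {p q u v w : ℂ} (hw : w ∈ segment ℝ u v) :
    ∃ s s' : ℝ, 0 ≤ s ∧ 0 ≤ s' ∧ s + s' = 1 ∧ dt p q w = s * dt p q u + s' * dt p q v := by
  obtain ⟨s, s', h1, h2, h3, rfl⟩ := hw
  exact ⟨s, s', h1, h2, h3, dt_comb _ _ _ _ h3⟩

lemma dt_segment_zero {p q w : ℂ} (hw : w ∈ segment ℝ p q) : dt p q w = 0 := by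
  obtain ⟨s, s', h1, h2, h3, e⟩ := dt_segment (p := p) (q := q) hw
  rw [e, dt_left, dt_right]; ring

lemma dt_segment_pos {p q u v w : ℂ} (hw : w ∈ segment ℝ u v) (hu : 0 < dt p q u)
    (hv : 0 < dt p q v) : 0 < dt p q w := by
  obtain ⟨s, s', h1, h2, h3, e⟩ := dt_segment (p := p) (q := q) hw
  rw [e]
  rcases h1.eq_or_lt with h | h
  · rw [← h] at h3 ⊢; simp at h3; simpa [h3]
  · have := mul_pos h hu; have := mul_nonneg h2 hv.le; linarith

lemma cyc_or (hz1 : z ≠ p) (hz2 : z ≠ q) (hpq : p ≠ q) : cyc p z q ∨ cyc q z p := by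
  have h1 := fun h => hz1 (crd_inj (a := 0) h)
  have h2 := fun h => hz2 (crd_inj (a := 0) h)
  have h3 := fun h => hpq (crd_inj (a := 0) h)
  rw [cyc_iff 0, cyc_iff 0]
  generalize crd 0 z = Z at *
  generalize crd 0 p = P at *
  generalize crd 0 q = Q at *
  grind

lemma cyc_ne (h : cyc p z q) : z ≠ p ∧ z ≠ q ∧ p ≠ q := by
  rw [cyc_iff 0] at h
  refine ⟨?_, ?_, ?_⟩ <;> rintro rfl <;> grind

lemma chordSet_mk (x y : S1) : chordSet s(x, y) = segment ℝ (toC x) (toC y) := rfl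

/-- Noncrossing chords with distinct endpoints are disjoint. -/
lemma disjoint_chordSet (h : ¬ Xs x z y w) (hxz : x ≠ z) (h1 : y ≠ x) (h2 : y ≠ z) (h3 : w ≠ x)
    (h4 : w ≠ z) : Disjoint (chordSet s(x, z)) (chordSet s(y, w)) := by
  rw [Set.disjoint_left, chordSet_mk, chordSet_mk]
  intro u hu hu'
  have h0 := dt_segment_zero hu
  rw [Xs_iff_cyc] at h
  rcases cyc_or h1 h2 hxz with a | a <;> rcases cyc_or h3 h4 hxz with b | b
  · have := dt_segment_pos hu' (dt_pos_iff.2 a) (dt_pos_iff.2 b)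
    rw [dt_swap] at this; linarith
  · exact h (Or.inl ⟨a, b⟩)
  · exact h (Or.inr ⟨b, a⟩)
  · have := dt_segment_pos hu' (dt_pos_iff.2 a) (dt_pos_iff.2 b)
    linarith

lemma exists_cyc (h : x ≠ y) : ∃ z, cyc x z y := by
  have h0 : 0 < crd x y := (crd_nonneg x y).lt_of_ne fun e => h (crd_eq_zero.1 e.symm).symm
  have h1 := crd_lt_one x y
  refine ⟨x + ((crd x y / 2 : ℝ) : S1), ?_⟩
  rw [cyc_base, crd_add (by linarith) (by linarith)]
  constructor <;> linarith

lemma toC_injective : Function.Injective toC := by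
  intro x y h
  by_contra hne
  obtain ⟨z, hz⟩ := exists_cyc hne
  have e : dt (toC x) (toC y) (toC z) = 0 := by rw [h]; unfold dt; ring
  have := dt_neg_iff.2 hz
  linarith

end SymLam

namespace SymLam

variable {a : S1} {t : ℝ} {P Q : Pc} {x y z w : S1}

lemma good_crd : Good a t x y ↔ ∃ P, inC t P (crd a x) ∧ inC t P (crd a y) := Iff.rfl

lemma exC_iff {p q : ℝ} : (∃ P, inC t P p ∧ inC t P q) ↔
    (inC t .A p ∧ inC t .A q) ∨ (inC t .B p ∧ inC t .B q) ∨
    (inC t .D p ∧ inC t .D q) ∨ (inC t .K1 p ∧ inC t .K1 q) ∨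
    (inC t .K2 p ∧ inC t .K2 q) ∨ (inC t .K3 p ∧ inC t .K3 q) ∨
    (inC t .K4 p ∧ inC t .K4 q) := by
  constructor
  · rintro ⟨P, h⟩; cases P <;> simp [h]
  · rintro (h | h | h | h | h | h | h) <;> exact ⟨_, h⟩

/-- Translation by one third of a turn. -/
def tr (x : S1) : S1 := x + ((1 / 3 : ℝ) : S1)

lemma continuous_tr : Continuous tr := continuous_id.add continuous_const

lemma tr_add (a : S1) (X : ℝ) : tr (a + (X : S1)) = a + ((X + 1 / 3 : ℝ) : S1) := by
  simp [tr, add_assoc]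

lemma s3_tr (x : S1) : s3 (tr x) = s3 x := by
  rw [tr, s3_add]
  rw [show ((3 * (1 / 3) : ℝ) : S1) = 0 by rw [← coe_one_eq_zero]; norm_num, add_zero]

lemma crd_tr (a x : S1) : (crd a x < 2/3 ∧ crd a (tr x) = crd a x + 1/3) ∨
    (2/3 ≤ crd a x ∧ crd a (tr x) = crd a x - 2/3) := by
  have h0 := crd_nonneg a x
  have h1 := crd_lt_one a x
  have e : tr x = a + ((crd a x + 1/3 : ℝ) : S1) := by rw [← tr_add, add_crd]
  have e' : tr x = a + ((crd a x - 2/3 : ℝ) : S1) := by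
    rw [e]; congr 1; exact coe_eq_coe_iff.2 ⟨1, by push_cast; ring⟩
  rcases lt_or_ge (crd a x) (2/3) with h | h
  · left; exact ⟨h, crd_eq e (by linarith) (by linarith)⟩
  · right; exact ⟨h, crd_eq e' (by linarith) (by linarith)⟩

lemma crd_s3 (a x : S1) : (crd a x < 1/3 ∧ crd (s3 a) (s3 x) = 3 * crd a x) ∨
    (1/3 ≤ crd a x ∧ crd a x < 2/3 ∧ crd (s3 a) (s3 x) = 3 * crd a x - 1) ∨
    (2/3 ≤ crd a x ∧ crd (s3 a) (s3 x) = 3 * crd a x - 2) := by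
  have h0 := crd_nonneg a x
  have h1 := crd_lt_one a x
  have e := s3_crd a x
  rcases lt_or_ge (crd a x) (1/3) with h | h
  · left; exact ⟨h, crd_eq e (by linarith) (by linarith)⟩
  rcases lt_or_ge (crd a x) (2/3) with h' | h'
  · right; left
    refine ⟨h, h', crd_eq (e.trans ?_) (by linarith) (by linarith)⟩
    rw [coe_sub_one]
  · right; right
    refine ⟨h', crd_eq (e.trans ?_) (by linarith) (by linarith)⟩
    congr 1; exact coe_eq_coe_iff.2 ⟨2, by push_cast; ring⟩

/-- A chord that does not cross `±{s3 a, s3 a + 3t}` has both ends in one of three regions. -/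
lemma image_region (ht : 0 < t) (ht' : t < 1/6)
    (h1 : ¬ Xs a (a + ((3 * t : ℝ) : S1)) x y)
    (h2 : ¬ Xs (antip a) (antip (a + ((3 * t : ℝ) : S1))) x y) :
    (crd a x ≤ 3 * t ∧ crd a y ≤ 3 * t) ∨
    ((1/2 ≤ crd a x ∧ crd a x ≤ 1/2 + 3 * t) ∧ (1/2 ≤ crd a y ∧ crd a y ≤ 1/2 + 3 * t)) ∨
    (((3 * t ≤ crd a x ∨ crd a x = 0) ∧ (crd a x ≤ 1/2 ∨ 1/2 + 3 * t ≤ crd a x)) ∧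
     ((3 * t ≤ crd a y ∨ crd a y = 0) ∧ (crd a y ≤ 1/2 ∨ 1/2 + 3 * t ≤ crd a y))) := by
  rw [Xs_iff a] at h1 h2
  rw [crd_self, crd_add (by linarith) (by linarith)] at h1
  have e1 : crd a (antip a) = 1/2 := by
    apply crd_eq (s := 1/2) rfl <;> norm_num
  have e2 : crd a (antip (a + ((3 * t : ℝ) : S1))) = 3 * t + 1/2 := by
    rw [antip_add, crd_add] <;> linarith
  rw [e1, e2] at h2
  have := crd_nonneg a x
  have := crd_lt_one a x
  have := crd_nonneg a y
  have := crd_lt_one a y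
  generalize crd a x = p at *
  generalize crd a y = q at *
  grind

lemma tr_vals (a x : S1) :
    (crd a x < 1/3 ∧ crd a (tr x) = crd a x + 1/3 ∧ crd a (tr (tr x)) = crd a x + 2/3 ∧
      crd (s3 a) (s3 x) = 3 * crd a x) ∨
    (1/3 ≤ crd a x ∧ crd a x < 2/3 ∧ crd a (tr x) = crd a x + 1/3 ∧
      crd a (tr (tr x)) = crd a x - 1/3 ∧ crd (s3 a) (s3 x) = 3 * crd a x - 1) ∨
    (2/3 ≤ crd a x ∧ crd a (tr x) = crd a x - 2/3 ∧ crd a (tr (tr x)) = crd a x - 1/3 ∧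
      crd (s3 a) (s3 x) = 3 * crd a x - 2) := by
  have a1 := crd_tr a x
  have a2 := crd_tr a (tr x)
  have a3 := crd_s3 a x
  have := crd_nonneg a x
  have := crd_lt_one a x
  generalize crd a (tr (tr x)) = p2 at *
  generalize crd a (tr x) = p1 at *
  generalize crd a x = p at *
  generalize crd (s3 a) (s3 x) = u at *
  grind

set_option maxHeartbeats 2000000 in
lemma good_translates (ht : 0 < t) (ht' : t < 1/6) (h : Good a t x y)
    (h1 : ¬ Xs (s3 a) (s3 a + ((3 * t : ℝ) : S1)) (s3 x) (s3 y))
    (h2 : ¬ Xs (antip (s3 a)) (antip (s3 a + ((3 * t : ℝ) : S1))) (s3 x) (s3 y)) :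
    (Good a t (tr x) (tr y) ∧ Good a t (tr (tr x)) (tr (tr y))) ∨
    (Good a t (tr x) (tr (tr y)) ∧ Good a t (tr (tr x)) (tr y)) := by
  have hr := image_region ht ht' h1 h2
  have hx0 := crd_nonneg a x
  have hx1 := crd_lt_one a x
  have hy0 := crd_nonneg a y
  have hy1 := crd_lt_one a y
  have ax := tr_vals a x
  have ay := tr_vals a y
  rw [good_crd, good_crd, good_crd, good_crd]
  rw [good_crd, exC_iff] at h
  clear h1 h2
  generalize crd a (tr (tr x)) = p2 at *
  generalize crd a (tr x) = p1 at *
  generalize crd a x = p at *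
  generalize crd a (tr (tr y)) = q2 at *
  generalize crd a (tr y) = q1 at *
  generalize crd a y = q at *
  generalize crd (s3 a) (s3 x) = u at *
  generalize crd (s3 a) (s3 y) = v at *
  simp only [exC_iff]
  simp only [inC] at h ⊢
  rcases ax with ⟨c1, rfl, rfl, rfl⟩ | ⟨c1, c1', rfl, rfl, rfl⟩ | ⟨c1, rfl, rfl, rfl⟩ <;>
  rcases ay with ⟨d1, rfl, rfl, rfl⟩ | ⟨d1, d1', rfl, rfl, rfl⟩ | ⟨d1, rfl, rfl, rfl⟩ <;>
    rcases hr with ⟨_, _⟩ | ⟨⟨_, _⟩, _, _⟩ | ⟨⟨r1 | r1, r2 | r2⟩, r3 | r3, r4 | r4⟩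
  all_goals try (exfalso; linarith)
  all_goals rcases h with h | h | h | h | h | h | h
  all_goals try (exfalso; grind)
  all_goals try (left; constructor <;> grind)
  all_goals (right; constructor <;> grind)

lemma exists_preimage (ht : 0 < t) (ht' : t < 1/6) (p q : S1)
    (h1 : ¬ Xs (s3 a) (s3 a + ((3 * t : ℝ) : S1)) p q)
    (h2 : ¬ Xs (antip (s3 a)) (antip (s3 a + ((3 * t : ℝ) : S1))) p q) :
    ∃ x y, s3 x = p ∧ s3 y = q ∧ Good a t x y := by
  have hr := image_region ht ht' h1 h2
  have hx0 := crd_nonneg (s3 a) p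
  have hx1 := crd_lt_one (s3 a) p
  have hy0 := crd_nonneg (s3 a) q
  have hy1 := crd_lt_one (s3 a) q
  by_cases hc : crd (s3 a) p ≤ 3 * t ∧ crd (s3 a) q ≤ 3 * t
  · refine ⟨a + ((crd (s3 a) p / 3 : ℝ) : S1), a + ((crd (s3 a) q / 3 : ℝ) : S1), ?_, ?_, .D, ?_, ?_⟩
    · rw [s3_add, mul_div_cancel₀ _ (by norm_num)]; exact add_crd _ _
    · rw [s3_add, mul_div_cancel₀ _ (by norm_num)]; exact add_crd _ _
    · unfold inP; rw [crd_add (by linarith) (by linarith)]; left; linarith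
    · unfold inP; rw [crd_add (by linarith) (by linarith)]; left; linarith
  · have e : ∀ s : ℝ, ((3 * ((s + 1) / 3) : ℝ) : S1) = s := fun s =>
      coe_eq_coe_iff.2 ⟨1, by push_cast; ring⟩
    have hl : ∀ r : S1, ∃ u : ℝ, 0 < u ∧ u ≤ 1 ∧ r = s3 a + (u : S1) ∧
        (u = crd (s3 a) r ∨ (crd (s3 a) r = 0 ∧ u = 1)) := by
      intro r
      rcases (crd_nonneg (s3 a) r).eq_or_lt with h0 | h0
      · refine ⟨1, one_pos, le_rfl, ?_, .inr ⟨h0.symm, rfl⟩⟩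
        rw [coe_one_eq_zero, add_zero]; exact crd_eq_zero.1 h0.symm
      · exact ⟨_, h0, (crd_lt_one _ _).le, (add_crd _ _).symm, .inl rfl⟩
    obtain ⟨u, hu0, hu1, hpu, hu⟩ := hl p
    obtain ⟨v, hv0, hv1, hqv, hv⟩ := hl q
    refine ⟨a + (((u + 1) / 3 : ℝ) : S1), a + (((v + 1) / 3 : ℝ) : S1), ?_, ?_, ?_⟩
    · rw [s3_add, e]; exact hpu.symm
    · rw [s3_add, e]; exact hqv.symm
    · rw [good_crd, crd_add (by linarith) (by linarith), crd_add (by linarith) (by linarith),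
        exC_iff]
      generalize crd (s3 a) p = p at *
      generalize crd (s3 a) q = q at *
      simp only [inC]
      clear h1 h2 hpu hqv e hl
      rcases hr with h | ⟨h, h'⟩ | ⟨⟨r1, r2⟩, r3, r4⟩
      · exact absurd h hc
      · left; grind
      · have r1' : 3 * t ≤ u := by grind
        have r3' : 3 * t ≤ v := by grind
        left; constructor <;> constructor <;> linarith

end SymLam

namespace SymLam

variable {a : S1} {t : ℝ} {x y z w : S1}

lemma isOpen_cyc : IsOpen {q : (S1 × S1) × (S1 × S1) | cyc q.1.1 q.1.2 q.2.1} := by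
  simp_rw [← dt_neg_iff]
  refine isOpen_lt ?_ continuous_const
  unfold dt
  have := continuous_toC
  fun_prop

lemma isOpen_Xs : IsOpen {q : (S1 × S1) × (S1 × S1) | Xs q.1.1 q.1.2 q.2.1 q.2.2} := by
  have h : ∀ g : (S1 × S1) × (S1 × S1) → (S1 × S1) × (S1 × S1), Continuous g →
      IsOpen {q | cyc (g q).1.1 (g q).1.2 (g q).2.1} := fun g hg => isOpen_cyc.preimage hg
  simp_rw [Xs_iff_cyc]
  have h1 := h (fun q => ((q.1.1, q.2.1), (q.1.2, q.1.2))) (by fun_prop)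
  have h2 := h (fun q => ((q.1.2, q.2.2), (q.1.1, q.1.1))) (by fun_prop)
  have h3 := h (fun q => ((q.1.1, q.2.2), (q.1.2, q.1.2))) (by fun_prop)
  have h4 := h (fun q => ((q.1.2, q.2.1), (q.1.1, q.1.1))) (by fun_prop)
  exact (h1.inter h2).union (h3.inter h4)

/-- The chord `{a, a+t}` generates a symmetric family of noncrossing chords avoiding the strips
determined by it. -/
structure Legal (a : S1) (t : ℝ) : Prop where
  pos : 0 < t
  lt : t < 1/6
  good : ∀ j, Good a t (s3^[j] a) (s3^[j] (a + (t : S1)))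
  nc : ∀ i j s, ¬ Xs (s3^[i] a) (s3^[i] (a + (t : S1)))
    (sg s (s3^[j] a)) (sg s (s3^[j] (a + (t : S1))))

/-- The forward images of `±{a, a+t}`. -/
def Base (a : S1) (t : ℝ) (x y : S1) : Prop := ∃ j s,
  (x = sg s (s3^[j] a) ∧ y = sg s (s3^[j] (a + (t : S1)))) ∨
  (y = sg s (s3^[j] a) ∧ x = sg s (s3^[j] (a + (t : S1))))

lemma Base.symm (h : Base a t x y) : Base a t y x := by
  obtain ⟨j, s, h⟩ := h; exact ⟨j, s, h.symm⟩

lemma Base.image (h : Base a t x y) : Base a t (s3 x) (s3 y) := by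
  obtain ⟨j, s, ⟨rfl, rfl⟩ | ⟨rfl, rfl⟩⟩ := h
  · exact ⟨j + 1, s, .inl ⟨by rw [s3_sg, Function.iterate_succ_apply'],
      by rw [s3_sg, Function.iterate_succ_apply']⟩⟩
  · exact ⟨j + 1, s, .inr ⟨by rw [s3_sg, Function.iterate_succ_apply'],
      by rw [s3_sg, Function.iterate_succ_apply']⟩⟩

lemma Base.iter (h : Base a t x y) (n : ℕ) : Base a t (s3^[n] x) (s3^[n] y) := by
  induction n with
  | zero => exact h
  | succ n ih => rw [Function.iterate_succ_apply', Function.iterate_succ_apply']; exact ih.image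

lemma Base.sg (h : Base a t x y) (s : Bool) : Base a t (sg s x) (sg s y) := by
  obtain ⟨j, s', ⟨rfl, rfl⟩ | ⟨rfl, rfl⟩⟩ := h
  · exact ⟨j, xor s s', .inl ⟨sg_sg _ _ _, sg_sg _ _ _⟩⟩
  · exact ⟨j, xor s s', .inr ⟨sg_sg _ _ _, sg_sg _ _ _⟩⟩

lemma Base.good (hL : Legal a t) (h : Base a t x y) : Good a t x y := by
  obtain ⟨j, s', ⟨rfl, rfl⟩ | ⟨rfl, rfl⟩⟩ := h
  · exact (hL.good j).sg hL.pos hL.lt s'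
  · exact ((hL.good j).sg hL.pos hL.lt s').symm

lemma Base.nc (hL : Legal a t) (h : Base a t x z) (h' : Base a t y w) : ¬ Xs x z y w := by
  have key : ∀ i j s s', ¬ Xs (SymLam.sg s (s3^[i] a)) (SymLam.sg s (s3^[i] (a + (t : S1))))
      (SymLam.sg s' (s3^[j] a)) (SymLam.sg s' (s3^[j] (a + (t : S1)))) := by
    intro i j s s' hX
    rw [← Xs_sg s, sg_sg, sg_sg, sg_sg, sg_sg, Bool.xor_self] at hX
    exact hL.nc i j _ hX
  obtain ⟨i, s, ⟨rfl, rfl⟩ | ⟨rfl, rfl⟩⟩ := h <;>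
  obtain ⟨j, s', ⟨rfl, rfl⟩ | ⟨rfl, rfl⟩⟩ := h' <;> intro hX
  · exact key _ _ _ _ hX
  · exact key _ _ _ _ (Xs_swap_right.1 hX)
  · exact key _ _ _ _ (Xs_swap_left.1 hX)
  · exact key _ _ _ _ (Xs_swap_left.1 (Xs_swap_right.1 hX))

/-- The pullbacks of the chord `{a, a+t}`. -/
def Fc (a : S1) (t : ℝ) (x y : S1) : Prop :=
  (∀ j, Good a t (s3^[j] x) (s3^[j] y)) ∧ ∃ n, Base a t (s3^[n] x) (s3^[n] y)

lemma Fc.symm (h : Fc a t x y) : Fc a t y x :=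
  ⟨fun j => (h.1 j).symm, h.2.imp fun _ h => h.symm⟩

lemma Fc.image (h : Fc a t x y) : Fc a t (s3 x) (s3 y) := by
  refine ⟨fun j => h.1 (j + 1), h.2.imp fun n hn => ?_⟩
  rw [← Function.iterate_succ_apply, ← Function.iterate_succ_apply,
    Function.iterate_succ_apply', Function.iterate_succ_apply']
  exact hn.image

lemma Fc.of_image (h : Good a t x y) (h' : Fc a t (s3 x) (s3 y)) : Fc a t x y := by
  refine ⟨fun j => ?_, ?_⟩
  · cases j with
    | zero => exact h
    | succ j => exact h'.1 j
  · obtain ⟨n, hn⟩ := h'.2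
    exact ⟨n + 1, hn⟩

lemma Base.fc (hL : Legal a t) (h : Base a t x y) : Fc a t x y :=
  ⟨fun j => (h.iter j).good hL, 0, h⟩

lemma base_self (a : S1) (t : ℝ) : Base a t a (a + (t : S1)) := ⟨0, false, .inl ⟨rfl, rfl⟩⟩

lemma Fc.sg (hL : Legal a t) (s : Bool) (h : Fc a t x y) : Fc a t (sg s x) (sg s y) := by
  refine ⟨fun j => ?_, h.2.imp fun n hn => ?_⟩
  · rw [iter_sg, iter_sg]; exact (h.1 j).sg hL.pos hL.lt s
  · rw [iter_sg, iter_sg]; exact hn.sg s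

lemma Fc.nc (hL : Legal a t) (h : Fc a t x z) (h' : Fc a t y w) : ¬ Xs x z y w := by
  intro hX
  have hn : ∀ n, Xs (s3^[n] x) (s3^[n] z) (s3^[n] y) (s3^[n] w) := by
    intro n
    induction n with
    | zero => exact hX
    | succ n ih =>
      simp only [Function.iterate_succ_apply']
      exact Xs_image hL.pos hL.lt (h.1 n) (h'.1 n) ih
  obtain ⟨n, hn1⟩ := h.2
  obtain ⟨m, hm1⟩ := h'.2
  have e1 := hn1.iter m
  have e2 := hm1.iter n
  simp only [← Function.iterate_add_apply] at e1 e2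
  rw [add_comm] at e1
  exact e1.nc hL e2 (hn _)

lemma s3_add_t (a : S1) (t : ℝ) : s3 (a + (t : S1)) = s3 a + ((3 * t : ℝ) : S1) := s3_add a t

lemma Fc.not_cross_minor (hL : Legal a t) (h : Fc a t x y) (s : Bool) :
    ¬ Xs (SymLam.sg s (s3 a)) (SymLam.sg s (s3 a + ((3 * t : ℝ) : S1))) x y := by
  rw [← s3_add_t]
  exact (((base_self a t).image.sg s).fc hL).nc hL h

lemma Fc.translates (hL : Legal a t) (h : Fc a t x y) :
    (Fc a t (tr x) (tr y) ∧ Fc a t (tr (tr x)) (tr (tr y))) ∨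
    (Fc a t (tr x) (tr (tr y)) ∧ Fc a t (tr (tr x)) (tr y)) := by
  have h1 := h.image
  rcases good_translates hL.pos hL.lt (h.1 0) (h1.not_cross_minor hL false)
    (h1.not_cross_minor hL true) with h' | h'
  · exact .inl ⟨.of_image h'.1 (by simpa [s3_tr] using h1),
      .of_image h'.2 (by simpa [s3_tr] using h1)⟩
  · exact .inr ⟨.of_image h'.1 (by simpa [s3_tr] using h1),
      .of_image h'.2 (by simpa [s3_tr] using h1)⟩

lemma Fc.preimage (hL : Legal a t) (h : Fc a t x y) :
    ∃ x' y', Fc a t x' y' ∧ s3 x' = x ∧ s3 y' = y := by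
  obtain ⟨x', y', rfl, rfl, h'⟩ := exists_preimage hL.pos hL.lt x y
    (h.not_cross_minor hL false) (h.not_cross_minor hL true)
  exact ⟨x', y', .of_image h' h, rfl, rfl⟩

/-- The closed set of pairs generated by a legal chord. -/
def Cc (a : S1) (t : ℝ) : Set (S1 × S1) := closure {q | Fc a t q.1 q.2}

lemma Fc.mem (h : Fc a t x y) : (x, y) ∈ Cc a t := subset_closure h

lemma Cc_map {g : S1 × S1 → S1 × S1} (hg : Continuous g)
    (h : ∀ x y, Fc a t x y → Fc a t (g (x, y)).1 (g (x, y)).2) {q : S1 × S1} (hq : q ∈ Cc a t) :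
    g q ∈ Cc a t := by
  have : MapsTo g {q | Fc a t q.1 q.2} {q | Fc a t q.1 q.2} := fun q hq => h q.1 q.2 hq
  exact (this.closure hg) hq

lemma Cc_image (h : (x, y) ∈ Cc a t) : (s3 x, s3 y) ∈ Cc a t :=
  Cc_map (g := fun q => (s3 q.1, s3 q.2))
    (by have := continuous_s3; fun_prop) (fun _ _ h => h.image) h

lemma Cc_sg (hL : Legal a t) (s : Bool) (h : (x, y) ∈ Cc a t) : (sg s x, sg s y) ∈ Cc a t :=
  Cc_map (g := fun q => (sg s q.1, sg s q.2))
    (by have := continuous_sg s; fun_prop) (fun _ _ h => h.sg hL s) h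

lemma Cc_good (hL : Legal a t) (h : (x, y) ∈ Cc a t) : Good a t x y := by
  have : Cc a t ⊆ {q : S1 × S1 | Good a t q.1 q.2} :=
    closure_minimal (fun q hq => hq.1 0) (isClosed_good hL.pos hL.lt)
  exact this h

lemma Cc_nc (hL : Legal a t) (h : (x, z) ∈ Cc a t) (h' : (y, w) ∈ Cc a t) : ¬ Xs x z y w := by
  have h2 : ((x, z), (y, w)) ∈ closure ({q : S1 × S1 | Fc a t q.1 q.2} ×ˢ
      {q : S1 × S1 | Fc a t q.1 q.2}) := by
    rw [closure_prod_eq]; exact ⟨h, h'⟩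
  have : closure ({q : S1 × S1 | Fc a t q.1 q.2} ×ˢ {q : S1 × S1 | Fc a t q.1 q.2}) ⊆
      {q | ¬ Xs q.1.1 q.1.2 q.2.1 q.2.2} :=
    closure_minimal (fun q hq => Fc.nc hL hq.1 hq.2) isOpen_Xs.isClosed_compl
  exact this h2

lemma Cc_preimage (hL : Legal a t) (h : (x, y) ∈ Cc a t) :
    ∃ x' y', (x', y') ∈ Cc a t ∧ s3 x' = x ∧ s3 y' = y := by
  have hc : IsClosed ((fun q : S1 × S1 => (s3 q.1, s3 q.2)) '' Cc a t) :=
    (isClosed_closure.isCompact.image (by have := continuous_s3; fun_prop)).isClosed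
  have : Cc a t ⊆ (fun q : S1 × S1 => (s3 q.1, s3 q.2)) '' Cc a t := by
    refine closure_minimal (fun q hq => ?_) hc
    obtain ⟨x', y', h1, h2, h3⟩ := Fc.preimage hL hq
    exact ⟨(x', y'), h1.mem, Prod.ext h2 h3⟩
  obtain ⟨⟨x', y'⟩, h1, h2⟩ := this h
  exact ⟨x', y', h1, congrArg Prod.fst h2, congrArg Prod.snd h2⟩

lemma Cc_translates (hL : Legal a t) (h : (x, y) ∈ Cc a t) :
    ((tr x, tr y) ∈ Cc a t ∧ (tr (tr x), tr (tr y)) ∈ Cc a t) ∨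
    ((tr x, tr (tr y)) ∈ Cc a t ∧ (tr (tr x), tr y) ∈ Cc a t) := by
  have hC : IsClosed (Cc a t) := isClosed_closure
  have ct := continuous_tr
  have h1 := hC.preimage (f := fun q : S1 × S1 => (tr q.1, tr q.2)) (by fun_prop)
  have h2 := hC.preimage (f := fun q : S1 × S1 => (tr (tr q.1), tr (tr q.2))) (by fun_prop)
  have h3 := hC.preimage (f := fun q : S1 × S1 => (tr q.1, tr (tr q.2))) (by fun_prop)
  have h4 := hC.preimage (f := fun q : S1 × S1 => (tr (tr q.1), tr q.2)) (by fun_prop)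
  refine closure_minimal (fun q hq => ?_) ((h1.inter h2).union (h3.inter h4)) h
  rcases Fc.translates hL hq with h' | h'
  · exact .inl ⟨h'.1.mem, h'.2.mem⟩
  · exact .inr ⟨h'.1.mem, h'.2.mem⟩

/-- The lamination generated by a legal chord. -/
def Lc (a : S1) (t : ℝ) : Set Chord := {ℓ | ∃ x y, (x, y) ∈ Cc a t ∧ ℓ = s(x, y)}

lemma cmap_mk (f : S1 → S1) (x y : S1) : cmap f s(x, y) = s(f x, f y) := rfl

lemma isClosed_unionSet_Lc (a : S1) (t : ℝ) : IsClosed (unionSet (Lc a t)) := by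
  have : unionSet (Lc a t) = (fun q : (S1 × S1) × ℝ => AffineMap.lineMap (toC q.1.1) (toC q.1.2) q.2) ''
      (Cc a t ×ˢ Icc (0:ℝ) 1) := by
    ext v
    simp only [unionSet, mem_iUnion, Lc, mem_image, mem_prod]
    constructor
    · rintro ⟨ℓ, ⟨x, y, h, rfl⟩, hv⟩
      rw [chordSet_mk, segment_eq_image_lineMap] at hv
      obtain ⟨θ, hθ, rfl⟩ := hv
      exact ⟨((x, y), θ), ⟨h, hθ⟩, rfl⟩
    · rintro ⟨⟨⟨x, y⟩, θ⟩, ⟨h, hθ⟩, rfl⟩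
      refine ⟨s(x, y), ⟨x, y, h, rfl⟩, ?_⟩
      rw [chordSet_mk, segment_eq_image_lineMap]
      exact ⟨θ, hθ, rfl⟩
  rw [this]
  refine ((isClosed_closure.isCompact.prod isCompact_Icc).image ?_).isClosed
  have := continuous_toC
  simp only [AffineMap.lineMap_apply]
  fun_prop

lemma tr_ne (x : S1) : tr x ≠ x := by
  rcases crd_tr x x with h | h
  · intro e; rw [e] at h; linarith [h.2]
  · rw [crd_self] at h; linarith [h.1]

lemma tr_tr_ne (x : S1) : tr (tr x) ≠ x := by
  intro e
  have h1 := crd_tr x x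
  have h2 := crd_tr x (tr x)
  rw [e] at h2
  rw [crd_self] at *
  rcases h1 with ⟨h, h'⟩ | ⟨h, h'⟩ <;> rcases h2 with ⟨k, k'⟩ | ⟨k, k'⟩ <;> linarith

lemma disjoint_of_Cc (hL : Legal a t) (h : (x, z) ∈ Cc a t) (h' : (y, w) ∈ Cc a t)
    (hxz : s3 x ≠ s3 z) (hy : y ≠ x) (hw : w ≠ z) (h1 : s3 y = s3 x) (h2 : s3 w = s3 z) :
    Disjoint (chordSet s(x, z)) (chordSet s(y, w)) := by
  refine disjoint_chordSet (Cc_nc hL h h') (fun e => hxz (by rw [e])) hy (fun e => hxz ?_)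
    (fun e => hxz ?_) hw
  · rw [← h1, e]
  · rw [← h2, e]

theorem Lc_isCubicSymLam (hL : Legal a t) : IsCubicSymLam (Lc a t) where
  nocross := by
    rintro _ ⟨x, z, h, rfl⟩ _ ⟨y, w, h', rfl⟩
    rw [crosses_iff]; exact Cc_nc hL h h'
  closed := isClosed_unionSet_Lc a t
  forward := by
    rintro _ ⟨x, y, h, rfl⟩
    exact .inl ⟨_, _, Cc_image h, rfl⟩
  backward := by
    rintro _ ⟨x, y, h, rfl⟩
    obtain ⟨x', y', h', rfl, rfl⟩ := Cc_preimage hL h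
    exact ⟨_, ⟨_, _, h', rfl⟩, rfl⟩
  siblings := by
    rintro _ ⟨x, y, h, rfl⟩ hd
    have hne : s3 x ≠ s3 y := by simpa [cmap_mk] using hd
    have e1 := tr_ne x
    have e2 := tr_tr_ne x
    have e3 := tr_ne (tr x)
    have e1' := tr_ne y
    have e2' := tr_tr_ne y
    have e3' := tr_ne (tr y)
    rcases Cc_translates hL h with ⟨h1, h2⟩ | ⟨h1, h2⟩
    · refine ⟨_, ⟨_, _, h1, rfl⟩, _, ⟨_, _, h2, rfl⟩, disjoint_of_Cc hL h h1 hne e1 e1' ?_ ?_,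
        disjoint_of_Cc hL h h2 hne e2 e2' ?_ ?_, disjoint_of_Cc hL h1 h2 ?_ e3 e3' ?_ ?_, hd, ?_, ?_⟩
      all_goals simp [cmap_mk, s3_tr, hne]
    · refine ⟨_, ⟨_, _, h1, rfl⟩, _, ⟨_, _, h2, rfl⟩, disjoint_of_Cc hL h h1 hne e1 e2' ?_ ?_,
        disjoint_of_Cc hL h h2 hne e2 e1' ?_ ?_, disjoint_of_Cc hL h1 h2 ?_ e3 e3'.symm ?_ ?_,
        hd, ?_, ?_⟩
      all_goals simp [cmap_mk, s3_tr, hne]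
  symm := by
    rintro _ ⟨x, y, h, rfl⟩
    exact ⟨_, _, Cc_sg hL true h, rfl⟩

lemma s3_add_third (a : S1) (X : ℝ) : s3 (a + ((X + 1/3 : ℝ) : S1)) = s3 (a + (X : S1)) := by
  rw [← tr_add, s3_tr]

theorem Legal.mem_CsCL (hL : Legal a t) : s(a, a + (t : S1)) ∈ CsCL := by
  have h0 := hL.pos
  have h1 := hL.lt
  have hself := (base_self a t).fc hL
  have hlen : chordLen s(a, a + (t : S1)) = t := by
    change ‖a - (a + (t : S1))‖ = t
    rw [norm_crd a, crd_self, crd_add (by linarith) (by linarith), zero_sub, abs_neg,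
      abs_of_pos h0, min_eq_left (by linarith)]
  have cM1 : crd a (a + ((1/3 + 1/3 : ℝ) : S1)) = 2/3 := by
    rw [crd_add] <;> norm_num
  have cM2 : crd a (a + ((t + 1/3 : ℝ) : S1)) = t + 1/3 := by
    rw [crd_add] <;> linarith
  have sM1 : s3 (a + ((1/3 + 1/3 : ℝ) : S1)) = s3 a := by
    rw [s3_add_third, show (1/3 : ℝ) = 0 + 1/3 by ring, s3_add_third]; simp
  have hM : Fc a t (a + ((1/3 + 1/3 : ℝ) : S1)) (a + ((t + 1/3 : ℝ) : S1)) := by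
    refine .of_image ⟨.A, ⟨?_, ?_⟩, ⟨?_, ?_⟩⟩ ?_
    · rw [cM1]; linarith
    · rw [cM1]
    · rw [cM2]
    · rw [cM2]; linarith
    · rw [sM1, s3_add_third]; exact hself.image
  have hMlen : |1/3 - chordLen s(a + ((1/3 + 1/3 : ℝ) : S1), a + ((t + 1/3 : ℝ) : S1))| = t := by
    change |1/3 - ‖(a + ((1/3 + 1/3 : ℝ) : S1)) - (a + ((t + 1/3 : ℝ) : S1))‖| = t
    rw [norm_crd a, cM1, cM2, abs_of_pos (by linarith : (0:ℝ) < 2/3 - (t + 1/3)),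
      min_eq_left (by linarith), show (1/3 - (2/3 - (t + 1/3)) : ℝ) = t by ring, abs_of_pos h0]
  refine ⟨Lc a t, Lc_isCubicSymLam hL, .inl (by rw [hlen]; exact h1), fun _ => ⟨_, _, hself.mem, rfl⟩,
    ⟨_, ⟨⟨_, _, hM.mem, rfl⟩, ?_⟩, ?_⟩, ?_⟩
  · rintro _ ⟨x, y, h, rfl⟩
    rw [hMlen]
    exact good_dist h0 h1 (Cc_good hL h)
  · rw [cmap_mk, cmap_mk, sM1, s3_add_third]
  · rintro _ ⟨⟨x, y, h, rfl⟩, hmin⟩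
    have h2 := hmin _ ⟨_, _, hM.mem, rfl⟩
    rw [hMlen] at h2
    have h3 := good_dist_eq h0 h1 (Cc_good hL h) h2
    have ca : crd a (a + (t : S1)) = t := crd_add (by linarith) (by linarith)
    have c0 := crd_self a
    have key : ∀ p q : S1, crd a p ≠ crd a q → p ≠ q := fun p q h e => h (by rw [e])
    refine disjoint_chordSet (Cc_nc hL hself.mem h) (key _ _ ?_) (key _ _ ?_) (key _ _ ?_)
      (key _ _ ?_) (key _ _ ?_) <;> grind

end SymLam

namespace SymLam

variable {a : S1} {t : ℝ} {x y z w p q : S1}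

lemma s3_eq_iff : s3 p = s3 a ↔ p = a ∨ p = tr a ∨ p = tr (tr a) := by
  constructor
  · intro h
    have h1 := crd_s3 a p
    rw [h, crd_self] at h1
    have c1 : crd a (tr a) = 1/3 := by
      have := crd_tr a a; rw [crd_self] at this; norm_num at this; rw [this]
    have c2 : crd a (tr (tr a)) = 2/3 := by
      have := crd_tr a (tr a); rw [c1] at this; norm_num at this; rw [this]
    rcases h1 with ⟨_, h⟩ | ⟨_, _, h⟩ | ⟨_, h⟩
    · left; exact crd_eq_zero.1 (by linarith)
    · right; left; exact crd_inj (a := a) (by linarith)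
    · right; right; exact crd_inj (a := a) (by linarith)
  · rintro (rfl | rfl | rfl) <;> simp [s3_tr]

lemma good_of_not_Xs_of_le (ht : 0 < t) (ht' : t < 1/6) (hxy : crd a x ≤ crd a y)
    (h1 : ∀ s, ¬ Xs (sg s (a + ((2/3 : ℝ) : S1))) (sg s (a + ((t + 1/3 : ℝ) : S1))) x y)
    (h2 : ∀ s, ¬ Xs (sg s (a + ((1/3 : ℝ) : S1))) (sg s (a + ((t + 2/3 : ℝ) : S1))) x y)
    (h : t ≤ |1/3 - ‖x - y‖|) : Good a t x y := by
  have c : ∀ u : ℝ, 1/2 ≤ u → u < 3/2 → crd a (antip (a + (u : S1))) = u - 1/2 := by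
    intro u hu hu'
    rw [antip_add]
    refine crd_eq ?_ (by linarith) (by linarith)
    congr 1; exact coe_eq_coe_iff.2 ⟨1, by push_cast; ring⟩
  have c' : ∀ u : ℝ, 0 ≤ u → u < 1/2 → crd a (antip (a + (u : S1))) = u + 1/2 := by
    intro u hu hu'
    rw [antip_add, crd_add (by linarith) (by linarith)]
  have k1 := h1 false
  have k2 := h1 true
  have k3 := h2 false
  have k4 := h2 true
  simp only [sg_false, sg_true] at k1 k2 k3 k4
  rw [Xs_iff a] at k1 k2 k3 k4
  rw [crd_add (by linarith) (by linarith), crd_add (by linarith) (by linarith)] at k1 k3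
  rw [c _ (by norm_num) (by norm_num), c' _ (by linarith) (by linarith)] at k2
  rw [c' _ (by norm_num) (by norm_num), c _ (by linarith) (by linarith)] at k4
  rw [norm_crd a] at h
  rw [good_crd, exC_iff]
  have := crd_nonneg a x
  have := crd_lt_one a x
  have := crd_nonneg a y
  have := crd_lt_one a y
  generalize crd a x = x at *
  generalize crd a y = y at *
  simp only [inC]
  clear h1 h2 c c'
  rw [show |x - y| = y - x by rw [abs_sub_comm, abs_of_nonneg (by linarith)]] at h
  have h' : (y - x ≤ 1/2 ∧ t ≤ |1/3 - (y - x)|) ∨ (1/2 ≤ y - x ∧ t ≤ |y - x - 2/3|) := by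
    rcases le_total (y - x) (1/2) with h2 | h2
    · left; rw [min_eq_left (by linarith)] at h
      exact ⟨h2, h⟩
    · right; rw [min_eq_right (by linarith)] at h
      exact ⟨h2, by convert h using 2; ring⟩
  clear h
  rw [le_abs, le_abs] at h'
  have hk : ∀ u v : ℝ, u < v →
      ¬((u < x ∧ x < v ∨ v < x ∧ x < u) ∧ (u < y ∧ v < y ∨ y < u ∧ y < v) ∨
        (u < x ∧ v < x ∨ x < u ∧ x < v) ∧ (u < y ∧ y < v ∨ v < y ∧ y < u)) →
      (u ≤ x ∧ y ≤ v) ∨ (x ≤ u ∧ v ≤ y) ∨ y ≤ u ∨ v ≤ x := by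
    intro u v huv hn; grind
  have hk2 : ∀ v u : ℝ, u < v →
      ¬((v < x ∧ x < u ∨ u < x ∧ x < v) ∧ (v < y ∧ u < y ∨ y < v ∧ y < u) ∨
        (v < x ∧ u < x ∨ x < v ∧ x < u) ∧ (v < y ∧ y < u ∨ u < y ∧ y < v)) →
      (u ≤ x ∧ y ≤ v) ∨ (x ≤ u ∧ v ≤ y) ∨ y ≤ u ∨ v ≤ x := by
    intro u v huv hn; grind
  have k1' := hk2 _ _ (by linarith) k1
  have k2' := hk _ _ (by linarith) k2
  have k3' := hk _ _ (by linarith) k3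
  have k4' := hk2 _ _ (by linarith) k4
  clear hk2
  clear k1 k2 k3 k4 hk
  rcases k1' with k1 | k1 | k1 | k1
  · left; constructor <;> constructor <;> linarith
  all_goals rcases k2' with k2 | k2 | k2 | k2
  all_goals first
    | (exfalso; linarith)
    | (right; right; left; constructor <;> first | (left; linarith) | (right; linarith))
    | skip
  all_goals rcases k3' with k3 | k3 | k3 | k3
  all_goals try (exfalso; linarith)
  all_goals rcases k4' with k4 | k4 | k4 | k4
  all_goals try (exfalso; linarith)
  all_goals rcases h' with ⟨h', h'' | h''⟩ | ⟨h', h'' | h''⟩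
  all_goals try (exfalso; linarith)
  all_goals grind

lemma good_of_not_Xs (ht : 0 < t) (ht' : t < 1/6)
    (h1 : ∀ s, ¬ Xs (sg s (a + ((2/3 : ℝ) : S1))) (sg s (a + ((t + 1/3 : ℝ) : S1))) x y)
    (h2 : ∀ s, ¬ Xs (sg s (a + ((1/3 : ℝ) : S1))) (sg s (a + ((t + 2/3 : ℝ) : S1))) x y)
    (h : t ≤ |1/3 - ‖x - y‖|) : Good a t x y := by
  rcases le_total (crd a x) (crd a y) with hxy | hxy
  · exact good_of_not_Xs_of_le ht ht' hxy h1 h2 h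
  · exact (good_of_not_Xs_of_le ht ht' hxy (fun s => by rw [Xs_swap_right]; exact h1 s)
      (fun s => by rw [Xs_swap_right]; exact h2 s) (by rwa [norm_sub_rev])).symm

lemma exists_oriented (x y : S1) : ∃ a : S1, s(x, y) = s(a, a + (‖x - y‖ : S1)) := by
  have h := norm_crd x x y
  rw [crd_self, zero_sub, abs_neg, abs_of_nonneg (crd_nonneg _ _)] at h
  rcases le_total (crd x y) (1/2) with h' | h'
  · refine ⟨x, ?_⟩
    rw [h, min_eq_left (by linarith), add_crd]
  · refine ⟨y, ?_⟩
    rw [h, min_eq_right (by linarith), Sym2.eq_swap]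
    congr 1
    calc x = x + (crd x y : S1) + ((1 - crd x y : ℝ) : S1) := by
          rw [add_assoc, ← AddCircle.coe_add, add_sub_cancel, coe_one_eq_zero, add_zero]
      _ = _ := by rw [add_crd]

/-- Every nondegenerate comajor is legal. -/
theorem exists_legal {L : Set Chord} {c : Chord} (hL : IsCubicSymLam L) (hc : IsComajor L c)
    (hd : ¬ c.IsDiag) : ∃ a t, Legal a t ∧ c = s(a, a + (t : S1)) := by
  induction c using Sym2.ind with | _ x y => ?_
  obtain ⟨hlt, hcL, ⟨M, hM, hMc⟩, hdis⟩ := hc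
  replace hlt := hlt.resolve_right hd
  replace hcL := hcL hd
  obtain ⟨a, ha⟩ := exists_oriented x y
  have hxy : x ≠ y := by simpa using hd
  set t := ‖x - y‖ with htdef
  have ht : 0 < t := norm_pos_iff.2 (sub_ne_zero.2 hxy)
  have ht' : t < 1/6 := hlt
  rw [ha] at hcL hMc hdis ⊢
  clear_value t
  clear ha hlt hd hxy htdef x y
  have L_sg : ∀ s x y, s(x, y) ∈ L → s(sg s x, sg s y) ∈ L := by
    intro s x y h
    cases s
    · exact h
    · exact hL.symm _ h
  have L_nc : ∀ {x z y w}, s(x, z) ∈ L → s(y, w) ∈ L → ¬ Xs x z y w := fun h h' hX =>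
    hL.nocross _ h _ h' (crosses_iff.2 hX)
  have hend : ∀ {p q : S1}, Disjoint (chordSet s(a, a + (t : S1))) (chordSet s(p, q)) →
      p ≠ a ∧ q ≠ a + (t : S1) := by
    intro p q h
    constructor <;> rintro rfl
    · exact Set.disjoint_left.1 h (left_mem_segment _ _ _) (left_mem_segment _ _ _)
    · exact Set.disjoint_left.1 h (right_mem_segment _ _ _) (right_mem_segment _ _ _)
  have tra : tr a = a + ((1/3 : ℝ) : S1) := rfl
  have ttra : tr (tr a) = a + ((2/3 : ℝ) : S1) := by rw [tra, tr_add]; norm_num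
  have tre : tr (a + (t : S1)) = a + ((t + 1/3 : ℝ) : S1) := tr_add _ _
  have ttre : tr (tr (a + (t : S1))) = a + ((t + 2/3 : ℝ) : S1) := by
    rw [tre, tr_add, show t + 1/3 + 1/3 = t + 2/3 by ring]
  have hlen : ∀ u v : ℝ, |u - v| ≤ 1 →
      chordLen s(a + (u : S1), a + (v : S1)) = min |u - v| (1 - |u - v|) :=
    fun u v h => norm_rel a rfl rfl h
  have hlen0 : ‖a - (a + (t : S1))‖ = t := by
    rw [norm_crd a, crd_self, crd_add (by linarith) (by linarith), zero_sub, abs_neg,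
      abs_of_pos ht, min_eq_left (by linarith)]
  have hs3 : ‖s3 a - s3 (a + (t : S1))‖ = 3 * t := by
    rcases norm_s3 a (a + (t : S1)) with h | h <;> rw [hlen0] at h
    · exact h.2
    · linarith [h.1]
  have hne : s3 a ≠ s3 (a + (t : S1)) := by
    intro h; rw [h, sub_self, norm_zero] at hs3; linarith
  have hnd : ¬ (cmap s3 s(a, a + (t : S1))).IsDiag := by simpa [cmap_mk] using hne
  have himage : s(s3 a, s3 (a + (t : S1))) ∈ L := (hL.forward _ hcL).resolve_right hnd
  -- chords with the same image
  have hsame : ∀ N : Chord, cmap s3 N = cmap s3 s(a, a + (t : S1)) → ∃ p q, N = s(p, q) ∧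
      s3 p = s3 a ∧ s3 q = s3 (a + (t : S1)) := by
    intro N
    induction N using Sym2.ind with | _ p q => ?_
    rw [cmap_mk, cmap_mk, Sym2.eq_iff]
    rintro (⟨h1, h2⟩ | ⟨h1, h2⟩)
    · exact ⟨p, q, rfl, h1, h2⟩
    · exact ⟨q, p, Sym2.eq_swap, h2, h1⟩
  have key : (∀ ℓ ∈ L, t ≤ |1/3 - chordLen ℓ|) ∧ s(tr (tr a), tr (a + (t : S1))) ∈ L ∧
      s(tr a, tr (tr (a + (t : S1)))) ∈ L := by
    obtain ⟨p, q, rfl, hp, hq⟩ := hsame M hMc.symm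
    obtain ⟨hpa, hqe⟩ := hend (hdis _ hM)
    have hsib := hL.siblings _ hM.1 (by rw [← hMc]; exact hnd)
    obtain ⟨N, hN, N', hN', d1, d2, d3, -, i2, i3⟩ := hsib
    obtain ⟨p2, q2, rfl, hp2, hq2⟩ := hsame N (i2.trans hMc.symm)
    obtain ⟨p3, q3, rfl, hp3, hq3⟩ := hsame N' (i3.trans hMc.symm)
    have dj : ∀ {p q p' q' : S1}, Disjoint (chordSet s(p, q)) (chordSet s(p', q')) →
        p ≠ p' ∧ q ≠ q' := by
      intro p q p' q' h
      constructor <;> rintro rfl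
      · exact Set.disjoint_left.1 h (left_mem_segment _ _ _) (left_mem_segment _ _ _)
      · exact Set.disjoint_left.1 h (right_mem_segment _ _ _) (right_mem_segment _ _ _)
    have n1 := dj d1
    have n2 := dj d2
    have n3 := dj d3
    clear d1 d2 d3 i2 i3
    have dja : ∀ {q' : S1}, ¬ Disjoint (chordSet s(a, a + (t : S1))) (chordSet s(a, q')) :=
      fun h => (hend h).1 rfl
    have l1 : chordLen s(tr (tr a), tr (a + (t : S1))) = 1/3 - t := by
      rw [ttra, tre, hlen _ _ (by rw [abs_le]; constructor <;> linarith),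
        abs_of_pos (by linarith), min_eq_left (by linarith)]; ring
    have l2 : chordLen s(tr a, tr (tr (a + (t : S1)))) = 1/3 + t := by
      rw [tra, ttre, hlen _ _ (by rw [abs_le]; constructor <;> linarith),
        abs_of_neg (by linarith), min_eq_left (by linarith)]; ring
    have l3 : chordLen s(a, tr (tr (a + (t : S1)))) = 1/3 - t := by
      have := hlen 0 (t + 2/3) (by rw [abs_le]; constructor <;> linarith)
      rw [AddCircle.coe_zero, add_zero, ← ttre] at this
      rw [this, abs_of_neg (by linarith), min_eq_right (by linarith)]; ring
    have l4 : chordLen s(a, tr (a + (t : S1))) = 1/3 + t := by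
      have := hlen 0 (t + 1/3) (by rw [abs_le]; constructor <;> linarith)
      rw [AddCircle.coe_zero, add_zero, ← tre] at this
      rw [this, abs_of_neg (by linarith), min_eq_left (by linarith)]; ring
    have a1 : |1/3 - (1/3 - t)| = t := by rw [sub_sub_cancel, abs_of_pos ht]
    have a2 : |1/3 - (1/3 + t)| = t := by rw [sub_add_cancel_left, abs_neg, abs_of_pos ht]
    have short : ∀ N, IsMajor L N → chordLen N = t → False := by
      intro N hN h
      have h1 := hN.2 _ himage
      rw [h] at h1
      change _ ≤ |1/3 - ‖s3 a - s3 (a + (t : S1))‖| at h1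
      rw [hs3] at h1
      rw [abs_of_pos (by linarith)] at h1
      rcases abs_cases (1/3 - 3 * t) with h2 | h2 <;> linarith
    have tshort : chordLen s(tr a, tr (a + (t : S1))) = t := by
      rw [tra, tre, hlen _ _ (by rw [abs_le]; constructor <;> linarith),
        abs_of_neg (by linarith), min_eq_left (by linarith)]; ring
    have ttshort : chordLen s(tr (tr a), tr (tr (a + (t : S1)))) = t := by
      rw [ttra, ttre, hlen _ _ (by rw [abs_le]; constructor <;> linarith),
        abs_of_neg (by linarith), min_eq_left (by linarith)]; ring
    have maj : ∀ {N N'}, IsMajor L N → N' ∈ L → |1/3 - chordLen N'| = |1/3 - chordLen N| →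
        IsMajor L N' := fun h h' e => ⟨h', fun ℓ hℓ => e ▸ h.2 ℓ hℓ⟩
    rw [s3_eq_iff] at hp hq hp2 hq2 hp3 hq3
    rcases hp.resolve_left hpa with rfl | rfl <;> rcases hq.resolve_left hqe with rfl | rfl
    · exact (short _ hM tshort).elim
    · have nb : ∀ N, N ∈ L → N = s(a, tr (a + (t : S1))) → False := by
        rintro N hN rfl
        exact dja (hdis _ (maj hM hN (by rw [l2, l4])))
      refine ⟨by simpa only [l2, a2] using hM.2, ?_, hM.1⟩
      rcases hp2 with rfl | rfl | rfl <;> rcases hq2 with rfl | rfl | rfl <;>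
        rcases hp3 with rfl | rfl | rfl <;> rcases hq3 with rfl | rfl | rfl <;>
        first
        | assumption
        | exact (nb _ hN rfl).elim
        | exact (nb _ hN' rfl).elim
        | (exfalso; simp at n1 n2 n3)
    · have nb : ∀ N, N ∈ L → N = s(a, tr (tr (a + (t : S1)))) → False := by
        rintro N hN rfl
        exact dja (hdis _ (maj hM hN (by rw [l1, l3])))
      refine ⟨by simpa only [l1, a1] using hM.2, hM.1, ?_⟩
      rcases hp2 with rfl | rfl | rfl <;> rcases hq2 with rfl | rfl | rfl <;>
        rcases hp3 with rfl | rfl | rfl <;> rcases hq3 with rfl | rfl | rfl <;>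
        first
        | assumption
        | exact (nb _ hN rfl).elim
        | exact (nb _ hN' rfl).elim
        | (exfalso; simp at n1 n2 n3)
    · exact (short _ hM ttshort).elim
  obtain ⟨hη, hM1, hM2⟩ := key
  have hgood : ∀ {x y}, s(x, y) ∈ L → Good a t x y := by
    intro x y h
    refine good_of_not_Xs ht ht' (fun s => ?_) (fun s => ?_) (hη _ h)
    · rw [← ttra, ← tre]; exact L_nc (L_sg s _ _ hM1) h
    · rw [← tra, ← ttre]; exact L_nc (L_sg s _ _ hM2) h
  have hit : ∀ j, s(s3^[j] a, s3^[j] (a + (t : S1))) ∈ L ∧ s3^[j] a ≠ s3^[j] (a + (t : S1)) := by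
    intro j
    induction j with
    | zero => exact ⟨hcL, fun h => hne (congrArg s3 h)⟩
    | succ j ih =>
      rw [Function.iterate_succ_apply', Function.iterate_succ_apply']
      have hne' : s3 (s3^[j] a) ≠ s3 (s3^[j] (a + (t : S1))) := by
        intro h
        rcases norm_s3 (s3^[j] a) (s3^[j] (a + (t : S1))) with h' | h'
        · rw [h, sub_self, norm_zero] at h'
          exact ih.2 (sub_eq_zero.1 (norm_eq_zero.1 (by linarith [h'.2])))
        · rw [h, sub_self, norm_zero] at h'
          have h1 : t ≤ |1/3 - ‖s3^[j] a - s3^[j] (a + (t : S1))‖| := hη _ ih.1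
          rw [show (1/3 - ‖s3^[j] a - s3^[j] (a + (t : S1))‖ : ℝ) =
            (1 - 3 * ‖s3^[j] a - s3^[j] (a + (t : S1))‖) / 3 by ring, abs_div, ← h'.2] at h1
          norm_num at h1
          linarith
      exact ⟨(hL.forward _ ih.1).resolve_right (by simpa [cmap_mk] using hne'), hne'⟩
  exact ⟨a, t, ⟨ht, ht', fun j => hgood (hit j).1, fun i j s => L_nc (hit i).1
    (L_sg s _ _ (hit j).1)⟩, rfl⟩

end SymLam

namespace SymLam

variable {a : S1} {t : ℝ} {P Q : Pc} {x y z w : S1} {X Y : ℕ → Pc}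

/-- The pieces not adjacent to the gaps between majors. -/
def Strong (P : Pc) : Prop := P = .A ∨ P = .B ∨ P = .D

lemma inP_unique (ht : 0 < t) (hP : Strong P) (hQ : Strong Q)
    (h : inP a t P x) (h' : inP a t Q x) : P = Q := by
  have h0 := crd_nonneg a x
  have h1 := crd_lt_one a x
  unfold inP at h h'
  rcases hP with rfl | rfl | rfl <;> rcases hQ with rfl | rfl | rfl <;> first | rfl | skip
  all_goals
    exfalso
    simp only [inC] at h h'
    grind

/-- The label `P` or its antipode. -/
def Pc.sgn : Bool → Pc → Pc
  | false, P => P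
  | true, P => P.neg

lemma Strong.sgn (h : Strong P) (s : Bool) : Strong (P.sgn s) := by
  cases s
  · exact h
  · rcases h with rfl | rfl | rfl
    · exact .inr (.inr rfl)
    · exact .inr (.inl rfl)
    · exact .inl rfl

lemma inP_sgn (ht : 0 < t) (ht' : t < 1/6) (s : Bool) (h : inP a t P x) :
    inP a t (P.sgn s) (sg s x) := by
  cases s
  · exact h
  · exact inP_antip ht ht' h

/-- The set of points with a given itinerary. -/
def Cl (a : S1) (t : ℝ) (X : ℕ → Pc) : Set S1 := {x | ∀ j, inP a t (X j) (s3^[j] x)}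

/-- The shifted itinerary. -/
def sh (X : ℕ → Pc) (n : ℕ) : ℕ → Pc := fun i => X (i + n)

lemma sh_sh (X : ℕ → Pc) (m n : ℕ) : sh (sh X m) n = sh X (n + m) := by
  funext i; simp [sh, add_assoc]

/-- The itinerary of the antipode. -/
def sgI (s : Bool) (X : ℕ → Pc) : ℕ → Pc := fun i => (X i).sgn s

lemma Cl_iter (h : x ∈ Cl a t X) (n : ℕ) : s3^[n] x ∈ Cl a t (sh X n) := by
  intro j
  rw [← Function.iterate_add_apply]; exact h (j + n)

lemma Cl_s3 (h : x ∈ Cl a t X) : s3 x ∈ Cl a t (sh X 1) := Cl_iter h 1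

lemma Cl_sg (ht : 0 < t) (ht' : t < 1/6) (s : Bool) (h : x ∈ Cl a t X) :
    sg s x ∈ Cl a t (sgI s X) := by
  intro j
  rw [iter_sg]; exact inP_sgn ht ht' s (h j)

lemma Cl_inj (ht : 0 < t) (ht' : t < 1/6) (hx : x ∈ Cl a t X) (hy : y ∈ Cl a t X) {n : ℕ}
    (h : s3^[n] x = s3^[n] y) : x = y := by
  induction n with
  | zero => exact h
  | succ n ih =>
    rw [Function.iterate_succ_apply', Function.iterate_succ_apply'] at h
    exact ih (s3_inj_on ht ht' (hx n) (hy n) h)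

lemma norm_image (ht : 0 < t) (ht' : t < 1/6) (h : Good a t x y) :
    ‖s3 x - s3 y‖ = 3 * ‖x - y‖ ∨ 3 * t ≤ ‖s3 x - s3 y‖ := by
  have h1 := good_dist ht ht' h
  rcases norm_s3 x y with ⟨h2, h3⟩ | ⟨h2, h3⟩
  · exact .inl h3
  · right
    rw [h3, show 1 - 3 * ‖x - y‖ = 3 * (1/3 - ‖x - y‖) by ring, abs_mul, abs_of_pos (by norm_num)]
    linarith

lemma Cl_good (hx : x ∈ Cl a t X) (hy : y ∈ Cl a t X) (j : ℕ) :
    Good a t (s3^[j] x) (s3^[j] y) := ⟨X j, hx j, hy j⟩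

lemma norm_back (ht : 0 < t) (ht' : t < 1/6) (hx : x ∈ Cl a t X) (hy : y ∈ Cl a t X) (j : ℕ)
    (h : ‖s3^[j] x - s3^[j] y‖ < 3 * t) : ‖s3^[j] x - s3^[j] y‖ = 3 ^ j * ‖x - y‖ := by
  induction j with
  | zero => simp
  | succ j ih =>
    have h1 := norm_image ht ht' (Cl_good hx hy j)
    rw [← Function.iterate_succ_apply' s3, ← Function.iterate_succ_apply' s3] at h1
    have h0 := norm_nonneg (s3^[j] x - s3^[j] y)
    rcases h1 with h1 | h1
    · rw [h1, ih (by linarith), pow_succ]; ring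
    · linarith

lemma Cl_finite (ht : 0 < t) (ht' : t < 1/6) (X : ℕ → Pc) : (Cl a t X).Finite := by
  by_contra hinf
  obtain ⟨M, hM⟩ := exists_nat_gt (1 / (3 * t))
  obtain ⟨F, hF, hFc⟩ := Set.Infinite.exists_subset_card_eq hinf (M + 1)
  obtain ⟨δ, hδ, hδ'⟩ : ∃ δ > 0, ∀ x ∈ F, ∀ y ∈ F, x ≠ y → δ ≤ ‖x - y‖ := by
    have hfin : ((fun p : S1 × S1 => ‖p.1 - p.2‖) '' (F.offDiag : Set (S1 × S1))).Finite :=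
      F.offDiag.finite_toSet.image _
    rcases ((fun p : S1 × S1 => ‖p.1 - p.2‖) '' (F.offDiag : Set (S1 × S1))).eq_empty_or_nonempty
      with he | hne
    · refine ⟨1, one_pos, fun x hx y hy hxy => ?_⟩
      have : ‖x - y‖ ∈ ((fun p : S1 × S1 => ‖p.1 - p.2‖) '' (F.offDiag : Set (S1 × S1))) :=
        ⟨(x, y), by simp [hx, hy, hxy], rfl⟩
      rw [he] at this; exact this.elim
    · obtain ⟨δ, hδ, hmin⟩ := hfin.exists_minimal hne
      obtain ⟨p, hp, rfl⟩ := hδ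
      refine ⟨‖p.1 - p.2‖, ?_, fun x hx y hy hxy => ?_⟩
      · exact norm_pos_iff.2 (sub_ne_zero.2 (by simpa using (Finset.mem_offDiag.1 hp).2.2))
      · have h1 : ‖x - y‖ ∈ ((fun p : S1 × S1 => ‖p.1 - p.2‖) '' (F.offDiag : Set (S1 × S1))) :=
          ⟨(x, y), by simp [hx, hy, hxy], rfl⟩
        rcases le_total ‖x - y‖ ‖p.1 - p.2‖ with h | h
        · exact hmin h1 h
        · exact h
  obtain ⟨j, hj⟩ := pow_unbounded_of_one_lt (3 * t / δ) (by norm_num : (1:ℝ) < 3)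
  have hmap : ∀ x ∈ F, ⌊crd 0 (s3^[j] x) / (3 * t)⌋₊ ∈ Finset.range M := by
    intro x _
    rw [Finset.mem_range, Nat.floor_lt (div_nonneg (crd_nonneg _ _) (by linarith))]
    refine lt_of_le_of_lt ?_ hM
    gcongr
    exact (crd_lt_one _ _).le
  obtain ⟨x, hx, y, hy, hxy, he⟩ := Finset.exists_ne_map_eq_of_card_lt_of_maps_to
    (by rw [Finset.card_range, hFc]; omega) hmap
  have hd : ‖s3^[j] x - s3^[j] y‖ < 3 * t := by
    rw [norm_crd 0]
    refine lt_of_le_of_lt (min_le_left _ _) ?_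
    have e1 := Nat.floor_le (div_nonneg (crd_nonneg 0 (s3^[j] x)) (by linarith : 0 ≤ 3 * t))
    have e2 := Nat.lt_floor_add_one (crd 0 (s3^[j] x) / (3 * t))
    have e3 := Nat.floor_le (div_nonneg (crd_nonneg 0 (s3^[j] y)) (by linarith : 0 ≤ 3 * t))
    have e4 := Nat.lt_floor_add_one (crd 0 (s3^[j] y) / (3 * t))
    rw [he] at e1 e2
    rw [le_div_iff₀ (by linarith)] at e1 e3
    rw [div_lt_iff₀ (by linarith)] at e2 e4
    rw [abs_lt]; constructor <;> linarith
  have h1 := norm_back ht ht' (hF hx) (hF hy) j hd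
  have h2 := hδ' x hx y hy hxy
  rw [div_lt_iff₀ hδ] at hj
  rw [h1] at hd
  have : (3:ℝ) ^ j * δ ≤ 3 ^ j * ‖x - y‖ := by gcongr
  linarith

lemma Cl_unlinked (ht : 0 < t) (ht' : t < 1/6) (hx : x ∈ Cl a t X) (hz : z ∈ Cl a t X)
    (hy : y ∈ Cl a t Y) (hw : w ∈ Cl a t Y) (h : Xs x z y w) : X = Y := by
  have hn : ∀ n, Xs (s3^[n] x) (s3^[n] z) (s3^[n] y) (s3^[n] w) := by
    intro n
    induction n with
    | zero => exact h
    | succ n ih =>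
      simp only [Function.iterate_succ_apply']
      exact Xs_image ht ht' (Cl_good hx hz n) (Cl_good hy hw n) ih
  funext n
  by_contra hne
  exact not_Xs_of_ne ht ht' hne (hx n) (hz n) (hy n) (hw n) (hn n)

lemma Cl_disjoint (ht : 0 < t) (hX : ∀ j, Strong (X j)) (hY : ∀ j, Strong (Y j))
    (hx : x ∈ Cl a t X) (hy : x ∈ Cl a t Y) : X = Y := by
  funext n
  exact inP_unique ht (hX n) (hY n) (hx n) (hy n)

lemma Legal.norm_sub (h : Legal a t) : ‖(a + (t : S1)) - a‖ = t := by
  rw [add_sub_cancel_left, norm_coe_of_abs_le (by rw [abs_of_pos h.pos]; linarith [h.lt]),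
    abs_of_pos h.pos]

lemma Legal.norm_iter (h : Legal a t) (j : ℕ) :
    3 * t ≤ ‖s3^[j+1] a - s3^[j+1] (a + (t : S1))‖ := by
  induction j with
  | zero =>
    have h1 := norm_s3 a (a + (t:S1))
    rw [norm_sub_rev a, h.norm_sub] at h1
    rcases h1 with h1 | h1
    · exact h1.2.ge
    · linarith [h1.1, h.lt]
  | succ j ih =>
    have h1 := norm_image h.pos h.lt (h.good (j + 1))
    rw [← Function.iterate_succ_apply' s3 (j+1), ← Function.iterate_succ_apply' s3 (j+1)] at h1
    rcases h1 with h1 | h1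
    · rw [h1]; linarith [h.pos]
    · exact h1

lemma strong_of_norm (hx : inP a t P x) (hy : inP a t P y)
    (h : t < ‖x - y‖) : Strong P := by
  rw [norm_crd a] at h
  have h' := lt_of_lt_of_le h (min_le_left _ _)
  unfold inP at hx hy
  rw [lt_abs] at h'
  cases P <;> simp only [Strong, inC] at * <;> first | (simp; done) | (exfalso; grind)

lemma crd_base (a : S1) {t : ℝ} (ht : 0 < t) (ht' : t < 1/6) : crd a (a + (t : S1)) = t :=
  crd_add ht.le (by linarith)

lemma Legal.itinerary (h : Legal a t) : ∃ X : ℕ → Pc, (∀ j, Strong (X j)) ∧ X 0 = .D ∧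
    a ∈ Cl a t X ∧ a + (t : S1) ∈ Cl a t X := by
  have h1 : ∀ j, ∃ P, Strong P ∧ (j = 0 → P = .D) ∧ inP a t P (s3^[j] a) ∧
      inP a t P (s3^[j] (a + (t : S1))) := by
    intro j
    cases j with
    | zero =>
      refine ⟨.D, .inr (.inr rfl), fun _ => rfl, ?_, ?_⟩
      · simp [inP, inC]
      · simp only [Function.iterate_zero, id, inP, inC, crd_base a h.pos h.lt]
        left; exact h.lt.le
    | succ j =>
      obtain ⟨P, hx, hy⟩ := h.good (j + 1)
      exact ⟨P, strong_of_norm hx hy (by linarith [h.norm_iter j, h.pos]), by simp, hx, hy⟩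
  choose X hX using h1
  exact ⟨X, fun j => (hX j).1, (hX 0).2.1 rfl, fun j => (hX j).2.2.1, fun j => (hX j).2.2.2⟩

/-- A short chord with a common itinerary whose first shift does not recur (up to sign) but
which is eventually periodic. -/
structure Setup (a : S1) (t : ℝ) (X : ℕ → Pc) : Prop where
  pos : 0 < t
  lt : t < 1/6
  strong : ∀ j, Strong (X j)
  zero : X 0 = .D
  memL : a ∈ Cl a t X
  memR : a + (t : S1) ∈ Cl a t X
  nrec : ∀ j, 1 ≤ j → sh X (j + 1) ≠ sh X 1
  nrec' : ∀ j, sh X (j + 1) ≠ sgI true (sh X 1)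
  per : ∃ k N, 2 ≤ k ∧ 1 ≤ N ∧ sh X (N + k) = sh X k

lemma perPt_of_maps {S : Set S1} (hS : S.Finite) {n : ℕ} (hn : 1 ≤ n)
    (hm : ∀ x ∈ S, s3^[n] x ∈ S) (hi : ∀ x ∈ S, ∀ y ∈ S, s3^[n] x = s3^[n] y → x = y)
    : ∃ N, 1 ≤ N ∧ ∀ x ∈ S, s3^[N] x = x := by
  classical
  have : Finite S := hS
  let f : S → S := fun x => ⟨s3^[n] x, hm x x.2⟩
  have hf : Function.Injective f := fun x y h =>
    Subtype.ext (hi x x.2 y y.2 (congrArg Subtype.val h))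
  let σ : Equiv.Perm S := Equiv.ofBijective f (Finite.injective_iff_bijective.1 hf)
  have ho : 0 < orderOf σ := orderOf_pos σ
  refine ⟨n * orderOf σ, Nat.mul_pos hn ho, fun x hx => ?_⟩
  have key : ∀ m, ((σ ^ m) ⟨x, hx⟩ : S1) = s3^[n * m] x := by
    intro m
    induction m with
    | zero => simp
    | succ m ih =>
      rw [pow_succ', Equiv.Perm.mul_apply]
      change s3^[n] ((σ ^ m) ⟨x, hx⟩ : S1) = _
      rw [ih, ← Function.iterate_add_apply]; rw [mul_add_one, add_comm]
  rw [← key, pow_orderOf_eq_one]; rfl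

lemma Legal.setup (h : Legal a t) (ha : ¬ PerPt (s3 a))
    (hpa : ∃ k p, 1 ≤ p ∧ s3^[p] (s3^[k] a) = s3^[k] a) :
    ∃ X, Setup a t X := by
  obtain ⟨X, hs, h0, hL, hR⟩ := h.itinerary
  have n1 : ∀ j, 1 ≤ j → sh X (j + 1) ≠ sh X 1 := by
    intro j hj he
    obtain ⟨N, hN, hp⟩ := perPt_of_maps (S := Cl a t (sh X 1)) (Cl_finite h.pos h.lt _) hj
      (fun x hx => by have := Cl_iter hx j; rwa [sh_sh, he] at this)
      (fun x hx y hy e => Cl_inj h.pos h.lt hx hy e)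
    exact ha ⟨N, hN, hp _ (Cl_s3 hL)⟩
  have n2 : ∀ j, sh X (j + 1) ≠ sgI true (sh X 1) := by
    intro j he
    have e : ∀ i, X (i + j + 1) = (X (i + 1)).neg := fun i => congrFun he i
    cases j with
    | zero =>
      have hB : ∀ i, X (i + 1) = .B := by
        intro i
        have := e i
        simp only [add_zero] at this
        generalize X (i + 1) = q at this
        cases q <;> simp [Pc.neg] at this
        rfl
      exact n1 1 le_rfl (by funext i; simp only [sh]; rw [hB i]; exact hB (i + 1))
    | succ j =>
      refine n1 (j + 1 + (j + 1)) (by omega) ?_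
      funext i
      simp only [sh]
      have e1 := e (i + (j + 1))
      rw [show i + (j + 1 + (j + 1) + 1) = i + (j + 1) + (j + 1) + 1 by ring, e1, e i, Pc.neg_neg]
  refine ⟨X, h.pos, h.lt, hs, h0, hL, hR, n1, n2, ?_⟩
  obtain ⟨k, p, hp, hk⟩ := hpa
  have per1 : ∀ x : S1, ∀ k p, s3^[p] (s3^[k] x) = s3^[k] x → ∀ m j,
      s3^[p * m] (s3^[k + j] x) = s3^[k + j] x := by
    intro x k p hx m j
    have h1 : s3^[p * m] (s3^[k] x) = s3^[k] x := by
      rw [Function.iterate_mul]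
      exact (show Function.IsFixedPt s3^[p] (s3^[k] x) from hx).iterate m
    rw [add_comm k j, Function.iterate_add_apply, ← Function.iterate_add_apply, add_comm,
      Function.iterate_add_apply, h1]
  refine ⟨k + 2, p, by omega, hp, ?_⟩
  funext i
  have e1 := per1 a k p hk 1 (2 + i)
  rw [mul_one] at e1
  refine inP_unique h.pos (hs _) (hs _) (hL _) ?_
  rw [show i + (p + (k + 2)) = p + (k + (2 + i)) by ring, Function.iterate_add_apply, e1]
  change inP a t (X (i + (k + 2))) _
  rw [show i + (k + 2) = k + (2 + i) by ring]
  exact hL _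

end SymLam

namespace SymLam

variable {a : S1} {t : ℝ} {P Q : Pc} {x y z w u v : S1} {X Y : ℕ → Pc}

/-- The signed coordinate. -/
def sc (a x : S1) : ℝ := if crd a x ≤ 1/2 then crd a x else crd a x - 1

lemma sc_spec (a x : S1) : a + (sc a x : S1) = x := by
  unfold sc
  split_ifs
  · exact add_crd a x
  · rw [coe_sub_one]; exact add_crd a x

lemma sc_self (a : S1) : sc a a = 0 := by simp [sc]

lemma sc_inj (h : sc a x = sc a y) : x = y := by rw [← sc_spec a x, h, sc_spec]

lemma sc_D (ht : 0 < t) (ht' : t < 1/6) (h : inP a t .D x) :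
    t - 1/6 ≤ sc a x ∧ sc a x ≤ 1/6 := by
  have h0 := crd_nonneg a x
  have h1 := crd_lt_one a x
  simp only [inP, inC] at h
  unfold sc
  split_ifs <;> grind

lemma crd_of_lift (b : S1) {r r' : ℝ} (hx : x = b + (r : S1)) (hy : y = b + (r' : S1)) (n : ℤ)
    (h0 : 0 ≤ r' - r + n) (h1 : r' - r + n < 1) : crd x y = r' - r + n := by
  refine crd_eq ?_ h0 h1
  rw [hx, hy, add_assoc, ← AddCircle.coe_add]
  congr 1
  exact coe_eq_coe_iff.2 ⟨-n, by push_cast; ring⟩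

lemma norm_of_crd (h : crd x y ≤ 1/2) : ‖x - y‖ = crd x y := by
  rw [norm_crd x, crd_self, zero_sub, abs_neg, abs_of_nonneg (crd_nonneg _ _),
    min_eq_left (by linarith)]

lemma norm_lt_of_cyc (h : cyc u x v) (h' : cyc u y v) (hv : crd u v ≤ 1/2) :
    ‖x - y‖ < ‖u - v‖ := by
  rw [cyc_base] at h h'
  rw [norm_of_crd hv, norm_crd u]
  refine lt_of_le_of_lt (min_le_left _ _) ?_
  rw [abs_lt]; constructor <;> linarith

lemma cyc_of_not_Xs (h : cyc u x v) (hX : ¬ Xs u v x y) (h1 : y ≠ u) (h2 : y ≠ v) :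
    cyc u y v := by
  rcases cyc_or h1 h2 (cyc_ne h).2.2 with h3 | h3
  · exact h3
  · exact absurd ((Xs_iff_cyc _ _ _ _).2 (.inl ⟨h, h3⟩)) hX

lemma sg_half (s : Bool) (x : S1) : sg s x = x + (((if s then 1/2 else 0 : ℝ)) : S1) := by
  cases s
  · simp [sg]
  · simp [sg, antip]

lemma lift_aux {r r' κ : ℝ} {s : Bool} (n m : ℤ) (hu : u = z + (r : S1)) (hv : v = z + (r' : S1))
    (hκ : κ = if s then 1/2 else 0) (h0 : 0 ≤ κ - r + n)
    (h1 : κ - r + n ≤ r' - r + m) (h2 : r' - r + m ≤ 1/2) :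
    crd u v ≤ 1/2 ∧ crd u (sg s z) ≤ crd u v := by
  have hs : sg s z = z + (κ : S1) := by rw [sg_half, hκ]
  rw [crd_of_lift z hu hv m (by linarith) (by linarith),
    crd_of_lift z hu hs n h0 (by linarith)]
  exact ⟨h2, h1⟩

/-- If an image chord is not longer, its short arc contains `±s3 a`. -/
lemma image_encloses (ht : 0 < t) (hP : Strong P) (hx : inP a t P x)
    (hy : inP a t P y) (hne : x ≠ y) (h : ‖s3 x - s3 y‖ ≤ ‖x - y‖) :
    ∃ s u v, ((u = s3 x ∧ v = s3 y) ∨ (u = s3 y ∧ v = s3 x)) ∧ crd u v ≤ 1/2 ∧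
      crd u (sg s (s3 a)) ≤ crd u v := by
  wlog hlt : crd a x < crd a y generalizing x y
  · have hlt' : crd a y < crd a x :=
      lt_of_le_of_ne (not_lt.1 hlt) (fun e => hne (crd_inj e).symm)
    obtain ⟨s, u, v, h1, h2⟩ := this hy hx hne.symm
      (by rwa [norm_sub_rev, norm_sub_rev y]) hlt'
    exact ⟨s, u, v, h1.symm, h2⟩
  have hx0 := crd_nonneg a x
  have hy1 := crd_lt_one a y
  have ex := s3_crd a x
  have ey := s3_crd a y
  have hn := norm_s3 x y
  rw [norm_crd a x y] at hn h
  rw [abs_sub_comm, abs_of_pos (by linarith)] at hn h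
  simp only [inP] at hx hy
  generalize crd a x = p at *
  generalize crd a y = q at *
  generalize ‖s3 x - s3 y‖ = N at *
  have hcase : (q - p ≤ 1/2 ∧ min (q - p) (1 - (q - p)) = q - p) ∨
      (1/2 ≤ q - p ∧ min (q - p) (1 - (q - p)) = 1 - (q - p)) := by
    rcases le_total (q - p) (1/2) with h | h
    · exact .inl ⟨h, min_eq_left (by linarith)⟩
    · exact .inr ⟨h, min_eq_right (by linarith)⟩
  generalize min (q - p) (1 - (q - p)) = D at *
  have habs : |1 - 3 * D| = 1 - 3 * D ∨ |1 - 3 * D| = -(1 - 3 * D) := abs_choice _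
  have habs' : 0 ≤ |1 - 3 * D| := abs_nonneg _
  generalize |1 - 3 * D| = E at *
  rcases hP with rfl | rfl | rfl
  · simp only [inC] at hx hy
    refine ⟨false, s3 y, s3 x, .inr ⟨rfl, rfl⟩,
      lift_aux (κ := 0) 2 1 ey ex (by simp) ?_ ?_ ?_⟩ <;> push_cast <;> grind
  · simp only [inC] at hx hy
    have hx' : t + 1/6 ≤ p ∧ p ≤ 1/3 := by grind
    have hy' : t + 2/3 ≤ q ∧ q ≤ 5/6 := by grind
    rcases le_total (3 * (q - p) - 1) (1/2) with h5 | h5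
    · refine ⟨false, s3 x, s3 y, .inl ⟨rfl, rfl⟩,
        lift_aux (κ := 0) 1 (-1) ex ey (by simp) ?_ ?_ ?_⟩ <;> push_cast <;> linarith
    · refine ⟨true, s3 y, s3 x, .inr ⟨rfl, rfl⟩,
        lift_aux (κ := 1/2) 2 2 ey ex (by simp) ?_ ?_ ?_⟩ <;> push_cast <;> linarith
  · simp only [inC] at hx hy
    rcases hx with hx | hx
    · rcases hy with hy | hy
      · exfalso; grind
      · refine ⟨true, s3 x, s3 y, .inl ⟨rfl, rfl⟩,
        lift_aux (κ := 1/2) 0 (-2) ex ey (by simp) ?_ ?_ ?_⟩ <;> push_cast <;> grind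
    · exfalso; grind

lemma sgI_strong (hX : ∀ j, Strong (X j)) (s : Bool) : ∀ j, Strong (sgI s X j) :=
  fun j => (hX j).sgn s

lemma sh_strong (hX : ∀ j, Strong (X j)) (n : ℕ) : ∀ j, Strong (sh X n j) := fun _ => hX _

lemma Setup.ne_sg (S : Setup a t X) {j : ℕ} (hj : 1 ≤ j) (s : Bool) :
    sh X (j + 1) ≠ sgI s (sh X 1) := by
  cases s
  · exact S.nrec j hj
  · exact S.nrec' j

/-- Distinct classes: a chord of one with a point of the other in an arc encloses the other. -/
lemma class_inside (ht : 0 < t) (ht' : t < 1/6) (hX : ∀ j, Strong (X j)) (hY : ∀ j, Strong (Y j))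
    (hne : X ≠ Y) (hu : u ∈ Cl a t X) (hv : v ∈ Cl a t X) (hz : z ∈ Cl a t Y)
    (h : cyc u z v) (hw : w ∈ Cl a t Y) : cyc u w v := by
  refine cyc_of_not_Xs h (fun hc => hne (Cl_unlinked ht ht' hu hv hz hw hc)) ?_ ?_
  · rintro rfl; exact hne (Cl_disjoint ht hX hY hu hw)
  · rintro rfl; exact hne (Cl_disjoint ht hX hY hv hw)

lemma Setup.norm_lt (S : Setup a t X) (hx : x ∈ Cl a t X) (hy : y ∈ Cl a t X) (hne : x ≠ y)
    (j : ℕ) : ‖s3 x - s3 y‖ < ‖s3^[j+2] x - s3^[j+2] y‖ := by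
  induction j using Nat.strong_induction_on with
  | _ j ih =>
    by_contra hcon
    rw [not_lt] at hcon
    have h1 : ‖s3^[j+2] x - s3^[j+2] y‖ ≤ ‖s3^[j+1] x - s3^[j+1] y‖ := by
      cases j with
      | zero => exact hcon
      | succ j => exact hcon.trans (ih j (by omega)).le
    rw [Function.iterate_succ_apply' s3 (j+1), Function.iterate_succ_apply' s3 (j+1)] at h1
    have hne' : s3^[j+1] x ≠ s3^[j+1] y := fun e => hne (Cl_inj S.pos S.lt hx hy e)
    obtain ⟨s, u, v, huv, h2, h3⟩ := image_encloses S.pos (S.strong _) (hx _) (hy _) hne' h1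
    rw [← Function.iterate_succ_apply' s3, ← Function.iterate_succ_apply' s3] at huv
    have hN := S.ne_sg (j := j + 1) (by omega) s
    have hxm := Cl_iter hx (j + 2)
    have hym := Cl_iter hy (j + 2)
    have hu : u ∈ Cl a t (sh X (j + 2)) := by rcases huv with ⟨rfl, rfl⟩ | ⟨rfl, rfl⟩ <;> assumption
    have hv : v ∈ Cl a t (sh X (j + 2)) := by rcases huv with ⟨rfl, rfl⟩ | ⟨rfl, rfl⟩ <;> assumption
    have hs1 := sh_strong S.strong (j + 2)
    have hs2 := sgI_strong (sh_strong S.strong 1) s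
    have hcl : ∀ {p}, p ∈ Cl a t X → sg s (s3 p) ∈ Cl a t (sgI s (sh X 1)) := fun hp =>
      Cl_sg S.pos S.lt s (Cl_s3 hp)
    have hcyc : cyc u (sg s (s3 a)) v := by
      rw [cyc_base]
      refine ⟨lt_of_le_of_ne (crd_nonneg _ _) fun e => ?_, lt_of_le_of_ne h3 fun e => ?_⟩
      · have e' : sg s (s3 a) = u := crd_eq_zero.1 e.symm
        exact hN (Cl_disjoint S.pos hs1 hs2 hu (e' ▸ hcl S.memL))
      · exact hN (Cl_disjoint S.pos hs1 hs2 hv (crd_inj e ▸ hcl S.memL))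
    have hlt := norm_lt_of_cyc
      (class_inside S.pos S.lt hs1 hs2 hN hu hv (hcl S.memL) hcyc (hcl hx))
      (class_inside S.pos S.lt hs1 hs2 hN hu hv (hcl S.memL) hcyc (hcl hy)) h2
    rw [sg_sub_sg] at hlt
    have : ‖u - v‖ = ‖s3^[j+2] x - s3^[j+2] y‖ := by
      rcases huv with ⟨rfl, rfl⟩ | ⟨rfl, rfl⟩
      · rfl
      · exact norm_sub_rev _ _
    linarith

lemma Setup.sc_mem (S : Setup a t X) (hx : x ∈ Cl a t X) : t - 1/6 ≤ sc a x ∧ sc a x ≤ 1/6 := by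
  have := hx 0
  rw [S.zero] at this
  exact sc_D S.pos S.lt this

lemma s3_sc (a x : S1) : s3 x = s3 a + ((3 * sc a x : ℝ) : S1) := by
  rw [← s3_add, sc_spec]

lemma Setup.sc_sub_lt (S : Setup a t X) (hx : x ∈ Cl a t X) (hy : y ∈ Cl a t X) :
    sc a y - sc a x < 1/6 := by
  by_contra hcon
  rw [not_lt] at hcon
  have h1 := S.sc_mem hx
  have h2 := S.sc_mem hy
  have ht := S.pos
  have e1 := s3_sc a x
  have e2 := s3_sc a y
  have e3 : sg true (s3 x) = s3 a + ((3 * sc a x + 1/2 : ℝ) : S1) := by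
    rw [sg_half, e1, if_pos rfl, add_assoc, ← AddCircle.coe_add]
  have e4 : sg true (s3 y) = s3 a + ((3 * sc a y - 1/2 : ℝ) : S1) := by
    rw [sg_half, e2, if_pos rfl, add_assoc, ← AddCircle.coe_add]
    congr 1; exact coe_eq_coe_iff.2 ⟨1, by push_cast; ring⟩
  have e0 : s3 a = s3 a + ((0 : ℝ) : S1) := by simp
  have hN : sgI true (sh X 1) ≠ sh X 1 := (S.nrec' 0).symm
  have m1 := Cl_s3 hx
  have m2 := Cl_s3 S.memL
  have m3 := Cl_sg S.pos S.lt true (Cl_s3 hx)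
  have m4 := Cl_sg S.pos S.lt true (Cl_s3 hy)
  have hs1 := sh_strong S.strong 1
  have hs2 := sgI_strong hs1 true
  have n1 : 3 * sc a y - 1/2 ≠ 0 := fun e => by
    rw [e, ← e0] at e4
    exact hN (Cl_disjoint S.pos hs2 hs1 (e4 ▸ m4) m2)
  have n2 : 3 * sc a y - 1/2 ≠ 3 * sc a x := fun e => by
    rw [e, ← e1] at e4
    exact hN (Cl_disjoint S.pos hs2 hs1 (e4 ▸ m4) m1)
  refine hN (Cl_unlinked S.pos S.lt m4 m3 m1 m2 ?_)
  have l1 : 3 * sc a x < 3 * sc a y - 1/2 := lt_of_le_of_ne (by linarith) n2.symm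
  have l2 : 3 * sc a y - 1/2 < 0 := lt_of_le_of_ne (by linarith) n1
  rw [Xs_rel (s3 a) e4 e3 e1 e0 (by rw [abs_lt]; constructor <;> linarith)
    (by rw [abs_lt]; constructor <;> linarith) (by rw [abs_lt]; constructor <;> linarith)
    (by rw [abs_lt]; constructor <;> linarith), neg_prod4]
  right
  constructor
  · nlinarith
  · nlinarith

lemma piece_escape {p q r r' : ℝ} (ht : 0 < t) (ht' : t < 1/6) (hP : Strong P)
    (hp : p ≤ 0) (hq : t ≤ q) (hpq : q - p < 1/6) (hpr : p ≤ r) (hrr : r < r') (hrq : r' ≤ q)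
    (hz : inP a t P z) (hz' : ¬ inP (a + (r : S1)) (r' - r) P z) :
    ∃ s, (P = .D → s = true) ∧
      cyc (sg s (s3 (a + (p : S1)))) (s3 z) (sg s (s3 (a + (q : S1)))) := by
  have h0 := crd_nonneg a z
  have h1 := crd_lt_one a z
  have h2 := crd_nonneg (a + (r : S1)) z
  have h3 := crd_lt_one (a + (r : S1)) z
  have e : ∃ n : ℤ, crd (a + (r : S1)) z = crd a z - r + n := by
    obtain ⟨n, hn⟩ := exists_rep_coe (crd a z - r)
    refine ⟨n, ?_⟩
    rw [← hn, crd]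
    congr 1
    nth_rw 1 [← add_crd a z]
    rw [AddCircle.coe_sub]; abel
  obtain ⟨n, hn⟩ := e
  have ez := s3_crd a z
  have key : ∀ (s : Bool) (κ : ℝ) (m : ℤ), κ = (if s then 1/2 else 0) →
      3 * p + κ < 3 * crd a z - m → 3 * crd a z - m < 3 * q + κ →
      cyc (sg s (s3 (a + (p : S1)))) (s3 z) (sg s (s3 (a + (q : S1)))) := by
    intro s κ m hκ hl hr
    have ep : sg s (s3 (a + (p : S1))) = s3 a + ((3 * p + κ : ℝ) : S1) := by
      rw [sg_half, s3_add, ← hκ, add_assoc, ← AddCircle.coe_add]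
    have eq : sg s (s3 (a + (q : S1))) = s3 a + ((3 * q + κ : ℝ) : S1) := by
      rw [sg_half, s3_add, ← hκ, add_assoc, ← AddCircle.coe_add]
    have ez' : s3 z = s3 a + ((3 * crd a z - m : ℝ) : S1) := by
      rw [ez]; congr 1; exact coe_eq_coe_iff.2 ⟨m, by ring⟩
    rw [cyc_rel (s3 a) ep ez' eq (by rw [abs_lt]; constructor <;> linarith)
      (by rw [abs_lt]; constructor <;> linarith) (by rw [abs_lt]; constructor <;> linarith),
      pos_prod3]
    exact .inl ⟨hl, hr⟩
  have hnn : n = -1 ∨ n = 0 ∨ n = 1 := by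
    have u1 : (n : ℝ) < 2 := by linarith
    have u2 : (-2 : ℝ) < n := by linarith
    have u1' : n < 2 := by exact_mod_cast u1
    have u2' : -2 < n := by exact_mod_cast u2
    omega
  have hn' : (n : ℝ) = -1 ∨ (n : ℝ) = 0 ∨ (n : ℝ) = 1 := by
    rcases hnn with rfl | rfl | rfl <;> simp
  simp only [inP] at hz hz'
  rw [hn] at hz' h2 h3
  clear hn ez
  generalize crd a z = ρ at *
  generalize (n : ℝ) = ν at *
  rcases hP with rfl | rfl | rfl
  · simp only [inC] at hz hz'
    refine ⟨false, by simp, ?_⟩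
    rcases le_or_gt ρ (1/2) with h | h
    · refine key false 0 1 (by simp) ?_ ?_ <;> push_cast <;> grind
    · refine key false 0 2 (by simp) ?_ ?_ <;> push_cast <;> grind
  · simp only [inC] at hz hz'
    have hc : (t + 1/6 ≤ ρ ∧ ρ < r' + 1/6) ∨ (r + 1/3 < ρ ∧ ρ ≤ 1/3) ∨
      (t + 2/3 ≤ ρ ∧ ρ < r' + 2/3) ∨ (r + 5/6 < ρ ∧ ρ ≤ 5/6) := by
      rcases hn' with rfl | rfl | rfl <;> grind
    rcases hc with hc | hc | hc | hc
    · exact ⟨true, by simp, key true (1/2) 0 (by simp) (by push_cast; linarith)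
        (by push_cast; linarith)⟩
    · exact ⟨false, by simp, key false 0 1 (by simp) (by push_cast; linarith)
        (by push_cast; linarith)⟩
    · exact ⟨false, by simp, key false 0 2 (by simp) (by push_cast; linarith)
        (by push_cast; linarith)⟩
    · exact ⟨true, by simp, key true (1/2) 2 (by simp) (by push_cast; linarith)
        (by push_cast; linarith)⟩
  · simp only [inC] at hz hz'
    refine ⟨true, by simp, ?_⟩
    rcases le_or_gt ρ (1/2) with h | h
    · refine key true (1/2) 0 (by simp) ?_ ?_ <;> push_cast <;> grind
    · refine key true (1/2) 2 (by simp) ?_ ?_ <;> push_cast <;> grind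

end SymLam

namespace SymLam

variable {a : S1} {t : ℝ} {P Q : Pc} {x y z w u v : S1} {X Y : ℕ → Pc}

lemma norm_s3_of_sc (S : Setup a t X) (hx : x ∈ Cl a t X) (hy : y ∈ Cl a t X)
    (h : sc a x ≤ sc a y) : crd (s3 x) (s3 y) = 3 * (sc a y - sc a x) := by
  have h1 := S.sc_sub_lt hx hy
  rw [crd_of_lift (s3 a) (s3_sc a x) (s3_sc a y) 0 (by push_cast; linarith)
    (by push_cast; linarith)]
  push_cast; ring

/-- No later class meets the arc spanned by a pair in the first image class. -/
lemma Setup.not_enter (S : Setup a t X) (hx : x ∈ Cl a t X) (hy : y ∈ Cl a t X)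
    (h : sc a x < sc a y) {j : ℕ} {s : Bool} (hs : j = 0 → s = true)
    (hz : z ∈ Cl a t (sh X (j + 1))) : ¬ cyc (sg s (s3 x)) z (sg s (s3 y)) := by
  intro hc
  have hN : sgI s (sh X 1) ≠ sh X (j + 1) := by
    cases s
    · exact (S.nrec j (Nat.pos_of_ne_zero fun e => by simpa using hs e)).symm
    · exact (S.nrec' j).symm
  have hs1 := sh_strong S.strong (j + 1)
  have hs2 := sgI_strong (sh_strong S.strong 1) s
  have m1 := Cl_sg S.pos S.lt s (Cl_s3 hx)
  have m2 := Cl_sg S.pos S.lt s (Cl_s3 hy)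
  have hlen : crd (sg s (s3 x)) (sg s (s3 y)) ≤ 1/2 := by
    rw [crd_sg, norm_s3_of_sc S hx hy h.le]; linarith [S.sc_sub_lt hx hy]
  have c1 := class_inside S.pos S.lt hs2 hs1 hN m1 m2 hz hc (Cl_iter hx (j + 1))
  have c2 := class_inside S.pos S.lt hs2 hs1 hN m1 m2 hz hc (Cl_iter hy (j + 1))
  have hlt := norm_lt_of_cyc c1 c2 hlen
  rw [sg_sub_sg] at hlt
  cases j with
  | zero => exact lt_irrefl _ hlt
  | succ j =>
    exact absurd (S.norm_lt hx hy (fun e => by rw [e] at h; exact lt_irrefl _ h) j) (not_lt.2 hlt.le)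

lemma Setup.sc_base (S : Setup a t X) : sc a (a + (t : S1)) = t := by
  rw [sc, crd_base a S.pos S.lt, if_pos (by linarith [S.lt])]

/-- Every pair in the class of `a` can serve as the base chord. -/
lemma Setup.hull (S : Setup a t X) (hx : x ∈ Cl a t X) (hy : y ∈ Cl a t X)
    (h : sc a x < sc a y) (hz : z ∈ Cl a t X) : z ∈ Cl x (sc a y - sc a x) X := by
  intro j
  by_contra hcon
  obtain ⟨p, hp, hp0, hpx⟩ : ∃ p ∈ Cl a t X, sc a p ≤ 0 ∧ sc a p ≤ sc a x := by
    rcases le_total (sc a x) 0 with h0 | h0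
    · exact ⟨x, hx, h0, le_rfl⟩
    · exact ⟨a, S.memL, (sc_self a).le, by rwa [sc_self]⟩
  obtain ⟨q, hq, hq0, hqy⟩ : ∃ q ∈ Cl a t X, t ≤ sc a q ∧ sc a y ≤ sc a q := by
    rcases le_total t (sc a y) with h0 | h0
    · exact ⟨y, hy, h0, le_rfl⟩
    · exact ⟨_, S.memR, S.sc_base.ge, by rwa [S.sc_base]⟩
  obtain ⟨s, hs, hc⟩ := piece_escape (P := X j) (z := s3^[j] z) (r := sc a x) (r' := sc a y)
    S.pos S.lt (S.strong j) hp0 hq0 (S.sc_sub_lt hp hq) hpx h hqy (hz j)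
    (by rw [sc_spec]; exact hcon)
  rw [sc_spec, sc_spec] at hc
  refine S.not_enter hp hq (by linarith [S.pos]) (s := s) (j := j) ?_ ?_ hc
  · rintro rfl; exact hs S.zero
  · have := Cl_iter hz (j + 1)
    rwa [Function.iterate_succ_apply'] at this

lemma add_sc_sub (a x y : S1) : x + ((sc a y - sc a x : ℝ) : S1) = y := by
  rw [AddCircle.coe_sub, eq_sub_of_add_eq' (sc_spec a x), eq_sub_of_add_eq' (sc_spec a y)]; abel

lemma Setup.rebase (S : Setup a t X) (hx : x ∈ Cl a t X) (hy : y ∈ Cl a t X)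
    (h : sc a x < sc a y) : Setup x (sc a y - sc a x) X where
  pos := by linarith
  lt := S.sc_sub_lt hx hy
  strong := S.strong
  zero := S.zero
  memL := S.hull hx hy h hx
  memR := by
    rw [add_sc_sub]; exact S.hull hx hy h hy
  nrec := S.nrec
  nrec' := S.nrec'
  per := S.per

lemma sc_change {r : ℝ} (hz : z = x + (r : S1)) (h : |r| < 1/2) : sc x z = r := by
  rw [abs_lt] at h
  unfold sc
  rcases le_or_gt 0 r with h0 | h0
  · rw [crd_eq hz h0 (by linarith), if_pos (by linarith)]
  · rw [crd_eq (s := r + 1) (by rw [hz]; congr 1; exact coe_eq_coe_iff.2 ⟨-1, by push_cast; ring⟩)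
      (by linarith) (by linarith), if_neg (by linarith)]; ring

lemma Setup.sc_rebase (S : Setup a t X) (hx : x ∈ Cl a t X) (hz : z ∈ Cl a t X) :
    sc x z = sc a z - sc a x := by
  refine sc_change (add_sc_sub a x z).symm ?_
  have h1 := S.sc_sub_lt hx hz
  have h2 := S.sc_sub_lt hz hx
  rw [abs_lt]; constructor <;> linarith

lemma Setup.rebase_Cl (S : Setup a t X) (hx : x ∈ Cl a t X) (hy : y ∈ Cl a t X)
    (h : sc a x < sc a y) : Cl x (sc a y - sc a x) X = Cl a t X := by
  refine Subset.antisymm (fun z hz => ?_) (fun z hz => S.hull hx hy h hz)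
  have S' := S.rebase hx hy h
  have ha := S.hull hx hy h S.memL
  have he := S.hull hx hy h S.memR
  have e1 : sc x (a + (t : S1)) - sc x a = t := by
    rw [S.sc_rebase hx S.memL, S.sc_rebase hx S.memR, S.sc_base, sc_self]; ring
  have := S'.hull ha he (by linarith [S.pos]) hz
  rwa [e1] at this

/-- Points outside the images of the holes lift to the piece. -/
lemma piece_surj (ht : 0 < t) (ht' : t < 1/6) (hP : Strong P)
    (h : ∀ s, (P = .D → s = true) → (P = .A → s = false) →
      ¬ cyc (sg s (s3 a)) z (sg s (s3 (a + (t : S1))))) :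
    ∃ w, inP a t P w ∧ s3 w = z := by
  have h0 := crd_nonneg (s3 a) z
  have h1 := crd_lt_one (s3 a) z
  have hz := add_crd (s3 a) z
  have hc : ∀ s : Bool, cyc (sg s (s3 a)) z (sg s (s3 (a + (t : S1)))) ↔
      ((if s then 1/2 else 0 : ℝ) < crd (s3 a) z ∧
        crd (s3 a) z < 3 * t + (if s then 1/2 else 0 : ℝ)) := by
    intro s
    have e1 : sg s (s3 a) = s3 a + ((if s then 1/2 else 0 : ℝ) : S1) := sg_half _ _
    have e2 : sg s (s3 (a + (t : S1))) = s3 a + ((3 * t + (if s then 1/2 else 0 : ℝ) : ℝ) : S1) := by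
      rw [sg_half, s3_add, add_assoc, ← AddCircle.coe_add]
    have b : (0 : ℝ) ≤ (if s then 1/2 else 0 : ℝ) ∧ (if s then 1/2 else 0 : ℝ) ≤ 1/2 := by
      split_ifs <;> norm_num
    generalize (if s then 1/2 else 0 : ℝ) = κ at *
    rw [cyc_iff (s3 a), crd_eq e1 b.1 (by linarith), crd_eq e2 (by linarith) (by linarith)]
    constructor
    · intro h; grind
    · intro h; exact .inl h
  have hf := h false
  have ht2 := h true
  rw [hc] at hf ht2
  generalize crd (s3 a) z = ρ at *
  have key : ∀ (r : ℝ) (n : ℤ), 0 ≤ r → r < 1 → 3 * r = ρ + n → inC t P r →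
      ∃ w, inP a t P w ∧ s3 w = z := by
    intro r n hr0 hr1 hr hP
    refine ⟨a + (r : S1), by rwa [inP, crd_add hr0 hr1], ?_⟩
    rw [s3_add, ← hz]; congr 1; exact coe_eq_coe_iff.2 ⟨n, hr⟩
  clear h hc
  simp only [if_true, Bool.false_eq_true, if_false] at hf ht2
  rcases hP with rfl | rfl | rfl
  · simp only [inC] at key
    simp at hf ht2
    rcases le_or_gt ρ 0 with h | h
    · exact key (2/3) 2 (by norm_num) (by norm_num) (by push_cast; linarith) (by constructor <;> linarith)
    · exact key ((ρ + 1)/3) 1 (by linarith) (by linarith) (by push_cast; linarith)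
        (by constructor <;> linarith [hf h])
  · simp only [inC] at key
    simp at hf ht2
    rcases le_or_gt ρ 0 with h | h
    · exact key (1/3) 1 (by norm_num) (by norm_num) (by push_cast; linarith) (by left; constructor <;> linarith)
    · have h2 := hf h
      rcases le_or_gt ρ (1/2) with h3 | h3
      · exact key ((ρ + 2)/3) 2 (by linarith) (by linarith) (by push_cast; linarith)
          (by right; constructor <;> linarith)
      · exact key (ρ/3) 0 (by linarith) (by linarith) (by push_cast; linarith)
          (by left; constructor <;> linarith [ht2 (by linarith)])
  · simp only [inC] at key
    simp at hf ht2
    rcases le_or_gt ρ (1/2) with h3 | h3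
    · exact key (ρ/3) 0 (by linarith) (by linarith) (by push_cast; linarith)
          (by left; linarith)
    · exact key ((ρ + 2)/3) 2 (by linarith) (by linarith) (by push_cast; linarith)
          (by right; linarith [ht2 (by linarith)])

lemma Cl_of_image (h0 : inP a t (X 0) w) (h : s3 w ∈ Cl a t (sh X 1)) : w ∈ Cl a t X := by
  intro j
  cases j with
  | zero => exact h0
  | succ j => exact h j

lemma Setup.surj_one (S : Setup a t X) {j : ℕ} (hz : z ∈ Cl a t (sh X (j + 1))) :
    ∃ w ∈ Cl a t (sh X j), s3 w = z := by
  obtain ⟨w, hw, rfl⟩ := piece_surj (z := z) S.pos S.lt (S.strong j) (fun s hs _ =>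
    S.not_enter S.memL S.memR (by rw [sc_self, S.sc_base]; exact S.pos) (j := j)
      (fun e => hs (by rw [e]; exact S.zero)) hz)
  exact ⟨w, Cl_of_image (by simpa [sh] using hw) (by rwa [sh_sh, add_comm]), rfl⟩

lemma Setup.surj (S : Setup a t X) (i : ℕ) {j : ℕ} (hz : z ∈ Cl a t (sh X (i + j))) :
    ∃ w ∈ Cl a t (sh X j), s3^[i] w = z := by
  induction i generalizing z with
  | zero => exact ⟨z, by simpa using hz, rfl⟩
  | succ i ih =>
    rw [show i + 1 + j = i + j + 1 by ring] at hz
    obtain ⟨w, hw, rfl⟩ := S.surj_one hz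
    obtain ⟨w', hw', rfl⟩ := ih hw
    exact ⟨w', hw', Function.iterate_succ_apply' _ _ _⟩

lemma cyc_iter_iff (ht : 0 < t) (ht' : t < 1/6) (hx : x ∈ Cl a t X) (hy : y ∈ Cl a t X)
    (hz : z ∈ Cl a t X) (i : ℕ) : cyc (s3^[i] x) (s3^[i] y) (s3^[i] z) ↔ cyc x y z := by
  induction i with
  | zero => rfl
  | succ i ih =>
    simp only [Function.iterate_succ_apply']
    rw [cyc_image_iff ht ht' (hx i) (hy i) (hz i), ih]

end SymLam

namespace SymLam

variable {a : S1} {t : ℝ} {P Q : Pc} {x y z w u v : S1} {X Y Z Z' : ℕ → Pc} {k : ℕ}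

lemma sgn_sgn (s s' : Bool) (P : Pc) : (P.sgn s').sgn s = P.sgn (xor s s') := by
  cases s <;> cases s' <;> cases P <;> rfl

lemma sgI_sgI (s s' : Bool) (X : ℕ → Pc) : sgI s (sgI s' X) = sgI (xor s s') X := by
  funext i; exact sgn_sgn s s' (X i)

lemma sh_sgI (s : Bool) (X : ℕ → Pc) (n : ℕ) : sh (sgI s X) n = sgI s (sh X n) := rfl

lemma sgI_false (X : ℕ → Pc) : sgI false X = X := rfl

/-- The signed shifts of `X` by at least `k`. -/
def PC (X : ℕ → Pc) (k : ℕ) (Z : ℕ → Pc) : Prop := ∃ s j, k ≤ j ∧ Z = sgI s (sh X j)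

lemma PC.step (h : PC X k Z) (s : Bool) (i : ℕ) : PC X k (sgI s (sh Z i)) := by
  obtain ⟨s', j, hj, rfl⟩ := h
  exact ⟨xor s s', i + j, by omega, by rw [sh_sgI, sh_sh, sgI_sgI]⟩

lemma PC.strong (S : Setup a t X) (h : PC X k Z) : ∀ j, Strong (Z j) := by
  obtain ⟨s', j, hj, rfl⟩ := h
  exact sgI_strong (sh_strong S.strong j) s'

lemma PC.ne (S : Setup a t X) (hk : 2 ≤ k) (h : PC X k Z) : Z ≠ sh X 1 := by
  obtain ⟨s, j, hj, rfl⟩ := h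
  intro e
  obtain ⟨i, rfl⟩ : ∃ i, j = i + 1 := ⟨j - 1, by omega⟩
  refine S.ne_sg (j := i) (by omega) s ?_
  rw [← e, sgI_sgI, Bool.xor_self]; rfl

lemma sh_per {N : ℕ} (h : sh X (N + k) = sh X k) {j : ℕ} (hj : k ≤ j) (m : ℕ) :
    sh X (N * m + j) = sh X j := by
  obtain ⟨i, rfl⟩ := Nat.exists_eq_add_of_le hj
  induction m with
  | zero => simp
  | succ m ih =>
    rw [show N * (m + 1) + (k + i) = (N * m + i) + (N + k) by ring, ← sh_sh, h, sh_sh,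
      ← ih]; congr 1; ring

lemma PC.per {N : ℕ} (h : sh X (N + k) = sh X k) (hZ : PC X k Z) : sh Z N = Z := by
  obtain ⟨s, j, hj, rfl⟩ := hZ
  rw [sh_sgI, sh_sh]
  have := sh_per h hj 1
  rw [mul_one] at this; rw [this]

lemma PC.trans {N : ℕ} (hN : 1 ≤ N) (h : sh X (N + k) = sh X k) (hZ : PC X k Z)
    (hZ' : PC X k Z') : ∃ s i, sgI s (sh Z i) = Z' := by
  obtain ⟨s, j, hj, rfl⟩ := hZ
  obtain ⟨s', j', hj', rfl⟩ := hZ'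
  have hle : j ≤ N * j + j' := by nlinarith
  refine ⟨xor s' s, N * j + j' - j, ?_⟩
  rw [sh_sgI, sh_sh, sgI_sgI, Bool.xor_assoc, Bool.xor_self, Bool.xor_false,
    Nat.sub_add_cancel hle, sh_per h hj']

lemma PC.fix (S : Setup a t X) {N : ℕ} (hN : 1 ≤ N) (h : sh X (N + k) = sh X k) (hZ : PC X k Z) :
    ∃ M, 1 ≤ M ∧ ∀ z ∈ Cl a t Z, s3^[M] z = z :=
  perPt_of_maps (Cl_finite S.pos S.lt Z) hN
    (fun x hx => by have := Cl_iter hx N; rwa [hZ.per h] at this)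
    (fun x hx y hy e => Cl_inj S.pos S.lt hx hy e)

/-- A shortest pair in the orbit of a pair of points of a periodic class. -/
structure MinC (a : S1) (t : ℝ) (X : ℕ → Pc) (k : ℕ) (Z : ℕ → Pc) (u v : S1) : Prop where
  pc : PC X k Z
  memL : u ∈ Cl a t Z
  memR : v ∈ Cl a t Z
  short : crd u v ≤ 1/2
  enc : cyc u (s3 a) v
  min : ∀ n, ‖u - v‖ ≤ ‖s3^[n] u - s3^[n] v‖

lemma exists_minC (S : Setup a t X) {N : ℕ} (hk : 2 ≤ k) (hN : 1 ≤ N) (h : sh X (N + k) = sh X k)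
    (hZ : PC X k Z) (hx : x ∈ Cl a t Z) (hy : y ∈ Cl a t Z) (hne : x ≠ y) :
    ∃ s i u v, ((u = sg s (s3^[i] x) ∧ v = sg s (s3^[i] y)) ∨
      (u = sg s (s3^[i] y) ∧ v = sg s (s3^[i] x))) ∧ MinC a t X k (sgI s (sh Z i)) u v ∧
      ‖u - v‖ ≤ ‖x - y‖ := by
  obtain ⟨M, hM, hfix⟩ := hZ.fix S hN h
  obtain ⟨i, -, hi⟩ := Finset.exists_min_image (Finset.range M)
    (fun n => ‖s3^[n] x - s3^[n] y‖) ⟨0, Finset.mem_range.2 hM⟩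
  have hmin : ∀ n, ‖s3^[i] x - s3^[i] y‖ ≤ ‖s3^[n] x - s3^[n] y‖ := by
    intro n
    have e1 := Function.IsPeriodicPt.iterate_mod_apply (f := s3) (n := M) (hfix x hx) n
    have e2 := Function.IsPeriodicPt.iterate_mod_apply (f := s3) (n := M) (hfix y hy) n
    rw [← e1, ← e2]
    exact hi _ (Finset.mem_range.2 (Nat.mod_lt _ hM))
  have hback : ∀ z ∈ Cl a t Z, s3 (s3^[i + M - 1] z) = s3^[i] z := by
    intro z hz
    rw [← Function.iterate_succ_apply' s3, show (i + M - 1).succ = i + M by omega,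
      Function.iterate_add_apply, hfix z hz]
  obtain ⟨s, u, v, huv, h1, h2⟩ := image_encloses S.pos (hZ.strong S _) (hx (i + M - 1))
    (hy (i + M - 1)) (fun e => hne (Cl_inj S.pos S.lt hx hy e))
    (by rw [hback x hx, hback y hy]; exact hmin _)
  rw [hback x hx, hback y hy] at huv
  have hpc := hZ.step s i
  have hu : sg s u ∈ Cl a t (sgI s (sh Z i)) := by
    refine Cl_sg S.pos S.lt s ?_
    rcases huv with ⟨rfl, -⟩ | ⟨rfl, -⟩
    · exact Cl_iter hx i
    · exact Cl_iter hy i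
  have hv : sg s v ∈ Cl a t (sgI s (sh Z i)) := by
    refine Cl_sg S.pos S.lt s ?_
    rcases huv with ⟨-, rfl⟩ | ⟨-, rfl⟩
    · exact Cl_iter hy i
    · exact Cl_iter hx i
  have hnorm : ∀ n, ‖s3^[n] (sg s u) - s3^[n] (sg s v)‖ = ‖s3^[n + i] x - s3^[n + i] y‖ := by
    intro n
    rw [iter_sg, iter_sg, sg_sub_sg, Function.iterate_add_apply, Function.iterate_add_apply]
    rcases huv with ⟨rfl, rfl⟩ | ⟨rfl, rfl⟩
    · rfl
    · exact norm_sub_rev _ _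
  have hnorm0 := hnorm 0
  simp only [Function.iterate_zero, id, zero_add] at hnorm0
  have h3 : crd (sg s u) (s3 a) ≤ crd (sg s u) (sg s v) := by
    rw [crd_sg, ← sg_sg_self s (s3 a), crd_sg]; exact h2
  refine ⟨s, i, sg s u, sg s v, ?_, ⟨hpc, hu, hv, ?_, ?_, ?_⟩, ?_⟩
  · rcases huv with ⟨rfl, rfl⟩ | ⟨rfl, rfl⟩ <;> simp
  · rw [crd_sg]; exact h1
  · have hcl := Cl_s3 S.memL
    have hs1 := sh_strong S.strong 1
    rw [cyc_base]
    refine ⟨lt_of_le_of_ne (crd_nonneg _ _) fun e => ?_, lt_of_le_of_ne h3 fun e => ?_⟩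
    · have e' : s3 a = sg s u := crd_eq_zero.1 e.symm
      exact hpc.ne S hk (Cl_disjoint S.pos (hpc.strong S) hs1 hu (e' ▸ hcl))
    · exact hpc.ne S hk (Cl_disjoint S.pos (hpc.strong S) hs1 hv (crd_inj e ▸ hcl))
  · intro n; rw [hnorm n, hnorm0]; exact hmin _
  · rw [hnorm0]; exact hmin 0

lemma MinC.unique (S : Setup a t X) {N : ℕ} (hN : 1 ≤ N) (h : sh X (N + k) = sh X k)
    {u' v' : S1} (m : MinC a t X k Z u v) (m' : MinC a t X k Z' u' v') : Z = Z' := by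
  by_contra hne
  wlog hle : crd u' (s3 a) ≤ crd u (s3 a) generalizing Z Z' u v u' v'
  · exact this m' m (fun e => hne e.symm) (le_of_not_ge hle)
  have hu : cyc u u' v := by
    have c1 := m.enc
    have c2 := m'.enc
    have n1 : u' ≠ u := by
      rintro rfl
      exact hne (Cl_disjoint S.pos (m.pc.strong S) (m'.pc.strong S) m.memL m'.memL)
    have e1 : s3 a = u + (crd u (s3 a) : S1) := (add_crd _ _).symm
    have e2 : u' = u + ((crd u (s3 a) - crd u' (s3 a) : ℝ) : S1) := by
      rw [AddCircle.coe_sub, ← add_sub_assoc, ← e1]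
      nth_rw 1 [← add_crd u' (s3 a)]; abel
    rw [cyc_base] at c1 c2 ⊢
    have e3 := crd_eq e2 (by linarith) (by linarith [crd_lt_one u (s3 a), c2.1])
    rw [e3]
    refine ⟨lt_of_le_of_ne (by linarith) fun e => n1 ?_, by linarith [c1.2, c2.1]⟩
    rw [← e] at e2; simpa using e2
  obtain ⟨s, i, hsi⟩ := m.pc.trans hN h m'.pc
  have key : ∀ p ∈ Cl a t Z, cyc u (sg s (s3^[i] p)) v := fun p hp =>
    class_inside S.pos S.lt (m.pc.strong S) (m'.pc.strong S) hne m.memL m.memR m'.memL hu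
      (hsi ▸ Cl_sg S.pos S.lt s (Cl_iter hp i))
  have := norm_lt_of_cyc (key u m.memL) (key v m.memR) m.short
  rw [sg_sub_sg] at this
  exact absurd (m.min i) (not_le.2 this)

lemma norm_le_of_arc {p q : S1} (hp : crd u p ≤ crd u q) (hq : crd u q ≤ crd u v)
    (hv : crd u v ≤ 1/2) : ‖p - q‖ ≤ ‖u - v‖ := by
  rw [norm_of_crd hv, norm_crd u]
  refine (min_le_left _ _).trans ?_
  have := crd_nonneg u p
  rw [abs_le]; constructor <;> linarith

lemma norm_lt_of_arc {p q : S1} (hp : crd u p ≤ crd u q) (hq : crd u q ≤ crd u v)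
    (hs : 0 < crd u p ∨ crd u q < crd u v) (hv : crd u v ≤ 1/2) : ‖p - q‖ < ‖u - v‖ := by
  rw [norm_of_crd hv, norm_crd u]
  refine (min_le_left _ _).trans_lt ?_
  have := crd_nonneg u p
  rw [abs_lt]; rcases hs with h | h <;> constructor <;> linarith

end SymLam

namespace SymLam

variable {a : S1} {t : ℝ} {P Q : Pc} {p q n n' b x y z w u v : S1} {X Y Z Z' : ℕ → Pc} {k : ℕ}

lemma left_unique {S : Set S1} (h1 : cyc u b v) (h2 : cyc n b p) (hu : u ∈ S) (hn : n ∈ S)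
    (e1 : ∀ w ∈ S, ¬ cyc u w v) (e2 : ∀ w ∈ S, ¬ cyc n w p) : u = n := by
  by_contra hne
  have a1 := e1 n hn
  have a2 := e2 u hu
  simp only [cyc_iff b] at *
  have d1 := crd_self b
  have := crd_nonneg b
  have : crd b u ≠ crd b n := fun e => hne (crd_inj e)
  have := crd_nonneg b u
  have := crd_nonneg b v
  have := crd_nonneg b n
  have := crd_nonneg b p
  generalize crd b u = u at *
  generalize crd b v = v at *
  generalize crd b p = p at *
  generalize crd b n = n at *
  rw [d1] at *
  clear * - h1 h2 a1 a2 this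
  grind

lemma right_unique {S : Set S1} (h1 : cyc u b v) (h2 : cyc n b p) (hu : v ∈ S) (hn : p ∈ S)
    (e1 : ∀ w ∈ S, ¬ cyc u w v) (e2 : ∀ w ∈ S, ¬ cyc n w p) : v = p := by
  by_contra hne
  have a1 := e1 p hn
  have a2 := e2 v hu
  simp only [cyc_iff b] at *
  have d1 := crd_self b
  have : crd b v ≠ crd b p := fun e => hne (crd_inj e)
  have := crd_nonneg b u
  have := crd_nonneg b v
  have := crd_nonneg b n
  have := crd_nonneg b p
  generalize crd b u = u at *
  generalize crd b v = v at *
  generalize crd b p = p at *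
  generalize crd b n = n at *
  rw [d1] at *
  grind

lemma crd_le_of_not_cyc (h : ¬ cyc v y u) (hne : u ≠ v) : crd u y ≤ crd u v := by
  by_contra hlt
  push Not at hlt
  apply h
  rw [cyc_iff u, crd_self]
  have := crd_nonneg u v
  have : crd u v ≠ 0 := fun e => hne (crd_eq_zero.1 e).symm
  grind

lemma cyc_sg_iter_iff (ht : 0 < t) (ht' : t < 1/6) (hx : x ∈ Cl a t X) (hy : y ∈ Cl a t X)
    (hz : z ∈ Cl a t X) (i : ℕ) (s : Bool) :
    cyc (sg s (s3^[i] x)) (sg s (s3^[i] y)) (sg s (s3^[i] z)) ↔ cyc x y z := by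
  rw [cyc_sg, cyc_iter_iff ht ht' hx hy hz]

lemma return_surj (ht : 0 < t) (ht' : t < 1/6) {s : Bool} {i : ℕ} (h : sgI s (sh Z i) = Z)
    (hz : z ∈ Cl a t Z) : ∃ w ∈ Cl a t Z, sg s (s3^[i] w) = z := by
  have hf := Cl_finite (a := a) ht ht' Z
  have hm : MapsTo (fun w => sg s (s3^[i] w)) (Cl a t Z) (Cl a t Z) := fun w hw =>
    h ▸ Cl_sg ht ht' s (Cl_iter hw i)
  have hi : InjOn (fun w => sg s (s3^[i] w)) (Cl a t Z) := fun x hx y hy e =>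
    Cl_inj ht ht' hx hy (sg_injective s e)
  have := Set.surj_on_of_inj_on_of_ncard_le (s := Cl a t Z) (t := Cl a t Z)
    (fun w _ => sg s (s3^[i] w)) (fun w hw => hm hw) (fun x y hx hy e => hi hx hy e) le_rfl hf z hz
  obtain ⟨w, hw, e⟩ := this
  exact ⟨w, hw, e.symm⟩

/-- A consecutive pair shorter than the shortest pair returns to the pair around `s3 a`. -/
lemma MinC.return (S : Setup a t X) {N : ℕ} (hk : 2 ≤ k) (hN : 1 ≤ N) (h : sh X (N + k) = sh X k)
    (m : MinC a t X k Z u v) (hp : p ∈ Cl a t Z) (hq : q ∈ Cl a t Z) (hpq : p ≠ q)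
    (hE : ‖p - q‖ < ‖u - v‖) (hc : ∀ w ∈ Cl a t Z, ¬ cyc p w q)
    (hn : n ∈ Cl a t Z) (hn' : n' ∈ Cl a t Z) (hb : cyc n (s3 a) n')
    (hc' : ∀ w ∈ Cl a t Z, ¬ cyc n w n') :
    ∃ s i, sgI s (sh Z i) = Z ∧ sg s (s3^[i] p) = n ∧ sg s (s3^[i] q) = n' := by
  obtain ⟨s, i, u', v', huv, m', hle⟩ := exists_minC S hk hN h m.pc hp hq hpq
  have hZ : sgI s (sh Z i) = Z := (m.unique S hN h m').symm
  refine ⟨s, i, hZ, ?_⟩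
  rw [hZ] at m'
  have hcτ : ∀ w ∈ Cl a t Z, ¬ cyc (sg s (s3^[i] p)) w (sg s (s3^[i] q)) := by
    intro w hw hh
    obtain ⟨w', hw', rfl⟩ := return_surj S.pos S.lt hZ hw
    rw [cyc_sg_iter_iff S.pos S.lt hp hw' hq] at hh
    exact hc _ hw' hh
  rcases huv with ⟨e1, e2⟩ | ⟨e1, e2⟩
  · rw [← e1, ← e2] at hcτ ⊢
    exact ⟨left_unique m'.enc hb m'.memL hn hcτ hc', right_unique m'.enc hb m'.memR hn' hcτ hc'⟩
  · rw [← e1, ← e2] at hcτ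
    exfalso
    have hne : u' ≠ v' := (cyc_ne m'.enc).2.2
    have h1 := crd_le_of_not_cyc (hcτ u m.memL) hne
    have h2 := crd_le_of_not_cyc (hcτ v m.memR) hne
    have : ‖u - v‖ ≤ ‖u' - v'‖ := by
      rcases le_total (crd u' u) (crd u' v) with h3 | h3
      · exact norm_le_of_arc h3 h2 m'.short
      · rw [norm_sub_rev]; exact norm_le_of_arc h3 h1 m'.short
    linarith

lemma MinC.not_inside (S : Setup a t X) {N : ℕ} (hk : 2 ≤ k) (hN : 1 ≤ N)
    (h : sh X (N + k) = sh X k) (m : MinC a t X k Z u v)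
    (nc : ∀ i s, ¬ Xs u v (sg s (s3^[i] u)) (sg s (s3^[i] v))) (hy : y ∈ Cl a t Z) :
    ¬ cyc u y v := by
  classical
  intro hin
  have hfin := Cl_finite (a := a) S.pos S.lt Z
  have henc := m.enc
  have hin' := hin
  rw [cyc_base] at henc hin'
  have hcl : ∀ w ∈ Cl a t Z, crd u w ≠ crd u (s3 a) := by
    intro w hw e
    have := crd_inj e
    exact m.pc.ne S hk (Cl_disjoint S.pos (m.pc.strong S) (sh_strong S.strong 1) hw
      (this ▸ Cl_s3 S.memL))
  obtain ⟨n, ⟨hn, hnb⟩, hnmax⟩ := Set.exists_max_image {w ∈ Cl a t Z | crd u w < crd u (s3 a)}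
    (crd u) (hfin.subset fun _ h => h.1) ⟨u, m.memL, by rw [crd_self]; exact henc.1⟩
  obtain ⟨p, ⟨hp, hpb⟩, hpmin⟩ := Set.exists_min_image {w ∈ Cl a t Z | crd u (s3 a) < crd u w}
    (crd u) (hfin.subset fun _ h => h.1) ⟨v, m.memR, henc.2⟩
  simp only [mem_ofPred_eq, and_imp] at hnmax hpmin
  have hpv := hpmin v m.memR henc.2
  have hn0 := crd_nonneg u n
  have hnp : cyc n (s3 a) p := by
    rw [cyc_iff u]; grind
  have hgap : ∀ w ∈ Cl a t Z, ¬ cyc n w p := by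
    intro w hw hh
    rw [cyc_iff u] at hh
    rcases lt_or_gt_of_ne (hcl w hw) with h1 | h1
    · have := hnmax w hw h1; grind
    · have := hpmin w hw h1; grind
  -- it suffices to find a return map taking one endpoint inside, the other one being uncrossed
  have finish : ∀ s i, sgI s (sh Z i) = Z → (cyc u (sg s (s3^[i] u)) v ∨ cyc u (sg s (s3^[i] v)) v) →
      False := by
    intro s i _ hor
    have hnx := nc i s
    have hlt : ‖sg s (s3^[i] u) - sg s (s3^[i] v)‖ < ‖u - v‖ := by
      generalize sg s (s3^[i] u) = u' at *
      generalize sg s (s3^[i] v) = v' at *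
      have key : ∀ u' v', cyc u u' v → ¬ Xs u v u' v' → ‖u' - v'‖ < ‖u - v‖ := by
        intro u' v' hc hX
        have hv' : crd u v' ≤ crd u v := by
          by_cases e1 : v' = u
          · rw [e1, crd_self]; exact crd_nonneg _ _
          by_cases e2 : v' = v
          · rw [e2]
          exact ((cyc_base _ _ _).1 (cyc_of_not_Xs hc hX e1 e2)).2.le
        rw [cyc_base] at hc
        rcases le_total (crd u u') (crd u v') with h1 | h1
        · exact norm_lt_of_arc h1 hv' (.inl hc.1) m.short
        · rw [norm_sub_rev]; exact norm_lt_of_arc h1 hc.2.le (.inr hc.2) m.short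
      rcases hor with h1 | h1
      · exact key _ _ h1 hnx
      · rw [norm_sub_rev]
        exact key _ _ h1 (fun hX => hnx (by rwa [Xs_swap_right]))
    rw [sg_sub_sg] at hlt
    exact absurd (m.min i) (not_le.2 hlt)
  have cardc : ∀ s i, sgI s (sh Z i) = Z → ∀ c d c' d' e, c ∈ Cl a t Z → d ∈ Cl a t Z →
      c' = sg s (s3^[i] c) → d' = sg s (s3^[i] d) →
      (∀ w, cyc c w d → cyc c' w d') → e ∈ Cl a t Z → cyc c' e d' → ¬ cyc c e d → False := by
    intro s i hZ c d c' d' e hc hd hc' hd' hsub he hin hout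
    subst hc' hd'
    have hf1 : {w ∈ Cl a t Z | cyc c w d}.Finite := hfin.subset fun _ h => h.1
    have hf2 : {w ∈ Cl a t Z | cyc (sg s (s3^[i] c)) w (sg s (s3^[i] d))}.Finite :=
      hfin.subset fun _ h => h.1
    have h1 : {w ∈ Cl a t Z | cyc c w d}.ncard <
        {w ∈ Cl a t Z | cyc (sg s (s3^[i] c)) w (sg s (s3^[i] d))}.ncard := by
      apply Set.ncard_lt_ncard _ hf2
      refine ⟨fun w hw => ⟨hw.1, hsub w hw.2⟩, fun hh => ?_⟩
      exact hout (hh ⟨he, hin⟩).2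
    have h2 : {w ∈ Cl a t Z | cyc (sg s (s3^[i] c)) w (sg s (s3^[i] d))} ⊆
        (fun w => sg s (s3^[i] w)) '' {w ∈ Cl a t Z | cyc c w d} := by
      rintro w ⟨hw, hh⟩
      obtain ⟨w', hw', rfl⟩ := return_surj S.pos S.lt hZ hw
      rw [cyc_sg_iter_iff S.pos S.lt hc hw' hd] at hh
      exact ⟨w', ⟨hw', hh⟩, rfl⟩
    have h3 := Set.ncard_le_ncard h2 (hf1.image _)
    have h4 := Set.ncard_image_le hf1 (f := fun w => sg s (s3^[i] w))
    omega
  by_cases hv : p = v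
  · have hnu : n ≠ u := by
      rintro rfl
      rw [hv] at hgap
      exact hgap y hy hin
    have hnu' : 0 < crd u n := lt_of_le_of_ne hn0 fun e => hnu (crd_eq_zero.1 e.symm)
    obtain ⟨q, ⟨hq, hqn⟩, hqmax⟩ := Set.exists_max_image {w ∈ Cl a t Z | crd u w < crd u n}
      (crd u) (hfin.subset fun _ h => h.1) ⟨u, m.memL, by rw [crd_self]; exact hnu'⟩
    simp only [mem_ofPred_eq, and_imp] at hqmax
    have hq0 := crd_nonneg u q
    obtain ⟨s, i, hZ, e1, e2⟩ := m.return S hk hN h hq hn (fun e => by rw [e] at hqn; exact lt_irrefl _ hqn)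
      (norm_lt_of_arc hqn.le (by linarith) (.inr (by linarith)) m.short)
      (fun w hw hh => by
        rw [cyc_iff u] at hh
        rcases lt_or_ge (crd u w) (crd u n) with h1 | h1
        · have := hqmax w hw h1; grind
        · grind) hn hp hnp hgap
    refine finish s i hZ (.inl ?_)
    by_contra hout
    have hne : sg s (s3^[i] u) ≠ p := by
      rw [← e2]
      exact fun e => hnu (Cl_inj S.pos S.lt m.memL hn (sg_injective s e)).symm
    have hw : ∀ w, 0 < crd u w → crd u w < crd u v → cyc (sg s (s3^[i] u)) w p := by
      intro w h1 h2
      rw [hv] at hne ⊢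
      rw [cyc_base] at hout
      have : crd u (sg s (s3^[i] u)) ≠ crd u v := fun e => hne (crd_inj e)
      have := crd_nonneg u (sg s (s3^[i] u))
      rw [cyc_iff u]
      grind
    refine cardc s i hZ u n _ p n m.memL hn rfl e2.symm (fun w hh => ?_) hn ?_ ?_
    · rw [cyc_base] at hh; exact hw w hh.1 (by linarith)
    · exact hw n hnu' (by linarith)
    · exact fun hh => (cyc_ne hh).2.1 rfl
  · have hpv' : crd u p < crd u v := lt_of_le_of_ne hpv fun e => hv (crd_inj e)
    obtain ⟨q, ⟨hq, hqp⟩, hqmin⟩ := Set.exists_min_image {w ∈ Cl a t Z | crd u p < crd u w}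
      (crd u) (hfin.subset fun _ h => h.1) ⟨v, m.memR, hpv'⟩
    simp only [mem_ofPred_eq, and_imp] at hqmin
    have hqv := hqmin v m.memR hpv'
    obtain ⟨s, i, hZ, e1, e2⟩ := m.return S hk hN h hp hq (fun e => by rw [e] at hqp; exact lt_irrefl _ hqp)
      (norm_lt_of_arc hqp.le (by linarith) (.inl (by linarith)) m.short)
      (fun w hw hh => by
        rw [cyc_iff u] at hh
        rcases lt_or_ge (crd u p) (crd u w) with h1 | h1
        · have := hqmin w hw h1; grind
        · grind) hn hp hnp hgap
    refine finish s i hZ (.inr ?_)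
    by_contra hout
    have hne : sg s (s3^[i] v) ≠ n := by
      rw [← e1]
      exact fun e => hv (Cl_inj S.pos S.lt m.memR hp (sg_injective s e)).symm
    have hw : ∀ w, crd u n < crd u w → crd u w < crd u v → cyc n w (sg s (s3^[i] v)) := by
      intro w h1 h2
      rw [cyc_base] at hout
      have : crd u (sg s (s3^[i] v)) ≠ crd u n := fun e => hne (crd_inj e)
      have := crd_nonneg u (sg s (s3^[i] v))
      rw [cyc_iff u]
      grind
    refine cardc s i hZ p v n _ p hp m.memR e1.symm rfl (fun w hh => ?_) hp ?_ ?_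
    · rw [cyc_iff u] at hh; exact hw w (by grind) (by grind [crd_nonneg u w])
    · exact hw p (by linarith) (by linarith)
    · exact fun hh => (cyc_ne hh).1 rfl

end SymLam

namespace SymLam

variable {a : S1} {t : ℝ} {P Q : Pc} {p q n n' b x y z w u v : S1} {X Y Z Z' : ℕ → Pc} {k : ℕ}

/-- A legal chord joining points of its class is an edge of the class. -/
lemma Setup.edge_of_legal (S : Setup a t X) (hl : Legal a t) (hz : z ∈ Cl a t X)
    (hw : w ∈ Cl a t X) (h : cyc a z (a + (t : S1))) : ¬ cyc (a + (t : S1)) w a := by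
  intro h'
  obtain ⟨k, N, hk, hN, hp⟩ := S.per
  have hne : s3^[k] a ≠ s3^[k] (a + (t : S1)) := fun e =>
    (cyc_ne h).2.2 (Cl_inj S.pos S.lt S.memL S.memR e)
  obtain ⟨s, i, u, v, huv, m, -⟩ := exists_minC S hk hN hp (Z := sh X k)
    ⟨false, k, le_rfl, rfl⟩ (Cl_iter S.memL k) (Cl_iter S.memR k) hne
  simp only [← Function.iterate_add_apply] at huv
  have hb : Base a t u v := by
    rcases huv with huv | ⟨h1, h2⟩
    · exact ⟨i + k, s, .inl huv⟩
    · exact ⟨i + k, s, .inr ⟨h2, h1⟩⟩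
  have hnc : ∀ i s, ¬ Xs u v (sg s (s3^[i] u)) (sg s (s3^[i] v)) := fun i s =>
    hb.nc hl ((hb.iter i).sg s)
  have hm : ∀ w ∈ Cl a t X, sg s (s3^[i + k] w) ∈ Cl a t (sgI s (sh (sh X k) i)) := fun w hw => by
    rw [sh_sh]; exact Cl_sg S.pos S.lt s (Cl_iter hw _)
  rw [← cyc_sg_iter_iff S.pos S.lt S.memL hz S.memR (i + k) s] at h
  rw [← cyc_sg_iter_iff S.pos S.lt S.memR hw S.memL (i + k) s] at h'
  rcases huv with ⟨rfl, rfl⟩ | ⟨rfl, rfl⟩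
  · exact m.not_inside S hk hN hp hnc (hm z hz) h
  · exact m.not_inside S hk hN hp hnc (hm w hw) h'

lemma Setup.legal_of_edge (S : Setup a t X)
    (h : (∀ w ∈ Cl a t X, ¬ cyc a w (a + (t : S1))) ∨ ∀ w ∈ Cl a t X, ¬ cyc (a + (t : S1)) w a) :
    Legal a t := by
  refine ⟨S.pos, S.lt, fun j => Cl_good S.memL S.memR j, fun i j s hX => ?_⟩
  have h1 := Cl_sg S.pos S.lt s (Cl_iter S.memL j)
  have h2 := Cl_sg S.pos S.lt s (Cl_iter S.memR j)
  have e := Cl_unlinked S.pos S.lt (Cl_iter S.memL i) (Cl_iter S.memR i) h1 h2 hX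
  rw [← e] at h1 h2
  obtain ⟨w1, m1, e1⟩ := S.surj i (j := 0) h1
  obtain ⟨w2, m2, e2⟩ := S.surj i (j := 0) h2
  rw [← e1, ← e2, Xs_iff_cyc] at hX
  change w1 ∈ Cl a t X at m1
  change w2 ∈ Cl a t X at m2
  rw [cyc_iter_iff S.pos S.lt S.memL m1 S.memR, cyc_iter_iff S.pos S.lt S.memR m2 S.memL,
    cyc_iter_iff S.pos S.lt S.memL m2 S.memR, cyc_iter_iff S.pos S.lt S.memR m1 S.memL] at hX
  rcases h with h | h
  · rcases hX with hX | hX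
    · exact h _ m1 hX.1
    · exact h _ m2 hX.1
  · rcases hX with hX | hX
    · exact h _ m2 hX.2
    · exact h _ m1 hX.2

end SymLam

namespace SymLam

variable {a : S1} {t : ℝ} {P Q : Pc} {p q n n' b c x y z w u v : S1} {X Y Z Z' : ℕ → Pc} {k : ℕ}

/-- The points whose first `n` letters are given. -/
def Cyl (a : S1) (t : ℝ) (X : ℕ → Pc) (n : ℕ) : Set S1 := {x | ∀ j < n, inP a t (X j) (s3^[j] x)}

lemma isClosed_Cyl (ht : 0 < t) (ht' : t < 1/6) (X : ℕ → Pc) (n : ℕ) :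
    IsClosed (Cyl a t X n) := by
  have : Cyl a t X n = ⋂ j, ⋂ (_ : j < n), s3^[j] ⁻¹' {x | inP a t (X j) x} := by
    ext x; simp [Cyl]
  rw [this]
  exact isClosed_iInter fun j => isClosed_iInter fun _ =>
    (isClosed_inP ht ht' _).preimage (continuous_s3.iterate j)

lemma Cyl_succ (n : ℕ) : x ∈ Cyl a t X (n + 1) ↔ inP a t (X 0) x ∧ s3 x ∈ Cyl a t (sh X 1) n := by
  constructor
  · intro h
    refine ⟨h 0 (by omega), fun j hj => ?_⟩
    have := h (j + 1) (by omega)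
    rwa [Function.iterate_succ_apply] at this
  · rintro ⟨h0, h⟩ j hj
    cases j with
    | zero => exact h0
    | succ j =>
      rw [Function.iterate_succ_apply]; exact h j (by omega)

/-- Nearest points of a closed set around a point off the set. -/
lemma gap_around {C : Set S1} (hC : IsClosed C) (hp : p ∈ C) (hq : q ∈ C)
    (hc : cyc p c q) (hn : c ∉ C) : ∃ w ∈ C, ∃ z ∈ C, (∀ y ∈ C, ¬ cyc w y z) ∧
      crd p w < crd p c ∧ crd p c < crd p z ∧ (∀ y ∈ C, crd p y < crd p c → crd p y ≤ crd p w) ∧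
      (∀ y ∈ C, crd p c < crd p y → crd p z ≤ crd p y) := by
  rw [cyc_base] at hc
  have hcont : Continuous fun s : ℝ => p + (s : S1) :=
    continuous_const.add (AddCircle.continuous_mk' 1)
  have hD : IsClosed ((fun s : ℝ => p + (s : S1)) ⁻¹' C) := hC.preimage hcont
  have h1 := crd_lt_one p
  have h0 := crd_nonneg p
  obtain ⟨r, ⟨⟨hr0, hrc⟩, hrC⟩, hrmax⟩ := (isCompact_Icc (a := (0:ℝ)) (b := crd p c)).inter_right hD
    |>.exists_isMaxOn ⟨0, ⟨le_rfl, hc.1.le⟩, by simpa using hp⟩ continuous_id.continuousOn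
  obtain ⟨r', ⟨⟨hr0', hrc'⟩, hrC'⟩, hrmin⟩ := (isCompact_Icc (a := crd p c) (b := crd p q)).inter_right hD
    |>.exists_isMinOn ⟨crd p q, ⟨hc.2.le, le_rfl⟩, by simpa [add_crd] using hq⟩
      continuous_id.continuousOn
  have e : crd p (p + (r : S1)) = r := crd_add hr0 (by linarith [h1 c])
  have e' : crd p (p + (r' : S1)) = r' := crd_add (by linarith) (by linarith [h1 q])
  have hmax : ∀ y ∈ C, crd p y < crd p c → crd p y ≤ r := fun y hy hyc =>
    hrmax ⟨⟨h0 y, hyc.le⟩, by simpa [add_crd] using hy⟩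
  have hmin : ∀ y ∈ C, crd p c < crd p y → r' ≤ crd p y := fun y hy hyc => by
    rcases le_total (crd p y) (crd p q) with h | h
    · exact hrmin ⟨⟨hyc.le, h⟩, by simpa [add_crd] using hy⟩
    · linarith
  have hne : r ≠ crd p c := fun h => hn (by rw [← add_crd p c, ← h]; exact hrC)
  have hne' : r' ≠ crd p c := fun h => hn (by rw [← add_crd p c, ← h]; exact hrC')
  have hlt : r < crd p c := lt_of_le_of_ne hrc hne
  have hlt' : crd p c < r' := lt_of_le_of_ne hr0' hne'.symm
  refine ⟨_, hrC, _, hrC', fun y hy h => ?_, by rwa [e], by rwa [e'], by rwa [e], by rwa [e']⟩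
  rw [cyc_iff p, e, e'] at h
  have hyc : crd p y ≠ crd p c := fun h => hn (crd_inj h ▸ hy)
  rcases lt_or_gt_of_ne hyc with h2 | h2
  · have := hmax y hy h2; grind
  · have := hmin y hy h2; grind

/-- The endpoints `a + κ`, `a + t + κ'` of a hole of a piece. -/
def Hole (P : Pc) (κ κ' : ℝ) : Prop :=
  (P = .A ∧ κ = 2/3 ∧ κ' = 1/3) ∨ (P = .D ∧ κ = 1/6 ∧ κ' = 5/6) ∨
  (P = .B ∧ κ = 1/3 ∧ κ' = 2/3) ∨ (P = .B ∧ κ = 5/6 ∧ κ' = 1/6)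

lemma coe_two_int {r r' : ℝ} (n : ℤ) (h : r = r' + n) : (r : S1) = r' := coe_eq_coe_iff.2 ⟨n, h⟩

lemma Hole.image {κ κ' : ℝ} (h : Hole P κ κ') : ∃ s, (P = .D → s = true) ∧ (P = .A → s = false) ∧
    (∀ x : S1, s3 (x + (κ : S1)) = sg s (s3 x)) ∧ (∀ x : S1, s3 (x + (κ' : S1)) = sg s (s3 x)) := by
  have hs : ∀ (s : Bool) (κ : ℝ) (n : ℤ), 3 * κ = (if s then 1/2 else 0 : ℝ) + n →
      ∀ x : S1, s3 (x + (κ : S1)) = sg s (s3 x) := by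
    intro s κ n e x
    rw [s3_add, sg_half, coe_two_int n e]
  rcases h with ⟨rfl, rfl, rfl⟩ | ⟨rfl, rfl, rfl⟩ | ⟨rfl, rfl, rfl⟩ | ⟨rfl, rfl, rfl⟩
  · exact ⟨false, by simp, by simp, hs _ _ 2 (by norm_num), hs _ _ 1 (by norm_num)⟩
  · exact ⟨true, by simp, by simp, hs _ _ 0 (by norm_num), hs _ _ 2 (by norm_num)⟩
  · exact ⟨false, by simp, by simp, hs _ _ 1 (by norm_num), hs _ _ 2 (by norm_num)⟩
  · exact ⟨true, by simp, by simp, hs _ _ 2 (by norm_num), hs _ _ 0 (by norm_num)⟩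

lemma exists_hole (a : S1) (ht : 0 < t) (ht' : t < 1/6) (hP : Strong P) (s : Bool)
    (h1 : P = .D → s = true) (h2 : P = .A → s = false) : ∃ κ κ', Hole P κ κ' ∧
      inP a t P (a + (κ : S1)) ∧ inP a t P (a + (t : S1) + (κ' : S1)) ∧
      s3 (a + (κ : S1)) = sg s (s3 a) ∧
      s3 (a + (t : S1) + (κ' : S1)) = sg s (s3 (a + (t : S1))) := by
  have hs : ∀ (s : Bool) (κ : ℝ) (n : ℤ), 3 * κ = (if s then 1/2 else 0 : ℝ) + n →
      ∀ x : S1, s3 (x + (κ : S1)) = sg s (s3 x) := by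
    intro s κ n e x
    rw [s3_add, sg_half, coe_two_int n e]
  have hin : ∀ κ : ℝ, 0 ≤ κ → κ < 1 → inC t P κ → inP a t P (a + (κ : S1)) := fun κ h0 h1 h => by
    unfold inP; rwa [crd_add h0 h1]
  have hin' : ∀ κ : ℝ, 0 ≤ t + κ → t + κ < 1 → inC t P (t + κ) →
      inP a t P (a + (t : S1) + (κ : S1)) := fun κ h0 h1 h => by
    unfold inP; rw [add_assoc, ← AddCircle.coe_add, crd_add h0 h1]; exact h
  rcases hP with rfl | rfl | rfl
  · obtain rfl := h2 rfl
    refine ⟨2/3, 1/3, .inl ⟨rfl, rfl, rfl⟩, hin _ ?_ ?_ ?_, hin' _ ?_ ?_ ?_, hs _ _ 2 ?_ _,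
      hs _ _ 1 ?_ _⟩ <;> (try simp only [inC]) <;> (try simp only [Bool.false_eq_true, if_false]) <;> grind
  · cases s
    · refine ⟨1/3, 2/3, .inr <| .inr <| .inl ⟨rfl, rfl, rfl⟩, hin _ ?_ ?_ ?_, hin' _ ?_ ?_ ?_, hs _ _ 1 ?_ _,
        hs _ _ 2 ?_ _⟩ <;> (try simp only [inC]) <;> (try simp only [Bool.false_eq_true, if_false]) <;> grind
    · refine ⟨5/6, 1/6, .inr <| .inr <| .inr ⟨rfl, rfl, rfl⟩, hin _ ?_ ?_ ?_, hin' _ ?_ ?_ ?_, hs _ _ 2 ?_ _,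
        hs _ _ 0 ?_ _⟩ <;> (try simp only [inC]) <;> (try simp only [if_true]) <;> grind
  · obtain rfl := h1 rfl
    refine ⟨1/6, 5/6, .inr <| .inl ⟨rfl, rfl, rfl⟩, hin _ ?_ ?_ ?_, hin' _ ?_ ?_ ?_, hs _ _ 0 ?_ _,
        hs _ _ 2 ?_ _⟩ <;> (try simp only [inC]) <;> (try simp only [if_true]) <;> grind

lemma image_avoids (ht : 0 < t) (ht' : t < 1/6) (hP : Strong P) (hx : inP a t P x) (s : Bool)
    (h1 : P = .D → s = true) (h2 : P = .A → s = false) :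
    ¬ cyc (sg s (s3 a)) (s3 x) (sg s (s3 (a + (t : S1)))) := by
  have h0 := crd_nonneg a x
  have h3 := crd_lt_one a x
  have hb : ∃ κ : ℝ, (κ = if s then 1/2 else 0) ∧ sg s (s3 a) = s3 a + (κ : S1) ∧
      sg s (s3 (a + (t : S1))) = s3 a + ((3 * t + κ : ℝ) : S1) :=
    ⟨_, rfl, sg_half _ _, by rw [sg_half, s3_add, add_assoc, ← AddCircle.coe_add]⟩
  obtain ⟨κ, hκ, e1, e2⟩ := hb
  have b : 0 ≤ κ ∧ κ ≤ 1/2 := by rw [hκ]; split_ifs <;> norm_num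
  have ex : ∀ n : ℤ, 0 ≤ 3 * crd a x - n → 3 * crd a x - n < 1 →
      crd (s3 a) (s3 x) = 3 * crd a x - n := fun n hn hn' => by
    refine crd_eq ?_ hn hn'
    rw [s3_crd a x, coe_two_int n (by ring : 3 * crd a x = (3 * crd a x - n) + n)]
  rw [cyc_iff (s3 a), crd_eq e1 b.1 (by linarith), crd_eq e2 (by linarith) (by linarith)]
  unfold inP at hx
  generalize crd a x = ρ at *
  have hcase : (0 ≤ 3 * ρ ∧ 3 * ρ < 1) ∨ (1 ≤ 3 * ρ ∧ 3 * ρ < 2) ∨ (2 ≤ 3 * ρ ∧ 3 * ρ < 3) := by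
    grind
  rcases hcase with h | h | h
  · have := ex 0 (by push_cast; linarith) (by push_cast; linarith)
    push_cast at this; rw [this]; clear ex this e1 e2
    rcases hP with rfl | rfl | rfl <;> simp only [inC] at hx <;> cases s <;> first
      | (exfalso; simp at h1; done)
      | (exfalso; simp at h2; done)
      | (norm_num at hκ; obtain ⟨h, h'⟩ := h
         rintro (⟨l, r⟩ | ⟨l, r⟩ | ⟨l, r⟩) <;> first
           | linarith
           | (rcases hx with hx | hx <;> linarith))
  · have := ex 1 (by push_cast; linarith) (by push_cast; linarith)
    push_cast at this; rw [this]; clear ex this e1 e2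
    rcases hP with rfl | rfl | rfl <;> simp only [inC] at hx <;> cases s <;> first
      | (exfalso; simp at h1; done)
      | (exfalso; simp at h2; done)
      | (norm_num at hκ; obtain ⟨h, h'⟩ := h
         rintro (⟨l, r⟩ | ⟨l, r⟩ | ⟨l, r⟩) <;> first
           | linarith
           | (rcases hx with hx | hx <;> linarith))
  · have := ex 2 (by push_cast; linarith) (by push_cast; linarith)
    push_cast at this; rw [this]; clear ex this e1 e2
    rcases hP with rfl | rfl | rfl <;> simp only [inC] at hx <;> cases s <;> first
      | (exfalso; simp at h1; done)
      | (exfalso; simp at h2; done)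
      | (norm_num at hκ; obtain ⟨h, h'⟩ := h
         rintro (⟨l, r⟩ | ⟨l, r⟩ | ⟨l, r⟩) <;> first
           | linarith
           | (rcases hx with hx | hx <;> linarith))

lemma Xs_of_lt (a : S1) (h1 : crd a x < crd a y) (h2 : crd a y < crd a z) (h3 : crd a z < crd a w) :
    Xs x z y w := by
  rw [Xs_iff_cyc, cyc_iff a, cyc_iff a]
  exact .inl ⟨.inl ⟨h1, h2⟩, .inr (.inr ⟨by linarith, by linarith⟩)⟩

/-- A gap of the cylinder ends at a pull back of a hole. -/
def HolePair (a : S1) (t : ℝ) (X : ℕ → Pc) (n : ℕ) (p q : S1) : Prop :=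
  ∃ i < n, ∃ κ κ', Hole (X i) κ κ' ∧ s3^[i] p = a + (κ : S1) ∧
    s3^[i] q = a + (t : S1) + (κ' : S1)

lemma HolePair.fc {n : ℕ} (hl : Legal a t) (hp : p ∈ Cyl a t X n) (hq : q ∈ Cyl a t X n)
    (h : HolePair a t X n p q) : Fc a t p q := by
  obtain ⟨i, hi, κ, κ', hole, e1, e2⟩ := h
  obtain ⟨s, -, -, h1, h2⟩ := hole.image
  have hb : Base a t (s3^[i+1] p) (s3^[i+1] q) := by
    rw [Function.iterate_succ_apply', Function.iterate_succ_apply', e1, e2, h1, h2]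
    exact ((base_self a t).image).sg s
  refine ⟨fun j => ?_, i + 1, hb⟩
  rcases lt_or_ge j n with hj | hj
  · exact ⟨_, hp j hj, hq j hj⟩
  · have := (hb.iter (j - (i+1))).good hl
    rw [← Function.iterate_add_apply, ← Function.iterate_add_apply,
      show j - (i + 1) + (i + 1) = j by omega] at this
    exact this

lemma holePair (hl : Legal a t) (n : ℕ) : ∀ (X : ℕ → Pc), (∀ j, Strong (X j)) → ∀ p q,
    p ∈ Cyl a t X n → q ∈ Cyl a t X n → p ≠ q → (∀ z ∈ Cyl a t X n, ¬ cyc p z q) →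
    HolePair a t X n p q := by
  induction n with
  | zero =>
    intro X _ p q _ _ hne h
    obtain ⟨z, hz⟩ := exists_cyc hne
    exact absurd hz (h z fun j hj => absurd hj (by omega))
  | succ n ih =>
    intro X hX p q hp hq hne h
    have ht := hl.pos
    have ht' := hl.lt
    have hp' := (Cyl_succ n).1 hp
    have hq' := (Cyl_succ n).1 hq
    have hne' : s3 p ≠ s3 q := fun e => hne (s3_inj_on ht ht' hp'.1 hq'.1 e)
    by_cases hz : ∀ z ∈ Cyl a t (sh X 1) n, ¬ cyc (s3 p) z (s3 q)
    · obtain ⟨i, hi, κ, κ', hole, e1, e2⟩ := ih (sh X 1) (sh_strong hX 1) _ _ hp'.2 hq'.2 hne' hz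
      exact ⟨i + 1, by omega, κ, κ', hole, e1, e2⟩
    have avoid : ∀ z ∈ Cyl a t (sh X 1) n, cyc (s3 p) z (s3 q) → ∃ s, (X 0 = .D → s = true) ∧
        (X 0 = .A → s = false) ∧ cyc (sg s (s3 a)) z (sg s (s3 (a + (t : S1)))) := by
      intro z hz hcz
      by_contra hcon
      push Not at hcon
      obtain ⟨w, hw, rfl⟩ := piece_surj ht ht' (hX 0) hcon
      rw [cyc_image_iff ht ht' hp'.1 hw hq'.1] at hcz
      exact h w ((Cyl_succ n).2 ⟨hw, hz⟩) hcz
    push Not at hz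
    obtain ⟨z, hz, hcz⟩ := hz
    obtain ⟨s, hsD, hsA, hs⟩ := avoid z hz hcz
    have np := image_avoids ht ht' (hX 0) hp'.1 s hsD hsA
    have nq := image_avoids ht ht' (hX 0) hq'.1 s hsD hsA
    obtain ⟨κ, κ', hole, m1, m2, i1, i2⟩ := exists_hole a ht ht' (hX 0) s hsD hsA
    have disj : ∀ s' s'' : Bool, ¬ cyc (sg s (s3 a)) (s3 (a + (κ : S1))) (sg s (s3 (a + (t : S1)))) := by
      intro _ _; exact image_avoids ht ht' (hX 0) m1 s hsD hsA
    have hcl := isClosed_Cyl (a := a) ht ht' (sh X 1) n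
    have hbase : Fc a t (sg s (s3 a)) (sg s (s3 (a + (t : S1)))) :=
      (((base_self a t).image).sg s).fc hl
    have fcs : ∀ w z, w ∈ Cyl a t (sh X 1) n → z ∈ Cyl a t (sh X 1) n → w ≠ z →
        (∀ y ∈ Cyl a t (sh X 1) n, ¬ cyc w y z) → Fc a t w z := fun w z hw hz hne hh =>
      (ih (sh X 1) (sh_strong hX 1) w z hw hz hne hh).fc hl hw hz
    have out1 : sg s (s3 a) ∈ Cyl a t (sh X 1) n → ¬ cyc (s3 p) (sg s (s3 a)) (s3 q) := by
      intro hm hc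
      obtain ⟨s', hD', hA', hc'⟩ := avoid _ hm hc
      rw [← i1] at hc'
      exact image_avoids ht ht' (hX 0) m1 s' hD' hA' hc'
    have out2 : sg s (s3 (a + (t : S1))) ∈ Cyl a t (sh X 1) n →
        ¬ cyc (s3 p) (sg s (s3 (a + (t : S1)))) (s3 q) := by
      intro hm hc
      obtain ⟨s', hD', hA', hc'⟩ := avoid _ hm hc
      rw [← i2] at hc'
      exact image_avoids ht ht' (hX 0) m2 s' hD' hA' hc'
    have hpC := hp'.2
    have hqC := hq'.2
    have key : s3 p = sg s (s3 a) ∧ s3 q = sg s (s3 (a + (t : S1))) := by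
      generalize sg s (s3 a) = A at *
      generalize sg s (s3 (a + (t : S1))) = E at *
      generalize s3 p = p at *
      generalize s3 q = q at *
      have hpA : 0 ≤ crd p A := crd_nonneg _ _
      have hpE : 0 ≤ crd p E := crd_nonneg _ _
      have ord : crd p A < crd p z ∧ crd p z < crd p E ∧ crd p E ≤ crd p q := by
        rw [cyc_base] at hcz
        rw [cyc_iff p] at hs np nq
        rw [crd_self] at np
        grind
      constructor
      · by_contra hpa
        have hA : 0 < crd p A := lt_of_le_of_ne hpA fun e => hpa (crd_eq_zero.1 e.symm).symm
        have hc : cyc p A q := by rw [cyc_base]; exact ⟨hA, by linarith⟩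
        obtain ⟨w, hw, z', hz', hcons, h1, h2, -, h4⟩ := gap_around hcl hpC hqC hc
          (fun hm => out1 hm hc)
        have h5 := h4 z hz ord.1
        have hwz : w ≠ z' := fun e => by rw [e] at h1; linarith
        have hX' := (fcs w z' hw hz' hwz hcons).nc hl hbase
        exact hX' (Xs_of_lt p h1 h2 (by linarith))
      · by_contra hqe
        have hlt : crd p E < crd p q := lt_of_le_of_ne ord.2.2 fun e => hqe (crd_inj e).symm
        have hc : cyc p E q := by rw [cyc_base]; exact ⟨by linarith, hlt⟩
        obtain ⟨w, hw, z', hz', hcons, h1, h2, h3, h4⟩ := gap_around hcl hpC hqC hc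
          (fun hm => out2 hm hc)
        have h5 := h3 z hz ord.2.1
        have hwz : w ≠ z' := fun e => by rw [e] at h1; linarith
        have hX' := (fcs w z' hw hz' hwz hcons).nc hl hbase
        exact hX' (Xs_comm.1 (Xs_of_lt p (by linarith) h1 h2))
    refine ⟨0, by omega, κ, κ', hole, ?_, ?_⟩
    · exact s3_inj_on ht ht' hp'.1 m1 (key.1.trans i1.symm)
    · exact s3_inj_on ht ht' hq'.1 m2 (key.2.trans i2.symm)

end SymLam

namespace SymLam
variable {a p q x y z w u v c b e : S1} {t : ℝ} {P Q : Pc} {X Y Z : ℕ → Pc} {k : ℕ}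

lemma Cyl_anti (a : S1) (t : ℝ) (X : ℕ → Pc) {n m : ℕ} (h : n ≤ m) :
    Cyl a t X m ⊆ Cyl a t X n := fun _ hx j hj => hx j (hj.trans_le h)

lemma Cl_subset_Cyl (n : ℕ) (h : x ∈ Cl a t X) : x ∈ Cyl a t X n := fun j _ => h j

lemma exists_pair (ht : 0 < t) (ht' : t < 1/6) (hx : x ∈ Cl a t X) (hy : y ∈ Cl a t X)
    (hne : x ≠ y) (hno : ∀ w ∈ Cl a t X, ¬ cyc x w y) {ε : ℝ} (hε : 0 < ε) :
    ∃ n, ∃ w ∈ Cyl a t X n, ∃ z ∈ Cyl a t X n, (∀ v ∈ Cyl a t X n, ¬ cyc w v z) ∧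
      crd x w < ε ∧ crd x w < crd x z ∧ crd x y - ε < crd x z ∧ crd x z ≤ crd x y := by
  have h0 : 0 < crd x y := lt_of_le_of_ne (crd_nonneg x y) fun h => hne (crd_eq_zero.1 h.symm).symm
  have h1 := crd_lt_one x y
  obtain ⟨δ, hδ, hδε, hδy⟩ : ∃ δ : ℝ, 0 < δ ∧ δ ≤ ε ∧ δ < crd x y / 2 :=
    ⟨min ε (crd x y / 3), by positivity, min_le_left _ _,
      (min_le_right _ _).trans_lt (by linarith)⟩
  have hcl : ∀ n, IsClosed (Cyl a t X n) := isClosed_Cyl ht ht' X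
  obtain ⟨n, hn⟩ := (isClosed_arcI x δ (crd x y - δ)).isCompact.elim_directed_family_closed
    (fun n => Cyl a t X n) hcl (by
      rw [Set.eq_empty_iff_forall_notMem]
      rintro w ⟨hw, hw'⟩
      rw [mem_arcI_iff hδ.le (by linarith)] at hw
      refine hno w (fun j => mem_iInter.1 hw' (j + 1) j (by omega)) ?_
      rw [cyc_base]
      exact ⟨by linarith, by linarith⟩)
    (directed_of_isDirected_le fun n m h => Cyl_anti a t X h)
  have hK : ∀ w ∈ Cyl a t X n, crd x w < δ ∨ crd x y - δ < crd x w := by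
    intro w hw
    by_contra! h
    rw [Set.eq_empty_iff_forall_notMem] at hn
    exact hn w ⟨(mem_arcI_iff hδ.le (by linarith)).2 h, hw⟩
  have hm : crd x (x + ((crd x y / 2 : ℝ) : S1)) = crd x y / 2 :=
    crd_eq rfl (by linarith) (by linarith)
  obtain ⟨w, hw, z, hz, hno', h2, h3, -, h5⟩ := gap_around (hcl n) (Cl_subset_Cyl n hx)
    (Cl_subset_Cyl n hy) (c := x + ((crd x y / 2 : ℝ) : S1))
    (by rw [cyc_base, hm]; exact ⟨by linarith, by linarith⟩)
    (fun h => by rcases hK _ h with h | h <;> rw [hm] at h <;> linarith)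
  rw [hm] at h2 h3 h5
  refine ⟨n, w, hw, z, hz, hno', ?_, by linarith, ?_, h5 y (Cl_subset_Cyl n hy) (by linarith)⟩
  · rcases hK w hw with h | h <;> linarith
  · rcases hK z hz with h | h <;> linarith

/-- Points of the class of the base never hit an endpoint of a hole. -/
lemma Setup.not_hole (S : Setup a t X) (hx : x ∈ Cl a t X) {i : ℕ} {κ κ' : ℝ}
    (h : Hole (X i) κ κ') (hy : y ∈ Cl a t X) : s3^[i] x ≠ y + (κ : S1) ∧
      s3^[i] x ≠ y + (κ' : S1) := by
  obtain ⟨s, h1, -, h3, h4⟩ := h.image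
  have key : s3^[i+1] x ≠ sg s (s3 y) := by
    intro e
    have m1 := Cl_iter hx (i + 1)
    have m2 := Cl_sg S.pos S.lt s (Cl_s3 hy)
    rw [e] at m1
    have := Cl_disjoint S.pos (sh_strong S.strong _) (sgI_strong (sh_strong S.strong _) _) m1 m2
    rcases Nat.eq_zero_or_pos i with rfl | hi
    · rw [h1 S.zero] at this
      exact S.nrec' 0 this
    · exact S.ne_sg hi s this
  rw [Function.iterate_succ_apply'] at key
  exact ⟨fun e => key (by rw [e, h3]), fun e => key (by rw [e, h4])⟩

lemma Hole.mem (ht : 0 < t) (ht' : t < 1/6) {κ κ' : ℝ} (h : Hole P κ κ') :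
    inP a t P (a + (κ : S1)) ∧ inP a t P (a + (t : S1) + (κ' : S1)) := by
  rcases h with ⟨rfl, rfl, rfl⟩ | ⟨rfl, rfl, rfl⟩ | ⟨rfl, rfl, rfl⟩ | ⟨rfl, rfl, rfl⟩ <;>
  · have h1 := fun r (h0 : (0:ℝ) ≤ r) (h1 : r < 1) => crd_eq (a := a) (s := r) rfl h0 h1
    refine ⟨?_, ?_⟩
    · rw [inP, h1 _ (by norm_num) (by norm_num)]
      simp only [inC]
      first
        | (left; constructor <;> linarith)
        | (right; constructor <;> linarith)
        | (left; linarith)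
        | (constructor <;> linarith)
    · rw [inP, add_assoc, ← AddCircle.coe_add, h1 _ (by linarith) (by linarith)]
      simp only [inC]
      first
        | (left; constructor <;> linarith)
        | (right; constructor <;> linarith)
        | (right; linarith)
        | (constructor <;> linarith)

/-- Strong pieces shrink as the base chord grows. -/
lemma inP_mono (ht' : t < 1/6) (hP : Strong P) {α β : ℝ} (hα : 0 ≤ α) (hβ : 0 ≤ β)
    (h : α + β < t) (hx : inP a t P x) : inP (a + (α : S1)) (t - α - β) P x := by
  have h0 := crd_nonneg a x
  have h1 := crd_lt_one a x
  have e : (α ≤ crd a x ∧ crd (a + (α : S1)) x = crd a x - α) ∨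
      (crd a x < α ∧ crd (a + (α : S1)) x = crd a x - α + 1) := by
    rcases le_or_gt α (crd a x) with h' | h'
    · exact .inl ⟨h', by
        simpa using crd_of_lift a (x := a + (α : S1)) rfl (add_crd a x).symm 0 (by simp; linarith)
          (by simp; linarith)⟩
    · exact .inr ⟨h', by
        simpa using crd_of_lift a (x := a + (α : S1)) rfl (add_crd a x).symm 1 (by simp; linarith)
          (by simp; linarith)⟩
  rw [inP] at hx ⊢
  generalize crd a x = r at *
  generalize crd (a + (α : S1)) x = r' at *
  rcases hP with rfl | rfl | rfl <;> simp only [inC] at hx ⊢ <;>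
  · rcases e with ⟨e1, rfl⟩ | ⟨e1, rfl⟩ <;> grind

/-- `p` and `q` lie in a common strong piece at all times. -/
lemma HolePair.strong {n : ℕ} (S : Setup a t X) (hp : p ∈ Cyl a t X n)
    (hq : q ∈ Cyl a t X n) (h : HolePair a t X n p q) (j : ℕ) :
    ∃ P, Strong P ∧ inP a t P (s3^[j] p) ∧ inP a t P (s3^[j] q) := by
  obtain ⟨i, hi, κ, κ', hole, e1, e2⟩ := h
  rcases Nat.lt_or_ge j n with hj | hj
  · exact ⟨X j, S.strong j, hp j hj, hq j hj⟩
  obtain ⟨s, -, -, h1, h2⟩ := hole.image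
  obtain ⟨m, rfl⟩ : ∃ m, j = m + (i + 1) := ⟨j - (i + 1), by omega⟩
  refine ⟨(X (m + 1)).sgn s, (S.strong _).sgn s, ?_, ?_⟩
  · rw [Function.iterate_add_apply, Function.iterate_succ_apply' s3 i, e1, h1, iter_sg,
      ← Function.iterate_succ_apply]
    exact inP_sgn S.pos S.lt s (S.memL _)
  · rw [Function.iterate_add_apply, Function.iterate_succ_apply' s3 i, e2, h2, iter_sg,
      ← Function.iterate_succ_apply]
    exact inP_sgn S.pos S.lt s (S.memR _)

/-- Approximation of the base chord from the small side. -/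
lemma Setup.approx_below (S : Setup a t X) (hl : Legal a t)
    (hno : ∀ w ∈ Cl a t X, ¬ cyc a w (a + (t : S1))) {ε : ℝ} (hε : 0 < ε) :
    ∃ α β, 0 < α ∧ α < ε ∧ 0 < β ∧ β < ε ∧ α + β < t ∧ Legal (a + (α : S1)) (t - α - β) := by
  have ht := S.pos
  have ht' := S.lt
  have hc := crd_base a ht ht'
  obtain ⟨n, w, hw, z, hz, hno', h1, h2, h3, h4⟩ := exists_pair ht ht' S.memL S.memR
    (fun h => by rw [← h, crd_self] at hc; linarith) hno hε
  rw [hc] at h3 h4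
  have hne : w ≠ z := fun h => by rw [h] at h2; exact lt_irrefl _ h2
  have hp := holePair hl n X S.strong w z hw hz hne hno'
  have hfc := hp.fc hl hw hz
  have hst := hp.strong S hw hz
  obtain ⟨i, hi, κ, κ', hole, e1, e2⟩ := hp
  have hwa : w ≠ a := by rintro rfl; exact (S.not_hole S.memL hole S.memL).1 e1
  have hza : z ≠ a + (t : S1) := by rintro rfl; exact (S.not_hole S.memR hole S.memR).2 e2
  have hw0 : 0 < crd a w :=
    lt_of_le_of_ne (crd_nonneg a w) fun h => hwa (crd_eq_zero.1 h.symm)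
  have hzt : crd a z < t := lt_of_le_of_ne h4 fun h => hza (by rw [← add_crd a z, h])
  have ew := add_crd a w
  have ez : a + (crd a w : S1) + ((t - crd a w - (t - crd a z) : ℝ) : S1) = z := by
    rw [add_assoc, ← AddCircle.coe_add]
    ring_nf
    exact add_crd a z
  refine ⟨crd a w, t - crd a z, hw0, h1, by linarith, by linarith, by linarith, by linarith,
    by linarith, ?_, ?_⟩
  · intro j
    rw [ez, ew]
    obtain ⟨P, hP, m1, m2⟩ := hst j
    refine ⟨P, ?_, ?_⟩
    · have := inP_mono ht' hP (α := crd a w) (β := t - crd a z) hw0.le (by linarith)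
        (by linarith) m1
      rwa [ew] at this
    · have := inP_mono ht' hP (α := crd a w) (β := t - crd a z) hw0.le (by linarith)
        (by linarith) m2
      rwa [ew] at this
  · intro i j s
    rw [ez, ew]
    have hit : ∀ i, Fc a t (s3^[i] w) (s3^[i] z) := by
      intro i
      induction i with
      | zero => exact hfc
      | succ i ih => rw [Function.iterate_succ_apply', Function.iterate_succ_apply']; exact ih.image
    exact Fc.nc hl (hit i) ((hit j).sg hl s)

end SymLam

namespace SymLam
variable {a p q x y z w u v c b e : S1} {t : ℝ} {P Q : Pc} {X Y Z : ℕ → Pc} {k : ℕ}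

/-- The piece `P` contains a neighbourhood of `x`, uniformly under small growth of the base. -/
def Rob (a : S1) (t : ℝ) (P : Pc) (δ : ℝ) (x : S1) : Prop :=
  ∀ η σ τ : ℝ, |η| ≤ δ → σ ≤ 0 → -δ ≤ σ → 0 ≤ τ → τ ≤ δ →
    inP (a + (σ : S1)) (t + τ - σ) P (x + (η : S1))

lemma Rob.mono {δ δ' : ℝ} (h : Rob a t P δ x) (hδ : δ' ≤ δ) : Rob a t P δ' x :=
  fun η σ τ h1 h2 h3 h4 h5 => h η σ τ (h1.trans hδ) h2 (by linarith) h4 (by linarith)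

lemma Rob.shift {δ δ' r : ℝ} (h : Rob a t P δ x) (hr : |r| ≤ δ - δ') :
    Rob a t P δ' (x + (r : S1)) := by
  intro η σ τ h1 h2 h3 h4 h5
  have := abs_nonneg r
  rw [add_assoc, ← AddCircle.coe_add]
  exact h _ σ τ ((abs_add_le _ _).trans (by linarith)) h2 (by linarith) h4 (by linarith)

/-- `x` is an endpoint of a hole of the piece `P`. -/
def HE (a : S1) (t : ℝ) (P : Pc) (x : S1) : Prop :=
  ∃ κ κ', Hole P κ κ' ∧ (x = a + (κ : S1) ∨ x = a + (t : S1) + (κ' : S1))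

lemma inP_of_lift {r : ℝ} (h : x = b + (r : S1)) (ht : 0 < t)
    (hr : (0 ≤ r ∧ r < 1 ∧ inC t P r) ∨ (P = .D ∧ t - 1/6 ≤ r ∧ r ≤ 1/6)) : inP b t P x := by
  rcases hr with ⟨h0, h1, h2⟩ | ⟨rfl, h0, h1⟩
  · rwa [inP, crd_eq h h0 h1]
  · rcases le_or_gt 0 r with h2 | h2
    · rw [inP, crd_eq h h2 (by linarith)]
      exact .inl h1
    · rw [inP]
      rw [coe_two_int (r' := r + 1) (-1) (by push_cast; ring)] at h
      rw [crd_eq h (by linarith) (by linarith)]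
      exact .inr (by linarith)

lemma exists_rob (ht : 0 < t) (ht' : t < 1/6) (hP : Strong P) (hx : inP a t P x)
    (hn : ¬ HE a t P x) : ∃ δ > 0, Rob a t P δ x := by
  have h0 := crd_nonneg a x
  have h1 := crd_lt_one a x
  have hn1 : ∀ κ κ', Hole P κ κ' → crd a x ≠ κ ∧ crd a x ≠ t + κ' := by
    refine fun κ κ' hole => ⟨fun h => hn ⟨κ, κ', hole, .inl ?_⟩, fun h => hn ⟨κ, κ', hole, .inr ?_⟩⟩
    · rw [← h, add_crd]
    · rw [add_assoc, ← AddCircle.coe_add, ← h, add_crd]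
  have key : ∀ l r : ℝ, l < crd a x → crd a x < r → 0 ≤ l → r < 1 →
      (∀ ρ t' : ℝ, t ≤ t' → t' - t ≤ ρ - l → ρ ≤ r → inC t' P ρ) →
      ∃ δ > 0, Rob a t P δ x := by
    intro l r h2 h3 hl hr h
    refine ⟨min (crd a x - l) (min (r - crd a x) (5/6)) / 5, by
      have := lt_min (sub_pos.2 h2) (lt_min (sub_pos.2 h3) (by norm_num : (0:ℝ) < 5/6))
      positivity, ?_⟩
    intro η σ τ g1 g2 g3 g4 g5
    have e1 := min_le_left (crd a x - l) (min (r - crd a x) (5/6))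
    have e2 := (min_le_right (crd a x - l) (min (r - crd a x) (5/6))).trans (min_le_left _ _)
    have e3 := (min_le_right (crd a x - l) (min (r - crd a x) (5/6))).trans (min_le_right _ _)
    rw [abs_le] at g1
    have ex : x + (η : S1) = a + (σ : S1) + ((crd a x + η - σ : ℝ) : S1) := by
      calc x + (η : S1) = a + (crd a x : S1) + (η : S1) := by rw [add_crd]
        _ = _ := by
          rw [add_assoc, ← AddCircle.coe_add, add_assoc, ← AddCircle.coe_add]
          ring_nf
    refine inP_of_lift ex (by linarith) (.inl ⟨by linarith, by linarith, h _ _ ?_ ?_ ?_⟩)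
    all_goals linarith
  rcases hP with rfl | rfl | rfl
  · have e := hn1 _ _ (.inl ⟨rfl, rfl, rfl⟩)
    rw [inP] at hx; simp only [inC] at hx
    refine key (t + 1/3) (2/3) (lt_of_le_of_ne hx.1 (Ne.symm e.2)) (lt_of_le_of_ne hx.2 e.1)
      (by linarith) (by norm_num) fun ρ t' g1 g2 g3 => ⟨by linarith, by linarith⟩
  · have e := hn1 _ _ (.inr (.inr (.inl ⟨rfl, rfl, rfl⟩)))
    have e' := hn1 _ _ (.inr (.inr (.inr ⟨rfl, rfl, rfl⟩)))
    rw [inP] at hx; simp only [inC] at hx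
    rcases hx with hx | hx
    · exact key (t + 1/6) (1/3) (lt_of_le_of_ne hx.1 (Ne.symm e'.2)) (lt_of_le_of_ne hx.2 e.1)
        (by linarith) (by norm_num) fun ρ t' g1 g2 g3 => .inl ⟨by linarith, by linarith⟩
    · exact key (t + 2/3) (5/6) (lt_of_le_of_ne hx.1 (Ne.symm e.2)) (lt_of_le_of_ne hx.2 e'.1)
        (by linarith) (by norm_num) fun ρ t' g1 g2 g3 => .inr ⟨by linarith, by linarith⟩
  · have e := hn1 _ _ (.inr (.inl ⟨rfl, rfl, rfl⟩))
    obtain ⟨ρ, hρ, hl, hr⟩ : ∃ ρ : ℝ, x = a + (ρ : S1) ∧ t - 1/6 < ρ ∧ ρ < 1/6 := by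
      rw [inP] at hx; simp only [inC] at hx
      rcases hx with hx | hx
      · exact ⟨crd a x, (add_crd a x).symm, by linarith, lt_of_le_of_ne hx e.1⟩
      · refine ⟨crd a x - 1, by rw [coe_sub_one, add_crd], ?_, by linarith⟩
        have := lt_of_le_of_ne hx (Ne.symm e.2)
        linarith
    have e1 := min_le_left (ρ - (t - 1/6)) (1/6 - ρ)
    have e2 := min_le_right (ρ - (t - 1/6)) (1/6 - ρ)
    have e0 := lt_min (sub_pos.2 hl) (sub_pos.2 hr)
    refine ⟨min (ρ - (t - 1/6)) (1/6 - ρ) / 3, by positivity, ?_⟩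
    intro η σ τ g1 g2 g3 g4 g5
    rw [abs_le] at g1
    refine inP_of_lift (r := ρ + η - σ) ?_ (by linarith)
      (.inr ⟨rfl, by linarith, by linarith⟩)
    rw [hρ, add_assoc, ← AddCircle.coe_add, add_assoc, ← AddCircle.coe_add]
    ring_nf

lemma Rob.not_HE {δ r : ℝ} (ht : 0 < t) (hδ : 0 < δ) (hδ' : t + 3 * δ ≤ 1/6) (h : Rob a t P δ x)
    (hr : |r| ≤ δ) : ¬ HE a t P (x + (r : S1)) := by
  rintro ⟨κ, κ', hole, e | e⟩
  · have := h r (-δ) 0 hr (by linarith) le_rfl le_rfl hδ.le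
    rw [e, inP, crd_eq (s := κ + δ) (by rw [add_assoc, ← AddCircle.coe_add]; ring_nf)
      (by rcases hole with ⟨-, rfl, rfl⟩ | ⟨-, rfl, rfl⟩ | ⟨-, rfl, rfl⟩ | ⟨-, rfl, rfl⟩ <;> linarith)
      (by rcases hole with ⟨-, rfl, rfl⟩ | ⟨-, rfl, rfl⟩ | ⟨-, rfl, rfl⟩ | ⟨-, rfl, rfl⟩ <;>
        linarith)] at this
    rcases hole with ⟨rfl, rfl, rfl⟩ | ⟨rfl, rfl, rfl⟩ | ⟨rfl, rfl, rfl⟩ | ⟨rfl, rfl, rfl⟩ <;>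
      simp only [inC] at this <;> grind
  · have := h r 0 δ hr le_rfl (by linarith) hδ.le le_rfl
    rw [e, inP, crd_eq (s := t + κ') (by simp [add_assoc])
      (by rcases hole with ⟨-, rfl, rfl⟩ | ⟨-, rfl, rfl⟩ | ⟨-, rfl, rfl⟩ | ⟨-, rfl, rfl⟩ <;> linarith)
      (by rcases hole with ⟨-, rfl, rfl⟩ | ⟨-, rfl, rfl⟩ | ⟨-, rfl, rfl⟩ | ⟨-, rfl, rfl⟩ <;>
        linarith)] at this
    rcases hole with ⟨rfl, rfl, rfl⟩ | ⟨rfl, rfl, rfl⟩ | ⟨rfl, rfl, rfl⟩ | ⟨rfl, rfl, rfl⟩ <;>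
      simp only [inC] at this <;> grind

lemma hole_perturb {κ κ' ξ ζ : ℝ} (ht : 0 < t) (h : Hole P κ κ') (hξ : ξ ≤ 0) (hζ : 0 ≤ ζ)
    (h1 : t - ξ ≤ 1/6) (h2 : t + ζ ≤ 1/6) :
    inP a t P (a + (κ : S1) + (ξ : S1)) ∧ inP a t P (a + (t : S1) + (κ' : S1) + (ζ : S1)) := by
  rw [add_assoc, ← AddCircle.coe_add, add_assoc, add_assoc, ← AddCircle.coe_add,
    ← AddCircle.coe_add]
  rcases h with ⟨rfl, rfl, rfl⟩ | ⟨rfl, rfl, rfl⟩ | ⟨rfl, rfl, rfl⟩ | ⟨rfl, rfl, rfl⟩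
  · refine ⟨inP_of_lift rfl (by linarith) (.inl ⟨by linarith, by linarith, ?_⟩),
      inP_of_lift rfl (by linarith) (.inl ⟨by linarith, by linarith, ?_⟩)⟩ <;>
    simp only [inC] <;> constructor <;> linarith
  · refine ⟨inP_of_lift rfl (by linarith) (.inr ⟨rfl, by linarith, by linarith⟩),
      inP_of_lift (r := t - 1/6 + ζ) ?_ (by linarith) (.inr ⟨rfl, by linarith, by linarith⟩)⟩
    rw [coe_two_int (r' := t - 1/6 + ζ) 1 (by push_cast; ring)]
  · refine ⟨inP_of_lift rfl (by linarith) (.inl ⟨by linarith, by linarith, .inl ?_⟩),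
      inP_of_lift rfl (by linarith) (.inl ⟨by linarith, by linarith, .inr ?_⟩)⟩ <;>
    constructor <;> linarith
  · refine ⟨inP_of_lift rfl (by linarith) (.inl ⟨by linarith, by linarith, .inr ?_⟩),
      inP_of_lift rfl (by linarith) (.inl ⟨by linarith, by linarith, .inl ?_⟩)⟩ <;>
    constructor <;> linarith

lemma iter_add (j : ℕ) (x : S1) (r : ℝ) :
    s3^[j] (x + (r : S1)) = s3^[j] x + ((3 ^ j * r : ℝ) : S1) := by
  induction j with
  | zero => simp
  | succ j ih =>
    rw [Function.iterate_succ_apply', ih, s3_add, Function.iterate_succ_apply', pow_succ']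
    ring_nf

lemma Fc.of_iter (n : ℕ) (hg : ∀ j < n, Good a t (s3^[j] x) (s3^[j] y))
    (h : Fc a t (s3^[n] x) (s3^[n] y)) : Fc a t x y := by
  induction n with
  | zero => exact h
  | succ n ih =>
    refine ih (fun j hj => hg j (by omega)) (.of_image (hg n (by omega)) ?_)
    rwa [← Function.iterate_succ_apply' s3 n, ← Function.iterate_succ_apply' s3 n]

lemma Rob.zero {δ : ℝ} (h : Rob a t P δ x) {r : ℝ} (hr : |r| ≤ δ) : inP a t P (x + (r : S1)) := by
  have h0 := (abs_nonneg r).trans hr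
  simpa using h r 0 0 hr le_rfl (by linarith) le_rfl h0

end SymLam

namespace SymLam
variable {a p q x y z w u v c b e : S1} {t : ℝ} {P Q : Pc} {X Y Z : ℕ → Pc} {k : ℕ}

lemma good_iter_swap {j : ℕ} (ht : 0 < t) (ht' : t < 1/6) (s : Bool)
    (h : Good a t (s3^[j] x) (s3^[j] y)) :
    Good a t (s3^[j] (sg s y)) (s3^[j] (sg s x)) := by
  rw [iter_sg, iter_sg]; exact (h.sg ht ht' s).symm

lemma Cc_iter (h : (x, y) ∈ Cc a t) (n : ℕ) : (s3^[n] x, s3^[n] y) ∈ Cc a t := by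
  induction n with
  | zero => exact h
  | succ n ih =>
    rw [Function.iterate_succ_apply', Function.iterate_succ_apply']; exact Cc_image ih

/-- A chord slightly larger than the base chord which is renormalised by the `i`-th iterate. -/
lemma renorm (hl : Legal a t) {δ α β κ κ' : ℝ} {i : ℕ} (hi : 1 ≤ i)
    (hδ : 0 < δ) (hδ' : t + 3 * δ ≤ 1/6) (hα' : -δ ≤ α) (hβ : 0 < β) (hβ' : β ≤ δ)
    (hTα : δ < 3 ^ i * -α) (hTβ : δ < 3 ^ i * β) (hole : Hole P κ κ')
    (e1 : s3^[i] (a + (t : S1) + (β : S1)) = a + (κ : S1))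
    (e2 : s3^[i] (a + (α : S1)) = a + (t : S1) + (κ' : S1))
    (h1 : ∀ j < i, Rob a t (X j) δ (s3^[j] (a + (α : S1))))
    (h2 : ∀ j < i, Rob a t (X j) δ (s3^[j] (a + (t : S1) + (β : S1)))) :
    ∃ ξ ζ, -δ ≤ ξ ∧ ξ < 0 ∧ 0 < ζ ∧ ζ ≤ δ ∧ Legal (a + (ξ : S1)) (t + ζ - ξ) := by
  have ht := hl.pos
  obtain ⟨T, hT⟩ : ∃ T : ℝ, T = 3 ^ i := ⟨_, rfl⟩
  have hT3 : 3 ≤ T := by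
    rw [hT]; calc (3:ℝ) = 3 ^ 1 := by norm_num
      _ ≤ 3 ^ i := pow_le_pow_right₀ (by norm_num) hi
  have hT0 : 0 < T := by linarith
  rw [← hT] at hTα hTβ
  obtain ⟨s, -, -, im1, im2⟩ := hole.image
  -- displacement at time `j`
  have pow : ∀ j < i, ∀ r : ℝ, |r| ≤ δ → |3 ^ j * (r / T)| ≤ δ := by
    intro j hj r hr
    have : (3:ℝ) ^ j ≤ T := by rw [hT]; exact pow_le_pow_right₀ (by norm_num) hj.le
    rw [← mul_div_assoc, abs_div, abs_mul, abs_of_pos hT0, abs_of_pos (by positivity),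
      div_le_iff₀ hT0]
    have := abs_nonneg r
    nlinarith
  have dispα : ∀ j (r : ℝ), s3^[j] (a + ((α + r : ℝ) : S1)) =
      s3^[j] (a + (α : S1)) + ((3 ^ j * r : ℝ) : S1) := fun j r => by
    rw [← iter_add, add_assoc, ← AddCircle.coe_add]
  have dispβ : ∀ j (r : ℝ), s3^[j] (a + (t : S1) + ((β + r : ℝ) : S1)) =
      s3^[j] (a + (t : S1) + (β : S1)) + ((3 ^ j * r : ℝ) : S1) := fun j r => by
    rw [← iter_add, add_assoc (a + (t : S1)), ← AddCircle.coe_add]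
  have atα : ∀ r : ℝ, s3^[i] (a + ((α + r / T : ℝ) : S1)) =
      a + (r : S1) + (t : S1) + (κ' : S1) := fun r => by
    rw [dispα, e2, ← hT, mul_div_cancel₀ _ hT0.ne']; abel
  have atβ : ∀ r : ℝ, s3^[i] (a + (t : S1) + ((β + r / T : ℝ) : S1)) =
      a + (r : S1) + (κ : S1) := fun r => by
    rw [dispβ, e1, ← hT, mul_div_cancel₀ _ hT0.ne']; abel
  -- the limit chord
  obtain ⟨ξ, ζ, hξ, hζ⟩ : ∃ ξ ζ : ℝ, ξ = α + ζ / T ∧ ζ = β + ξ / T := by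
    have : T ^ 2 - 1 ≠ 0 := by nlinarith
    refine ⟨(α * T ^ 2 + β * T) / (T ^ 2 - 1), (β * T ^ 2 + α * T) / (T ^ 2 - 1), ?_, ?_⟩ <;>
      field_simp <;> ring
  have hξT : ξ * T = α * T + ζ := by rw [hξ]; field_simp
  have hζT : ζ * T = β * T + ξ := by rw [hζ]; field_simp
  have hT2 : 0 < T ^ 2 - 1 := by nlinarith
  have hξ0 : ξ < 0 := by
    have g : ξ * (T ^ 2 - 1) = T * (α * T + β) := by linear_combination T * hξT + hζT
    have : T * (α * T + β) < 0 := mul_neg_of_pos_of_neg hT0 (by linarith)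
    exact neg_of_mul_neg_left (g ▸ this) hT2.le
  have hζ0 : 0 < ζ := by
    have g : ζ * (T ^ 2 - 1) = T * (β * T + α) := by linear_combination T * hζT + hξT
    have : 0 < T * (β * T + α) := mul_pos hT0 (by linarith)
    exact pos_of_mul_pos_left (g ▸ this) hT2.le
  have hζδ : ζ ≤ δ := by nlinarith
  have hξδ : -δ ≤ ξ := by nlinarith
  have hzabs : |ζ| ≤ δ := abs_le.2 ⟨by linarith, hζδ⟩
  have hxabs : |ξ| ≤ δ := abs_le.2 ⟨hξδ, by linarith⟩
  have closed : (a + (ξ : S1), a + (t : S1) + (ζ : S1)) ∈ Cc a t := by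
    let f : ℕ → ℝ × ℝ := fun m => (fun q : ℝ × ℝ => (α + q.2 / T, β + q.1 / T))^[m] (0, 0)
    have f0 : f 0 = (0, 0) := rfl
    have fs : ∀ m, f (m + 1) = (α + (f m).2 / T, β + (f m).1 / T) := fun m =>
      Function.iterate_succ_apply' _ m _
    have fb : ∀ m, -δ ≤ (f m).1 ∧ (f m).1 ≤ 0 ∧ 0 ≤ (f m).2 ∧ (f m).2 ≤ δ := by
      intro m
      induction m with
      | zero => rw [f0]; exact ⟨by linarith, le_rfl, le_rfl, hδ.le⟩
      | succ m ih =>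
        obtain ⟨g1, g2, g3, g4⟩ := ih
        rw [fs]
        have d1 : (f m).2 / T ≤ -α := by rw [div_le_iff₀ hT0]; linarith
        have d2 : -β ≤ (f m).1 / T := by rw [le_div_iff₀ hT0]; linarith
        have d3 : 0 ≤ (f m).2 / T := by positivity
        have d4 : (f m).1 / T ≤ 0 := div_nonpos_of_nonpos_of_nonneg g2 hT0.le
        exact ⟨by dsimp only; linarith, by dsimp only; linarith, by dsimp only; linarith,
          by dsimp only; linarith⟩
    have ff : ∀ m, Fc a t (a + ((f m).1 : S1)) (a + (t : S1) + ((f m).2 : S1)) := by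
      intro m
      induction m with
      | zero => rw [f0]; simpa using (base_self a t).fc hl
      | succ m ih =>
        obtain ⟨g1, g2, g3, g4⟩ := fb m
        rw [fs]
        have b1 : |(f m).1| ≤ δ := abs_le.2 ⟨g1, by linarith⟩
        have b2 : |(f m).2| ≤ δ := abs_le.2 ⟨by linarith, g4⟩
        refine Fc.of_iter (i + 1) ?_ ?_
        · intro j hj
          rcases Nat.lt_succ_iff_lt_or_eq.1 hj with hj | rfl
          · refine ⟨X j, ?_, ?_⟩
            · rw [dispα]; exact (h1 j hj).zero (pow j hj _ b2)
            · rw [dispβ]; exact (h2 j hj).zero (pow j hj _ b1)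
          · have := hole_perturb (a := a) ht hole g2 g3 (by linarith) (by linarith)
            refine ⟨P, ?_, ?_⟩
            · rw [atα]; convert this.2 using 1; abel
            · rw [atβ]; convert this.1 using 1; abel
        · rw [Function.iterate_succ_apply', Function.iterate_succ_apply']
          dsimp only
          rw [atα, atβ, im1, im2]
          convert (ih.image.sg hl s).symm using 3
          abel
    have lim : ∀ m, |(f m).1 - ξ| ≤ (1/3) ^ m * δ ∧ |(f m).2 - ζ| ≤ (1/3) ^ m * δ := by
      intro m
      induction m with
      | zero => rw [f0]; simpa using ⟨hxabs, hzabs⟩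
      | succ m ih =>
        have sh : ∀ r : ℝ, |r| ≤ (1/3) ^ m * δ → |r / T| ≤ (1/3) ^ (m + 1) * δ := by
          intro r hr
          rw [abs_div, abs_of_pos hT0, div_le_iff₀ hT0, pow_succ]
          have : 0 ≤ (1/3 : ℝ) ^ m * δ := by positivity
          nlinarith
        rw [fs]
        constructor
        · convert sh _ ih.2 using 2
          rw [hξ]; ring
        · convert sh _ ih.1 using 2
          rw [hζ]; ring
    have tend : Filter.Tendsto (fun m : ℕ => (1/3 : ℝ) ^ m * δ) Filter.atTop (nhds 0) := by
      simpa using (tendsto_pow_atTop_nhds_zero_of_lt_one (r := (1/3 : ℝ)) (by norm_num)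
        (by norm_num)).mul_const δ
    have t1 : Filter.Tendsto (fun m => (f m).1) Filter.atTop (nhds ξ) := by
      rw [tendsto_iff_norm_sub_tendsto_zero]
      exact squeeze_zero (fun _ => norm_nonneg _) (fun m => (lim m).1) tend
    have t2 : Filter.Tendsto (fun m => (f m).2) Filter.atTop (nhds ζ) := by
      rw [tendsto_iff_norm_sub_tendsto_zero]
      exact squeeze_zero (fun _ => norm_nonneg _) (fun m => (lim m).2) tend
    refine mem_closure_of_tendsto (Filter.Tendsto.prodMk_nhds
      (tendsto_const_nhds.add ((AddCircle.continuous_mk' 1).continuousAt.tendsto.comp t1))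
      (tendsto_const_nhds.add ((AddCircle.continuous_mk' 1).continuousAt.tendsto.comp t2)))
      (Filter.Eventually.of_forall ff)
  have ee : a + (ξ : S1) + ((t + ζ - ξ : ℝ) : S1) = a + (t : S1) + (ζ : S1) := by
    rw [add_assoc, ← AddCircle.coe_add, add_assoc, ← AddCircle.coe_add]; ring_nf
  have p0 : 0 < t + ζ - ξ := by linarith
  have p1 : t + ζ - ξ < 1/6 := by linarith
  refine ⟨ξ, ζ, hξδ, hξ0, hζ0, hζδ, p0, p1, ?_, ?_⟩
  · intro j
    rw [ee]
    induction j using Nat.strong_induction_on with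
    | _ j ih =>
    rcases lt_trichotomy j i with hj | rfl | hj
    · refine ⟨X j, ?_, ?_⟩
      · have := h1 j hj _ ξ ζ (pow j hj _ hzabs) hξ0.le hξδ hζ0.le hζδ
        rwa [← dispα, ← hξ] at this
      · have := h2 j hj _ ξ ζ (pow j hj _ hxabs) hξ0.le hξδ hζ0.le hζδ
        rwa [← dispβ, ← hζ] at this
    · have hm := hole.mem (a := a + (ξ : S1)) p0 p1
      rw [ee] at hm
      have g1 := atα ζ
      have g2 := atβ ξ
      rw [← hξ] at g1
      rw [← hζ] at g2
      refine ⟨P, ?_, ?_⟩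
      · rw [g1]; convert hm.2 using 1; abel
      · rw [g2]; exact hm.1
    · obtain ⟨m, rfl⟩ : ∃ m, j = m + (i + 1) := ⟨j - (i + 1), by omega⟩
      have g1 := atα ζ
      have g2 := atβ ξ
      rw [← hξ] at g1
      rw [← hζ] at g2
      rw [Function.iterate_add_apply, Function.iterate_add_apply s3 m,
        Function.iterate_succ_apply', Function.iterate_succ_apply' s3 i, g1, g2, im1, im2,
        show a + (ζ : S1) + (t : S1) = a + (t : S1) + (ζ : S1) by abel]
      refine good_iter_swap p0 p1 s ?_
      rw [← Function.iterate_succ_apply, ← Function.iterate_succ_apply]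
      exact ih (m + 1) (by omega)
  · intro i j s
    rw [ee]
    exact Cc_nc hl (Cc_iter closed i) (Cc_sg hl s (Cc_iter closed j))

end SymLam

namespace SymLam
variable {a p q x y z w u v c b e : S1} {t : ℝ} {P Q : Pc} {X Y Z : ℕ → Pc} {k : ℕ}

lemma exists_uniform {p : ℕ → ℝ → Prop} (hm : ∀ j δ δ', δ' ≤ δ → p j δ → p j δ') (n : ℕ)
    (h : ∀ j < n, ∃ δ > 0, p j δ) : ∃ δ > 0, ∀ j < n, p j δ := by
  induction n with
  | zero => exact ⟨1, one_pos, by simp⟩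
  | succ n ih =>
    obtain ⟨δ, hδ, h1⟩ := ih fun j hj => h j (by omega)
    obtain ⟨δ', hδ', h2⟩ := h n (by omega)
    refine ⟨min δ δ', lt_min hδ hδ', fun j hj => ?_⟩
    rcases Nat.lt_succ_iff_lt_or_eq.1 hj with hj | rfl
    · exact hm _ _ _ (min_le_left _ _) (h1 j hj)
    · exact hm _ _ _ (min_le_right _ _) h2

lemma HE.image (S : Setup a t X) (h : HE a t P x) : ∃ s, s3 x ∈ Cl a t (sgI s (sh X 1)) ∧
    (P = .D → s = true) := by
  obtain ⟨κ, κ', hole, h⟩ := h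
  obtain ⟨s, hs, -, h1, h2⟩ := hole.image
  refine ⟨s, ?_, hs⟩
  rcases h with rfl | rfl
  · rw [h1]; exact Cl_sg S.pos S.lt s (Cl_s3 S.memL)
  · rw [h2]; exact Cl_sg S.pos S.lt s (Cl_s3 S.memR)

lemma Setup.not_HE (S : Setup a t X) (hx : x ∈ Cl a t X) (i : ℕ) :
    ¬ HE a t (X i) (s3^[i] x) := by
  rintro ⟨κ, κ', hole, e | e⟩
  · exact (S.not_hole hx hole S.memL).1 e
  · exact (S.not_hole hx hole S.memR).2 e

lemma Setup.not_HE_twice (S : Setup a t X) {i j : ℕ} (h : j < i) (h1 : HE a t P (s3^[j] x)) :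
    ¬ HE a t Q (s3^[i] x) := by
  intro h2
  obtain ⟨s, m1, -⟩ := h1.image S
  obtain ⟨s', m2, -⟩ := h2.image S
  obtain ⟨m, rfl⟩ : ∃ m, i = (m + 1) + j := ⟨i - j - 1, by omega⟩
  have m3 := Cl_iter m1 (m + 1)
  rw [← Function.iterate_succ_apply' s3 j, ← Function.iterate_add_apply] at m3
  rw [← Function.iterate_succ_apply' s3] at m2
  rw [show m + 1 + j.succ = (m + 1 + j).succ by omega] at m3
  have := Cl_disjoint S.pos (sh_strong (sgI_strong (sh_strong S.strong 1) s) _)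
    (sgI_strong (sh_strong S.strong _) s') m3 m2
  rw [sh_sgI, sh_sh] at this
  have := congrArg (sgI s) this
  rw [sgI_sgI, sgI_sgI, Bool.xor_self, sgI_false] at this
  exact S.ne_sg (by omega) _ this

/-- Approximation of the base chord from the large side. -/
lemma Setup.approx_above (S : Setup a t X) (hl : Legal a t)
    (hno : ∀ w ∈ Cl a t X, ¬ cyc (a + (t : S1)) w a) {ε : ℝ} (hε : 0 < ε) :
    ∃ ξ ζ, -ε < ξ ∧ ξ < 0 ∧ 0 < ζ ∧ ζ < ε ∧ t + ζ - ξ < 1/6 ∧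
      Legal (a + (ξ : S1)) (t + ζ - ξ) := by
  have ht := S.pos
  have ht' := S.lt
  have hc := crd_base a ht ht'
  obtain ⟨k, N, hk, hN, hper⟩ := S.per
  -- periodicity
  obtain ⟨M, hM, hfix⟩ := PC.fix S hN hper ⟨false, k, le_rfl, (sgI_false _).symm⟩
  have hperM : sh X (M + k) = sh X k := by
    have h1 := Cl_iter (Cl_iter S.memL k) M
    rw [hfix _ (Cl_iter S.memL k), sh_sh] at h1
    exact Cl_disjoint ht (sh_strong S.strong _) (sh_strong S.strong _) h1 (Cl_iter S.memL k)
  have hXM : ∀ m j, k ≤ j → X (M * m + j) = X j := fun m j hj => by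
    have := congrFun (sh_per hperM hj m) 0
    simpa [sh] using this
  have hit : ∀ y ∈ Cl a t X, ∀ m j, k ≤ j → s3^[M * m + j] y = s3^[j] y := by
    intro y hy m j hj
    obtain ⟨l, rfl⟩ : ∃ l, j = l + k := ⟨j - k, by omega⟩
    have : ∀ m, s3^[M * m + k] y = s3^[k] y := by
      intro m
      induction m with
      | zero => simp
      | succ m ih =>
        rw [show M * (m + 1) + k = M + (M * m + k) by ring, Function.iterate_add_apply, ih,
          hfix _ (Cl_iter hy k)]
    rw [show M * m + (l + k) = l + (M * m + k) by ring, Function.iterate_add_apply, this,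
      ← Function.iterate_add_apply]
  -- robustness along the orbit of the base
  obtain ⟨ε₀, hε₀, hε₀', hrob⟩ : ∃ ε₀ > 0, t + 3 * ε₀ ≤ 1/6 ∧ ∀ j, Rob a t (X j) ε₀ (s3^[j] a) ∧
      Rob a t (X j) ε₀ (s3^[j] (a + (t : S1))) := by
    obtain ⟨δ, hδ, h⟩ := exists_uniform
      (p := fun j δ => Rob a t (X j) δ (s3^[j] a) ∧ Rob a t (X j) δ (s3^[j] (a + (t : S1))))
      (fun j δ δ' h h' => ⟨h'.1.mono h, h'.2.mono h⟩) (M + k) fun j _ => by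
        obtain ⟨δ, hδ, h⟩ := exists_rob ht ht' (S.strong j) (S.memL j) (S.not_HE S.memL j)
        obtain ⟨δ', hδ', h'⟩ := exists_rob ht ht' (S.strong j) (S.memR j) (S.not_HE S.memR j)
        exact ⟨min δ δ', lt_min hδ hδ', h.mono (min_le_left _ _), h'.mono (min_le_right _ _)⟩
    refine ⟨min δ ((1/6 - t) / 3), lt_min hδ (by linarith), ?_, fun j => ?_⟩
    · have := min_le_right δ ((1/6 - t) / 3)
      linarith
    · suffices H : Rob a t (X j) δ (s3^[j] a) ∧ Rob a t (X j) δ (s3^[j] (a + (t : S1))) from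
        ⟨H.1.mono (min_le_left _ _), H.2.mono (min_le_left _ _)⟩
      rcases Nat.lt_or_ge j (M + k) with hj | hj
      · exact h j hj
      · have e : j = M * ((j - k) / M) + (k + (j - k) % M) := by
          have := Nat.div_add_mod (j - k) M
          omega
        have hlt : (j - k) % M < M := Nat.mod_lt _ hM
        rw [e, hXM _ _ (by omega), hit _ S.memL _ _ (by omega), hit _ S.memR _ _ (by omega)]
        exact h _ (by omega)
  -- the initial approximating pair
  have h3k : (0:ℝ) < 3 ^ k := by positivity
  obtain ⟨n, v, hv, u, hu, hno', h1, h2, h3, h4⟩ := exists_pair ht ht' S.memR S.memL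
    (fun h => by rw [h, crd_self] at hc; linarith) hno (ε := min (ε₀ / (2 * 3 ^ k)) (1/2)) (by positivity)
  have hne : v ≠ u := fun h => by rw [h] at h2; exact lt_irrefl _ h2
  obtain ⟨i₀, hi₀, κ, κ', hole, e1, e2⟩ := holePair hl n X S.strong v u hv hu hne hno'
  obtain ⟨β, hβ⟩ : ∃ β, β = crd (a + (t : S1)) v := ⟨_, rfl⟩
  obtain ⟨α, hα⟩ : ∃ α, α = crd (a + (t : S1)) u - crd (a + (t : S1)) a := ⟨_, rfl⟩
  have ev : a + (t : S1) + (β : S1) = v := by rw [hβ, add_crd]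
  have eu : a + (α : S1) = u := by
    rw [hα, AddCircle.coe_sub]
    have g1 := add_crd (a + (t : S1)) u
    have g2 := add_crd (a + (t : S1)) a
    calc a + ((crd (a + (t : S1)) u : S1) - (crd (a + (t : S1)) a : S1))
        = (a + (t : S1) + (crd (a + (t : S1)) u : S1)) -
          (a + (t : S1) + (crd (a + (t : S1)) a : S1)) + a := by abel
      _ = u := by rw [g1, g2]; abel
  have hβ0 : 0 ≤ β := hβ ▸ crd_nonneg _ _
  have hα0 : α ≤ 0 := by linarith
  have hβ1 : 3 ^ k * β ≤ ε₀ / 2 := by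
    have : β ≤ ε₀ / (2 * 3 ^ k) := hβ ▸ (h1.trans_le (min_le_left _ _)).le
    rw [le_div_iff₀ (by positivity)] at this
    linarith
  have hα1 : 3 ^ k * -α ≤ ε₀ / 2 := by
    have : -α ≤ ε₀ / (2 * 3 ^ k) := by linarith [min_le_left (ε₀ / (2 * 3 ^ k)) (1/2 : ℝ)]
    rw [le_div_iff₀ (by positivity)] at this
    linarith
  have hev : HE a t (X i₀) (s3^[i₀] v) := ⟨κ, κ', hole, .inl e1⟩
  have heu : HE a t (X i₀) (s3^[i₀] u) := ⟨κ, κ', hole, .inr e2⟩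
  -- expansion
  have hTβ : ε₀ < 3 ^ i₀ * β := by
    by_contra! h
    refine (hrob i₀).2.not_HE ht hε₀ hε₀' (r := 3 ^ i₀ * β) ?_ ?_
    · rwa [abs_of_nonneg (by positivity)]
    · rwa [← iter_add, ev]
  have hTα : ε₀ < 3 ^ i₀ * -α := by
    by_contra! h
    refine (hrob i₀).1.not_HE ht hε₀ hε₀' (r := 3 ^ i₀ * α) ?_ ?_
    · rw [abs_mul, abs_of_pos (by positivity), abs_of_nonpos hα0]; exact h
    · rwa [← iter_add, eu]
  have hβ' : 0 < β := by
    by_contra! h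
    have : 0 ≤ (3:ℝ) ^ i₀ := by positivity
    nlinarith
  have hα' : α < 0 := by
    by_contra! h
    have : 0 ≤ (3:ℝ) ^ i₀ := by positivity
    nlinarith
  have hk0 : k < i₀ := by
    by_contra! h
    have h5 : (3:ℝ) ^ i₀ ≤ 3 ^ k := pow_le_pow_right₀ (by norm_num) h
    nlinarith
  -- robustness along the orbit of the pair
  obtain ⟨δ₁, hδ₁, hrob1⟩ := exists_uniform
    (p := fun j δ => Rob a t (X j) δ (s3^[j] u) ∧ Rob a t (X j) δ (s3^[j] v))
    (fun j δ δ' h h' => ⟨h'.1.mono h, h'.2.mono h⟩) i₀ fun j hj => by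
      obtain ⟨δ, hδ, h⟩ := exists_rob ht ht' (S.strong j) (hu j (by omega))
        (fun h => S.not_HE_twice hj h heu)
      obtain ⟨δ', hδ', h'⟩ := exists_rob ht ht' (S.strong j) (hv j (by omega))
        (fun h => S.not_HE_twice hj h hev)
      exact ⟨min δ δ', lt_min hδ hδ', h.mono (min_le_left _ _), h'.mono (min_le_right _ _)⟩
  obtain ⟨δ, hδ, hδ1, hδ0, hδε⟩ : ∃ δ > 0, δ ≤ δ₁ ∧ δ ≤ ε₀ / 2 ∧ δ < ε :=
    ⟨min (min δ₁ (ε₀ / 2)) (ε / 2), by positivity, (min_le_left _ _).trans (min_le_left _ _),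
      (min_le_left _ _).trans (min_le_right _ _), (min_le_right _ _).trans_lt (by linarith)⟩
  -- pull the pair back along the cycle
  obtain ⟨r, hr⟩ : ∃ r : ℕ, max (-α) β / δ < 3 ^ (M * r) := by
    obtain ⟨r, hr⟩ := pow_unbounded_of_one_lt (max (-α) β / δ) (by norm_num : (1:ℝ) < 3)
    refine ⟨r, hr.trans_le (pow_le_pow_right₀ (by norm_num) (Nat.le_mul_of_pos_left r hM))⟩
  obtain ⟨R, hR⟩ : ∃ R : ℝ, R = 3 ^ (M * r) := ⟨_, rfl⟩
  have hR0 : 0 < R := by rw [hR]; positivity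
  rw [← hR, div_lt_iff₀ hδ, max_lt_iff] at hr
  have back : ∀ (y : S1) (γ : ℝ), y ∈ Cl a t X → ∀ j, k ≤ j →
      s3^[j + M * r] (y + ((γ / R : ℝ) : S1)) = s3^[j] (y + (γ : S1)) := by
    intro y γ hy j hj
    rw [iter_add, iter_add, add_comm j, hit y hy r j hj, pow_add, ← hR,
      show R * 3 ^ j * (γ / R) = 3 ^ j * γ by field_simp]
  have robs : ∀ (y : S1) (γ : ℝ), y ∈ Cl a t X → 3 ^ k * |γ| ≤ ε₀ / 2 →
      (∀ j, Rob a t (X j) ε₀ (s3^[j] y)) → (∀ j < i₀, Rob a t (X j) δ (s3^[j] (y + (γ : S1)))) →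
      ∀ j < i₀ + M * r, Rob a t (X j) δ (s3^[j] (y + ((γ / R : ℝ) : S1))) := by
    intro y γ hy hγ hr1 hr2 j hj
    rcases Nat.lt_or_ge j (k + M * r) with h | h
    · rw [iter_add]
      refine (hr1 j).shift ?_
      have h5 : (3:ℝ) ^ j ≤ 3 ^ k * R := by
        rw [hR, ← pow_add]; exact pow_le_pow_right₀ (by norm_num) h.le
      rw [abs_mul, abs_div, abs_of_pos hR0, abs_of_pos (by positivity), ← mul_div_assoc,
        div_le_iff₀ hR0]
      have := abs_nonneg γ
      nlinarith
    · obtain ⟨l, rfl⟩ : ∃ l, j = l + M * r := ⟨j - M * r, by omega⟩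
      rw [back y γ hy l (by omega), add_comm l, hXM r l (by omega)]
      exact hr2 l (by omega)
  obtain ⟨ξ, ζ, g1, g2, g3, g4, g5⟩ := renorm (X := X) hl (i := i₀ + M * r) (α := α / R) (β := β / R)
    (δ := δ) (κ := κ) (κ' := κ') (P := X i₀) (by omega) hδ (by linarith)
    (by rw [le_div_iff₀ hR0]; linarith) (by positivity) (by rw [div_le_iff₀ hR0]; linarith)
    (by
      rw [pow_add, ← hR]
      calc δ < 3 ^ i₀ * -α := by linarith
        _ = _ := by field_simp)
    (by
      rw [pow_add, ← hR]
      calc δ < 3 ^ i₀ * β := by linarith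
        _ = _ := by field_simp)
    hole (by rw [back _ _ S.memR _ hk0.le, ev, e1]) (by rw [back _ _ S.memL _ hk0.le, eu, e2])
    (robs a α S.memL (by rw [abs_of_neg hα']; exact hα1) (fun j => (hrob j).1)
      (fun j hj => by rw [eu]; exact (hrob1 j hj).1.mono hδ1))
    (robs (a + (t : S1)) β S.memR (by rw [abs_of_pos hβ']; exact hβ1) (fun j => (hrob j).2)
      (fun j hj => by rw [ev]; exact (hrob1 j hj).2.mono hδ1))
  exact ⟨ξ, ζ, by linarith, g2, g3, by linarith, g5.lt, g5⟩

end SymLam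

namespace SymLam
variable {a p q x y z w u v c b e : S1} {t : ℝ} {P Q : Pc} {X Y Z : ℕ → Pc} {k : ℕ}

/-- `(x, y)` is a pair of consecutive points of the class. -/
def Consec (a : S1) (t : ℝ) (X : ℕ → Pc) (x y : S1) : Prop :=
  x ∈ Cl a t X ∧ y ∈ Cl a t X ∧ x ≠ y ∧ ∀ w ∈ Cl a t X, ¬ cyc x w y

/-- The chord of a consecutive pair is the base of a legal set-up with the same class. -/
lemma Consec.rebase (S : Setup a t X) (h : Consec a t X x y) :
    (∃ r : ℝ, y = x + (r : S1) ∧ Setup x r X ∧ Legal x r ∧ Cl x r X = Cl a t X) ∨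
    (∃ r : ℝ, x = y + (r : S1) ∧ Setup y r X ∧ Legal y r ∧ Cl y r X = Cl a t X) := by
  obtain ⟨hx, hy, hne, hno⟩ := h
  rcases lt_trichotomy (sc a x) (sc a y) with hs | hs | hs
  · have e := S.rebase_Cl hx hy hs
    have S' := S.rebase hx hy hs
    refine .inl ⟨_, (add_sc_sub a x y).symm, S', S'.legal_of_edge (.inl ?_), e⟩
    rwa [e, add_sc_sub]
  · exact absurd (sc_inj hs) hne
  · have e := S.rebase_Cl hy hx hs
    have S' := S.rebase hy hx hs
    refine .inr ⟨_, (add_sc_sub a y x).symm, S', S'.legal_of_edge (.inr ?_), e⟩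
    rwa [e, add_sc_sub]

lemma Consec.approx (S : Setup a t X) (h : Consec a t X x y) {ε : ℝ} (hε : 0 < ε) :
    ∃ w z, s(w, z) ∈ CsCL ∧ 0 < crd x w ∧ crd x w < ε ∧ crd x w < crd x z ∧
      crd x y - ε < crd x z ∧ crd x z < crd x y := by
  obtain ⟨-, -, -, hno⟩ := id h
  rcases h.rebase S with ⟨r, rfl, S', hl, e⟩ | ⟨r, rfl, S', hl, e⟩
  · rw [← e] at hno
    obtain ⟨α, β, h1, h2, h3, h4, h5, hL⟩ := S'.approx_below hl hno hε
    have := S'.lt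
    have e1 : crd x (x + (α : S1)) = α := crd_eq rfl h1.le (by linarith)
    have e2 : crd x (x + (α : S1) + ((r - α - β : ℝ) : S1)) = r - β :=
      crd_eq (by rw [add_assoc, ← AddCircle.coe_add]; ring_nf) (by linarith) (by linarith)
    refine ⟨_, _, hL.mem_CsCL, ?_⟩
    rw [e1, e2, crd_base x S'.pos S'.lt]
    exact ⟨h1, h2, by linarith, by linarith, by linarith⟩
  · rw [← e] at hno
    have h0 := S'.pos
    obtain ⟨ξ, ζ, h1, h2, h3, h4, h5, hL⟩ := S'.approx_above hl hno hε
    have e0 : crd (y + (r : S1)) y = 1 - r := by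
      refine crd_eq ?_ (by linarith) (by linarith)
      rw [add_assoc, ← AddCircle.coe_add]
      simp
    have e1 : crd (y + (r : S1)) (y + (ξ : S1) + ((r + ζ - ξ : ℝ) : S1)) = ζ := by
      refine crd_eq ?_ h3.le (by linarith)
      rw [add_assoc, ← AddCircle.coe_add, add_assoc, ← AddCircle.coe_add]; ring_nf
    have e2 : crd (y + (r : S1)) (y + (ξ : S1)) = 1 - r + ξ := by
      refine crd_eq ?_ (by linarith) (by linarith)
      rw [add_assoc, ← AddCircle.coe_add, coe_two_int (r := r + (1 - r + ξ)) (r' := ξ) 1 (by push_cast; ring)]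
    have hm := hL.mem_CsCL
    rw [Sym2.eq_swap] at hm
    refine ⟨_, _, hm, ?_⟩
    rw [e0, e1, e2]
    exact ⟨h3, h4, by linarith, by linarith, by linarith⟩

lemma Cl_mono (ht' : t < 1/6) (hX : ∀ j, Strong (X j)) {α β : ℝ} (hα : 0 ≤ α) (hβ : 0 ≤ β)
    (h : α + β < t) (hx : x ∈ Cl a t X) : x ∈ Cl (a + (α : S1)) (t - α - β) X :=
  fun j => inP_mono ht' (hX j) hα hβ h (hx j)

lemma exists_overlap {s : ℝ} (ht : 0 < t) (ht' : t < 1/6) (hs : 0 < s) (hs' : s < 1/6)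
    (h : Xs a (a + (t : S1)) b (b + (s : S1))) :
    ∃ α β α' β', 0 ≤ α ∧ 0 ≤ β ∧ 0 ≤ α' ∧ 0 ≤ β' ∧ α + β < t ∧ α' + β' < s ∧
      a + (α : S1) = b + (α' : S1) ∧ t - α - β = s - α' - β' := by
  have hc := crd_base a ht ht'
  have hc' := crd_base b hs hs'
  rw [Xs_iff_cyc] at h
  rcases h with ⟨h1, h2⟩ | ⟨h1, h2⟩
  · rw [cyc_base, hc] at h1
    have h3 : crd a (b + (s : S1)) = crd a b + s := by
      refine crd_eq ?_ (by linarith) (by linarith)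
      rw [AddCircle.coe_add, ← add_assoc, add_crd]
    rw [cyc_iff a, hc, h3, crd_self] at h2
    have h4 : t < crd a b + s := by grind
    refine ⟨crd a b, 0, 0, s - (t - crd a b), by linarith, le_rfl, le_rfl, by linarith,
      by linarith, by linarith, by simp [add_crd], by ring⟩
  · rw [cyc_base, hc] at h1
    rw [cyc_iff a, hc, crd_self] at h2
    have h4 : t < crd a b := by
      have := crd_nonneg a b
      grind
    have h5 := crd_lt_one a b
    have e : b + (s : S1) = a + ((crd a b + s : ℝ) : S1) := by
      rw [AddCircle.coe_add, ← add_assoc, add_crd]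
    have h6 : 1 ≤ crd a b + s := by
      by_contra! h6
      rw [crd_eq e (by linarith) h6] at h1
      linarith
    have h3 : crd a (b + (s : S1)) = crd a b + s - 1 :=
      crd_eq (by rw [e, coe_sub_one]) (by linarith) (by linarith)
    rw [h3] at h1
    refine ⟨0, t - (crd a b + s - 1), 1 - crd a b, 0, le_rfl, by linarith, by linarith, le_rfl,
      by linarith, by linarith, ?_, by ring⟩
    symm
    calc b + ((1 - crd a b : ℝ) : S1) = a + (crd a b : S1) + ((1 - crd a b : ℝ) : S1) := by
          rw [add_crd]
      _ = a + ((0 : ℝ) : S1) := by rw [add_assoc, ← AddCircle.coe_add]; simp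

/-- A legal chord crossing the base chord of a set-up has both endpoints in the class. -/
lemma Setup.mem_of_cross {s : ℝ} (S : Setup a t X) (hl : Legal b s)
    (h : Xs a (a + (t : S1)) b (b + (s : S1))) :
    b ∈ Cl a t X ∧ b + (s : S1) ∈ Cl a t X := by
  obtain ⟨Y, hY, -, hb, hb'⟩ := hl.itinerary
  obtain ⟨α, β, α', β', hα, hβ, hα', hβ', h1, h2, e1, e2⟩ :=
    exists_overlap S.pos S.lt hl.pos hl.lt h
  have ha := Cl_mono S.lt S.strong hα hβ h1 S.memL
  have ha' := Cl_mono S.lt S.strong hα hβ h1 S.memR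
  replace hb := Cl_mono hl.lt hY hα' hβ' h2 hb
  replace hb' := Cl_mono hl.lt hY hα' hβ' h2 hb'
  rw [← e1, ← e2] at hb hb'
  have p0 : 0 < t - α - β := by linarith
  have p1 : t - α - β < 1/6 := by linarith [S.lt]
  obtain rfl := Cl_unlinked p0 p1 ha ha' hb hb' h
  have hX := S.strong
  suffices H : ∀ g g', g ∈ Cl (a + (α : S1)) (t - α - β) X → g' ∈ Cl (a + (α : S1)) (t - α - β) X →
      Xs a (a + (t : S1)) g g' → g ∈ Cl a t X from
    ⟨H _ _ hb hb' h, H _ _ hb' hb (Xs_swap_right.1 h)⟩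
  intro g g' hg hg' hx j
  by_contra hj
  obtain ⟨s, hs, hc⟩ := piece_escape (p := -α) (q := t - α) (r := -α) (r' := t - α) p0 p1 (hX j)
    (by linarith) (by linarith) (by linarith [S.lt]) le_rfl (by linarith [S.pos]) le_rfl (hg j)
    (by
      rw [add_assoc, ← AddCircle.coe_add]
      simpa using hj)
  rw [add_assoc, ← AddCircle.coe_add, add_assoc, ← AddCircle.coe_add] at hc
  simp only [add_neg_cancel, AddCircle.coe_zero, add_zero, add_sub_cancel] at hc
  have hs0 : j = 0 → s = true := by rintro rfl; exact hs S.zero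
  have hlt : sc a a < sc a (a + (t : S1)) := by rw [sc_self, S.sc_base]; exact S.pos
  have n1 := S.not_enter S.memL S.memR hlt hs0 (Cl_iter S.memL (j + 1))
  have n2 := S.not_enter S.memL S.memR hlt hs0 (Cl_iter S.memR (j + 1))
  have hx' : Xs (s3^[j+1] a) (s3^[j+1] (a + (t : S1))) (s3^[j+1] g) (s3^[j+1] g') := by
    rw [Xs_iff_cyc] at hx ⊢
    rwa [cyc_iter_iff p0 p1 ha hg ha', cyc_iter_iff p0 p1 ha' hg' ha,
      cyc_iter_iff p0 p1 ha hg' ha', cyc_iter_iff p0 p1 ha' hg ha]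
  rw [← Function.iterate_succ_apply' s3 j] at hc
  have hX' : Xs (sg s (s3 a)) (sg s (s3 (a + (t : S1)))) (s3^[j+1] g) (s3^[j+1] g') := by
    generalize sg s (s3 a) = U at *
    generalize sg s (s3 (a + (t : S1))) = V at *
    generalize s3^[j+1] a = A at *
    generalize s3^[j+1] (a + (t : S1)) = E at *
    generalize s3^[j+1] g' = G' at *
    have hc' : cyc U (s3^[j+1] g) V := hc
    generalize s3^[j+1] g = G at *
    rw [cyc_base] at n1 n2 hc'
    rw [Xs_iff U] at hx' ⊢
    rw [crd_self]
    have hA := crd_nonneg U A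
    have hE := crd_nonneg U E
    have hG := crd_nonneg U G'
    clear hc
    generalize crd U A = rA at *
    generalize crd U E = rE at *
    generalize crd U G' = rG' at *
    generalize crd U G = rG at *
    generalize crd U V = rV at *
    clear * - n1 n2 hc' hx' hA hE hG
    grind
  have := Cl_unlinked p0 p1 (Cl_sg p0 p1 s (Cl_s3 ha)) (Cl_sg p0 p1 s (Cl_s3 ha'))
    (Cl_iter hg (j + 1)) (Cl_iter hg' (j + 1)) hX'
  rcases Nat.eq_zero_or_pos j with hj | hj
  · rw [hs0 hj] at this
    exact S.nrec' _ this.symm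
  · exact S.ne_sg hj s this.symm

end SymLam

namespace SymLam
variable {a p q x y z w u v c b e g : S1} {t : ℝ} {P Q : Pc} {X Y Z : ℕ → Pc} {k : ℕ}

lemma mem_segment_of_dt {p q u : ℂ} (hp : ‖p‖ = 1) (hq : ‖q‖ = 1) (hpq : p ≠ q) (hu : ‖u‖ ≤ 1)
    (h : dt p q u = 0) : u ∈ segment ℝ p q := by
  have hp' : p.re ^ 2 + p.im ^ 2 = 1 := by
    rw [← Complex.sq_norm_sub_sq_im, hp]; ring
  have hq' : q.re ^ 2 + q.im ^ 2 = 1 := by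
    rw [← Complex.sq_norm_sub_sq_im, hq]; ring
  have hu' : u.re ^ 2 + u.im ^ 2 ≤ 1 := by
    rw [← Complex.sq_norm_sub_sq_im]; nlinarith [norm_nonneg u]
  have hD : 0 < (q.re - p.re) ^ 2 + (q.im - p.im) ^ 2 := by
    by_contra! hD
    apply hpq
    apply Complex.ext <;> nlinarith [sq_nonneg (q.re - p.re), sq_nonneg (q.im - p.im)]
  unfold dt at h
  set D := (q.re - p.re) ^ 2 + (q.im - p.im) ^ 2 with hDd
  set s := ((u.re - p.re) * (q.re - p.re) + (u.im - p.im) * (q.im - p.im)) / D with hs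
  have hsD : s * D = (u.re - p.re) * (q.re - p.re) + (u.im - p.im) * (q.im - p.im) :=
    div_mul_cancel₀ _ hD.ne'
  have e1 : u.re = (1 - s) * p.re + s * q.re := by
    have : D * (u.re - ((1 - s) * p.re + s * q.re)) = 0 := by
      linear_combination (- (q.im - p.im)) * h - (q.re - p.re) * hsD + (u.re - p.re) * hDd
    rcases mul_eq_zero.1 this with h | h <;> linarith
  have e2 : u.im = (1 - s) * p.im + s * q.im := by
    have : D * (u.im - ((1 - s) * p.im + s * q.im)) = 0 := by
      linear_combination (q.re - p.re) * h - (q.im - p.im) * hsD + (u.im - p.im) * hDd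
    rcases mul_eq_zero.1 this with h | h <;> linarith
  have e3 : u.re ^ 2 + u.im ^ 2 = 1 - s * (1 - s) * D := by
    rw [e1, e2, hDd]
    linear_combination (1 - s) * hp' + s * hq'
  have e4 : 0 ≤ s * (1 - s) := by
    by_contra! h4
    nlinarith
  refine ⟨1 - s, s, by nlinarith, by nlinarith, by ring, ?_⟩
  apply Complex.ext <;> simp [e1, e2]

lemma dt_eq_zero_iff (hxy : x ≠ y) {u : ℂ} (hu : u ∈ closedDisk) :
    dt (toC x) (toC y) u = 0 ↔ u ∈ chordSet s(x, y) :=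
  ⟨mem_segment_of_dt (norm_toC x) (norm_toC y) (fun h => hxy (toC_injective h))
    (by simpa [closedDisk] using hu), dt_segment_zero⟩

lemma dt_segment_neg {p q u v w : ℂ} (hw : w ∈ segment ℝ u v) (hu : dt p q u < 0)
    (hv : dt p q v < 0) : dt p q w < 0 := by
  rw [dt_swap] at *
  have := dt_segment_pos (p := q) (q := p) hw (by linarith) (by linarith)
  linarith

lemma chordSet_subset_closedDisk (ℓ : Chord) : chordSet ℓ ⊆ closedDisk := by
  induction ℓ using Sym2.ind with
  | _ x y =>
    exact (convex_closedBall _ _).segment_subset (toC_mem_closedDisk x) (toC_mem_closedDisk y)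

lemma hausdorffDist_segment {p q p' q' : ℂ} {ε : ℝ} (hp : ‖p' - p‖ < ε) (hq : ‖q' - q‖ < ε) :
    hausdorffDist (segment ℝ p' q') (segment ℝ p q) < ε := by
  have key : ∀ {p q p' q' : ℂ} {r : ℝ}, ‖p' - p‖ ≤ r → ‖q' - q‖ ≤ r →
      ∀ v ∈ segment ℝ p' q', ∃ v' ∈ segment ℝ p q, dist v v' ≤ r := by
    rintro p q p' q' r h1 h2 v ⟨s, s', h, h', e, rfl⟩
    refine ⟨s • p + s' • q, ⟨s, s', h, h', e, rfl⟩, ?_⟩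
    rw [dist_eq_norm]
    calc _ = ‖s • (p' - p) + s' • (q' - q)‖ := by congr 1; simp only [smul_sub]; ring
      _ ≤ s * ‖p' - p‖ + s' * ‖q' - q‖ := by
          refine (norm_add_le _ _).trans_eq ?_
          rw [norm_smul, norm_smul, Real.norm_of_nonneg h, Real.norm_of_nonneg h']
      _ ≤ s * r + s' * r := by gcongr
      _ = r := by rw [← add_mul, e, one_mul]
  refine (hausdorffDist_le_of_mem_dist (r := max ‖p' - p‖ ‖q' - q‖) ?_
    (key (le_max_left _ _) (le_max_right _ _)) (key ?_ ?_)).trans_lt (max_lt hp hq)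
  · exact (norm_nonneg _).trans (le_max_left _ _)
  · rw [norm_sub_rev]; exact le_max_left _ _
  · rw [norm_sub_rev]; exact le_max_right _ _

lemma Consec.near (S : Setup a t X) (h : Consec a t X x y) {ε : ℝ} (hε : 0 < ε) :
    ∃ w z, s(w, z) ∈ CsCL ∧ cyc x w y ∧ cyc x z y ∧ w ≠ z ∧ ‖toC w - toC x‖ < ε ∧
      ‖toC z - toC y‖ < ε := by
  have hc : Continuous fun s : ℝ => toC (x + (s : S1)) :=
    continuous_toC.comp (continuous_const.add (AddCircle.continuous_mk' 1))
  obtain ⟨δ, hδ, h1⟩ := Metric.continuous_iff.1 hc 0 ε hε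
  obtain ⟨δ', hδ', h2⟩ := Metric.continuous_iff.1 hc (crd x y) ε hε
  obtain ⟨w, z, hm, e1, e2, e3, e4, e5⟩ := h.approx S (lt_min hδ hδ')
  refine ⟨w, z, hm, ?_, ?_, ?_, ?_, ?_⟩
  · rw [cyc_base]; exact ⟨e1, e3.trans e5⟩
  · rw [cyc_base]; exact ⟨e1.trans e3, e5⟩
  · rintro rfl; exact lt_irrefl _ e3
  · have := h1 (crd x w) (by
      rw [Real.dist_eq, sub_zero, abs_of_pos e1]; exact e2.trans_le (min_le_left _ _))
    rw [dist_eq_norm] at this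
    simpa [add_crd] using this
  · have := h2 (crd x z) (by
      rw [Real.dist_eq, abs_sub_lt_iff]
      constructor <;> linarith [min_le_right δ δ'])
    rw [dist_eq_norm] at this
    simpa [add_crd] using this

/-- A class whose chord is consecutive from one side is approximated from that side. -/
lemma Consec.limit (S : Setup a t X) (h : Consec a t X x y) {v : ℂ}
    (hv : v ∈ closedDisk) (hv' : dt (toC x) (toC y) v < 0) {ε : ℝ} (hε : 0 < ε) :
    ∃ d ∈ CsCL, d ≠ s(x, y) ∧ chordSet d ⊆
      connectedComponentIn (closedDisk \ chordSet s(x, y)) v ∧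
      hausdorffDist (chordSet d) (chordSet s(x, y)) < ε := by
  obtain ⟨w, z, hm, h1, h2, -, h3, h4⟩ := h.near S hε
  refine ⟨_, hm, ?_, ?_, hausdorffDist_segment h3 h4⟩
  · intro e
    have : w ∈ s(x, y) := e ▸ Sym2.mem_mk_left w z
    have hw := cyc_ne h1
    rcases Sym2.mem_iff.1 this with e | e
    exacts [hw.1 e, hw.2.1 e]
  have hA : Convex ℝ {u ∈ closedDisk | dt (toC x) (toC y) u < 0} := by
    rw [convex_iff_segment_subset]
    exact fun p hp q hq u hu => ⟨(convex_closedBall _ _).segment_subset hp.1 hq.1 hu,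
      dt_segment_neg hu hp.2 hq.2⟩
  have hs : chordSet s(w, z) ⊆ {u ∈ closedDisk | dt (toC x) (toC y) u < 0} := fun u hu =>
    ⟨chordSet_subset_closedDisk _ hu, dt_segment_neg hu (dt_neg_iff.2 h1) (dt_neg_iff.2 h2)⟩
  refine hs.trans
    (hA.isPreconnected.subset_connectedComponentIn ⟨hv, hv'⟩ fun u hu => ⟨hu.1, fun hc => ?_⟩)
  exact hu.2.ne (dt_segment_zero hc)

lemma Consec.twoSided (S : Setup a t X) (h : Consec a t X x y) (h' : Consec a t X y x) :
    TwoSidedLimitOf CsCL s(x, y) := by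
  rintro v ⟨hv, hv'⟩ ε hε
  rcases lt_trichotomy (dt (toC x) (toC y) v) 0 with h1 | h1 | h1
  · exact h.limit S hv h1 hε
  · exact absurd ((dt_eq_zero_iff h.2.2.1 hv).1 h1) hv'
  · rw [Sym2.eq_swap]
    exact h'.limit S hv (by rw [dt_swap]; linarith) hε

lemma Setup.consec_of_legal (S : Setup a t X) (hl : Legal a t) :
    Consec a t X a (a + (t : S1)) ∨ Consec a t X (a + (t : S1)) a := by
  have hne : a ≠ a + (t : S1) := by
    intro e
    have := crd_base a S.pos S.lt
    rw [← e, crd_self] at this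
    exact S.pos.ne this
  by_cases h : ∀ w ∈ Cl a t X, ¬ cyc a w (a + (t : S1))
  · exact .inl ⟨S.memL, S.memR, hne, h⟩
  · push Not at h
    obtain ⟨z, hz, hz'⟩ := h
    exact .inr ⟨S.memR, S.memL, hne.symm, fun w hw => S.edge_of_legal hl hz hw hz'⟩

/-- A legal chord with both endpoints in the class is consecutive in it. -/
lemma Setup.consec_of_mem {s : ℝ} (S : Setup a t X) (hl : Legal b s) (hb : b ∈ Cl a t X)
    (hb' : b + (s : S1) ∈ Cl a t X) :
    Consec a t X b (b + (s : S1)) ∨ Consec a t X (b + (s : S1)) b := by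
  have hcb := crd_base b hl.pos hl.lt
  rcases lt_trichotomy (sc a b) (sc a (b + (s : S1))) with h | h | h
  · have e := S.rebase_Cl hb hb' h
    have S' := S.rebase hb hb' h
    have e' := add_sc_sub a b (b + (s : S1))
    generalize sc a (b + (s : S1)) - sc a b = r at *
    have : r = s := by
      rw [← hcb, ← e', crd_base b S'.pos S'.lt]
    subst this
    unfold Consec
    rw [← e]
    exact S'.consec_of_legal hl
  · have := sc_inj h
    rw [← this, crd_self] at hcb
    exact absurd hcb hl.pos.ne
  · have S' := S.rebase hb' hb h
    have e' := add_sc_sub a (b + (s : S1)) b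
    generalize sc a b - sc a (b + (s : S1)) = r at *
    have h1 := hl.pos
    have h2 := hl.lt
    have h3 := S'.pos
    have h4 := S'.lt
    rw [add_assoc, ← AddCircle.coe_add] at e'
    have := crd_add (a := b) (s := s + r) (by linarith) (by linarith)
    rw [e', crd_self] at this
    linarith

/-- A point outside the class lies strictly between two consecutive points. -/
lemma Setup.exists_consec (S : Setup a t X) (hg : g ∉ Cl a t X) :
    ∃ x y, Consec a t X x y ∧ cyc x g y := by
  have hf := Cl_finite S.pos S.lt X (a := a)
  obtain ⟨x, hx, hx'⟩ := Set.exists_max_image _ (crd g) hf ⟨a, S.memL⟩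
  obtain ⟨y, hy, hy'⟩ := Set.exists_min_image _ (crd g) hf ⟨a, S.memL⟩
  have hy0 : 0 < crd g y := (crd_nonneg g y).lt_of_ne fun e => hg (crd_eq_zero.1 e.symm ▸ hy)
  have hyx : crd g y < crd g x := by
    refine (hy' x hx).lt_of_ne fun e => ?_
    have h1 : crd g a = crd g (a + (t : S1)) := by
      linarith [hx' a S.memL, hx' _ S.memR, hy' a S.memL, hy' _ S.memR]
    have := crd_base a S.pos S.lt
    rw [← crd_inj h1, crd_self] at this
    exact S.pos.ne this
  refine ⟨x, y, ⟨hx, hy, ?_, fun w hw hc => ?_⟩, ?_⟩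
  · rintro rfl; exact lt_irrefl _ hyx
  · rw [cyc_iff g] at hc
    have h1 := hx' w hw
    have h2 := hy' w hw
    rcases hc with hc | hc | hc <;> linarith
  · rw [cyc_iff g, crd_self]
    exact .inr (.inl ⟨hy0, hyx⟩)

end SymLam

namespace SymLam
variable {a p q x y z w u v c b e g h : S1} {t : ℝ} {P Q : Pc} {X Y Z : ℕ → Pc} {k : ℕ}

/-- The open polygon spanned by a class. -/
def Pin (a : S1) (t : ℝ) (X : ℕ → Pc) : Set ℂ :=
  {v ∈ openDisk | ∀ x y, Consec a t X x y → 0 < dt (toC x) (toC y) v}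

/-- The closed polygon spanned by a class. -/
def Poly (a : S1) (t : ℝ) (X : ℕ → Pc) : Set ℂ :=
  {v ∈ closedDisk | ∀ x y, Consec a t X x y → 0 ≤ dt (toC x) (toC y) v}

lemma continuous_dt (p q : ℂ) : Continuous (dt p q) := by
  unfold dt; fun_prop

lemma isOpen_Pin (ht : 0 < t) (ht' : t < 1/6) : IsOpen (Pin a t X) := by
  have hf := Cl_finite ht ht' X (a := a)
  have : Pin a t X = openDisk ∩ ⋂ p ∈ {p ∈ Cl a t X ×ˢ Cl a t X | Consec a t X p.1 p.2},
      {v | 0 < dt (toC p.1) (toC p.2) v} := by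
    ext v
    simp only [Pin, Set.mem_inter_iff, Set.mem_iInter, Prod.forall]
    exact ⟨fun h => ⟨h.1, fun x y hxy => h.2 x y hxy.2⟩,
      fun h => ⟨h.1, fun x y hxy => h.2 x y ⟨⟨hxy.1, hxy.2.1⟩, hxy⟩⟩⟩
  rw [this]
  refine isOpen_ball.inter (((hf.prod hf).subset (sep_subset _ _)).isOpen_biInter fun p _ => ?_)
  exact isOpen_lt continuous_const (continuous_dt _ _)

lemma convex_Pin : Convex ℝ (Pin a t X) := by
  rw [convex_iff_segment_subset]
  exact fun p hp q hq u hu => ⟨(convex_ball _ _).segment_subset hp.1 hq.1 hu,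
    fun x y hxy => dt_segment_pos hu (hp.2 x y hxy) (hq.2 x y hxy)⟩

lemma isClosed_Poly : IsClosed (Poly a t X) := by
  have : Poly a t X = closedDisk ∩ ⋂ x, ⋂ y, ⋂ _ : Consec a t X x y,
      {v | 0 ≤ dt (toC x) (toC y) v} := by
    ext v; simp [Poly]
  rw [this]
  exact isClosed_closedBall.inter (isClosed_iInter fun x => isClosed_iInter fun y =>
    isClosed_iInter fun _ => isClosed_le continuous_const (continuous_dt _ _))

lemma Pin_subset_Poly : Pin a t X ⊆ Poly a t X :=
  fun _ hv => ⟨ball_subset_closedBall hv.1, fun x y hxy => (hv.2 x y hxy).le⟩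

lemma Consec.dt_nonneg (hc : Consec a t X x y) (hh : h ∈ Cl a t X) :
    0 ≤ dt (toC x) (toC y) (toC h) := by
  by_contra! hlt
  exact hc.2.2.2 h hh (dt_neg_iff.1 hlt)

lemma Consec.dt_pos (hc : Consec a t X x y) (hh : h ∈ Cl a t X) (hx : h ≠ x) (hy : h ≠ y) :
    0 < dt (toC x) (toC y) (toC h) :=
  dt_pos_iff.2 ((cyc_or hx hy hc.2.2.1).resolve_left (hc.2.2.2 h hh))

lemma toC_mem_Poly (hh : h ∈ Cl a t X) : toC h ∈ Poly a t X :=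
  ⟨toC_mem_closedDisk h, fun _ _ hc => hc.dt_nonneg hh⟩

lemma Setup.gapVerts_Poly (S : Setup a t X) : gapVerts (Poly a t X) = Cl a t X := by
  ext g
  refine ⟨fun hg => ?_, toC_mem_Poly⟩
  by_contra hn
  obtain ⟨x, y, hc, hxy⟩ := S.exists_consec hn
  exact absurd (dt_neg_iff.2 hxy) (not_lt.2 (hg.2 x y hc))

lemma midpoint_mem_openDisk (hgh : g ≠ h) :
    (1/2 : ℝ) • toC g + (1/2 : ℝ) • toC h ∈ openDisk := by
  rw [openDisk, mem_ball_zero_iff]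
  exact norm_combo_lt_of_ne (norm_toC g).le (norm_toC h).le (fun e => hgh (toC_injective e))
    (by norm_num) (by norm_num) (by norm_num)

lemma Pin_nonempty {h₁ h₂ h₃ : S1} (m₁ : h₁ ∈ Cl a t X) (m₂ : h₂ ∈ Cl a t X) (m₃ : h₃ ∈ Cl a t X)
    (n₁₂ : h₁ ≠ h₂) (n₁₃ : h₁ ≠ h₃) (n₂₃ : h₂ ≠ h₃) : (Pin a t X).Nonempty := by
  refine ⟨(1/2 : ℝ) • ((1/2 : ℝ) • toC h₁ + (1/2 : ℝ) • toC h₂) + (1/2 : ℝ) • toC h₃, ?_, ?_⟩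
  · have h1 := midpoint_mem_openDisk n₁₂
    rw [openDisk, mem_ball_zero_iff] at h1 ⊢
    refine (norm_add_le _ _).trans_lt ?_
    rw [norm_smul, norm_smul, norm_toC, Real.norm_of_nonneg (by norm_num)]
    linarith
  · intro x y hc
    rw [dt_comb _ _ _ _ (by norm_num), dt_comb _ _ _ _ (by norm_num)]
    have d₁ := hc.dt_nonneg m₁
    have d₂ := hc.dt_nonneg m₂
    have d₃ := hc.dt_nonneg m₃
    have p₁ := hc.dt_pos m₁
    have p₂ := hc.dt_pos m₂
    have p₃ := hc.dt_pos m₃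
    have : 0 < dt (toC x) (toC y) (toC h₁) ∨ 0 < dt (toC x) (toC y) (toC h₂) ∨
        0 < dt (toC x) (toC y) (toC h₃) := by
      by_contra! hcon
      grind
    rcases this with h | h | h <;> linarith

/-- Comajors do not meet the open polygon. -/
lemma Setup.Pin_disjoint (S : Setup a t X) : Pin a t X ⊆ openDisk \ unionSet CsCL := by
  refine fun v hv => ⟨hv.1, fun hu => ?_⟩
  simp only [unionSet, Set.mem_iUnion] at hu
  obtain ⟨d, ⟨L, hL, hd⟩, hvd⟩ := hu
  by_cases hdiag : d.IsDiag
  · induction d using Sym2.ind with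
    | _ b b' =>
      obtain rfl : b = b' := hdiag
      rw [chordSet_mk, segment_same] at hvd
      have := hv.1
      rw [hvd, openDisk, mem_ball_zero_iff, norm_toC] at this
      exact lt_irrefl _ this
  obtain ⟨b, s, hl, rfl⟩ := exists_legal hL hd hdiag
  have key : ∀ g g', v ∈ chordSet s(g, g') →
      (∀ {a' : S1} {r : ℝ}, Setup a' r X → Xs a' (a' + (r : S1)) g g' → g ∈ Cl a' r X) →
      g ∈ Cl a t X := by
    intro g g' hv' hX
    by_contra hg
    obtain ⟨x, y, hc, hxy⟩ := S.exists_consec hg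
    have hpos := hv.2 x y hc
    have hg0 := dt_neg_iff.2 hxy
    rcases lt_or_ge 0 (dt (toC x) (toC y) (toC g')) with h0 | h0
    · rw [dt_pos_iff] at h0
      have hXs : Xs x y g g' := (Xs_iff_cyc x y g g').2 (.inl ⟨hxy, h0⟩)
      rcases hc.rebase S with ⟨r, rfl, S', -, e⟩ | ⟨r, rfl, S', -, e⟩
      · exact hg (e ▸ hX S' hXs)
      · exact hg (e ▸ hX S' (Xs_swap_left.1 hXs))
    · obtain ⟨s, s', h1, h2, h3, h4⟩ := dt_segment (p := toC x) (q := toC y) hv'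
      nlinarith
  have hb : b ∈ Cl a t X := key b _ hvd fun S' hX => (S'.mem_of_cross hl hX).1
  have hb' : b + (s : S1) ∈ Cl a t X :=
    key _ b (by rwa [Sym2.eq_swap]) fun S' hX => (S'.mem_of_cross hl (Xs_swap_right.1 hX)).2
  rcases S.consec_of_mem hl hb hb' with hc | hc
  · exact (hv.2 _ _ hc).ne' (dt_segment_zero hvd)
  · rw [Sym2.eq_swap] at hvd
    exact (hv.2 _ _ hc).ne' (dt_segment_zero hvd)

lemma Setup.component_subset (S : Setup a t X) {o : ℂ} (ho : o ∈ Pin a t X) :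
    connectedComponentIn (openDisk \ unionSet CsCL) o ⊆ Poly a t X := by
  intro v hv
  have hv1 := (connectedComponentIn_subset _ _ hv).1
  refine ⟨ball_subset_closedBall hv1, fun x y hc => ?_⟩
  by_contra! hneg
  have hpos := ho.2 x y hc
  have hcont : ∀ u : ℂ, Continuous fun p : ℂ × ℂ => dt p.1 p.2 u := fun u => by
    unfold dt; fun_prop
  have hU := ((isOpen_lt (hcont v) continuous_const).inter
    (isOpen_lt (f := fun _ => (0:ℝ)) continuous_const (hcont o))).mem_nhds
    (show (toC x, toC y) ∈ _ from ⟨hneg, hpos⟩)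
  obtain ⟨ε, hε, hball⟩ := Metric.mem_nhds_iff.1 hU
  obtain ⟨w, z, hm, -, -, hne, h1, h2⟩ := hc.near S hε
  obtain ⟨hn, hp⟩ : dt (toC w) (toC z) v < 0 ∧ 0 < dt (toC w) (toC z) o := hball (by
    rw [Metric.mem_ball, Prod.dist_eq, dist_eq_norm, dist_eq_norm]
    exact max_lt h1 h2 : (toC w, toC z) ∈ _)
  obtain ⟨u, hu, hu0⟩ := isPreconnected_connectedComponentIn.intermediate_value hv
    (mem_connectedComponentIn (S.Pin_disjoint ho)) (continuous_dt (toC w) (toC z)).continuousOn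
    (show (0:ℝ) ∈ Icc _ _ from ⟨hn.le, hp.le⟩)
  have hu' := connectedComponentIn_subset _ _ hu
  refine hu'.2 (Set.mem_biUnion hm ?_)
  exact (dt_eq_zero_iff hne (ball_subset_closedBall hu'.1)).1 hu0

lemma combo_tendsto {A : Set ℂ} {v o : ℂ}
    (h : ∀ s ∈ Ioo (0:ℝ) 1, (1 - s) • v + s • o ∈ A) : v ∈ closure A := by
  have hc : Continuous fun s : ℝ => (1 - s) • v + s • o := by fun_prop
  have := map_mem_closure hc (s := Ioo (0:ℝ) 1) (x := 0)
    (by rw [closure_Ioo zero_ne_one]; exact ⟨le_rfl, zero_le_one⟩) h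
  simpa using this

lemma Poly_subset {o : ℂ} (ho : o ∈ Pin a t X) : Poly a t X ⊆ closure (Pin a t X) := by
  refine fun v hv => combo_tendsto (o := o) fun s hs => ⟨?_, fun x y hc => ?_⟩
  · have h1 := hv.1
    have h2 := ho.1
    rw [openDisk, mem_ball_zero_iff] at h2 ⊢
    rw [closedDisk, mem_closedBall_zero_iff] at h1
    refine (norm_add_le _ _).trans_lt ?_
    rw [norm_smul, norm_smul, Real.norm_of_nonneg (by linarith [hs.2]), Real.norm_of_nonneg hs.1.le]
    nlinarith [hs.1, hs.2]
  · rw [dt_comb _ _ _ _ (by ring)]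
    have h1 := mul_nonneg (sub_nonneg.2 hs.2.le) (hv.2 x y hc)
    have h2 := mul_pos hs.1 (ho.2 x y hc)
    linarith

lemma Setup.isGap (S : Setup a t X) (h : (Pin a t X).Nonempty) : IsGapOf CsCL (Poly a t X) := by
  obtain ⟨o, ho⟩ := h
  refine ⟨o, S.Pin_disjoint ho, Subset.antisymm ((Poly_subset ho).trans (closure_mono ?_))
    (isClosed_Poly.closure_subset_iff.2 (S.component_subset ho))⟩
  exact convex_Pin.isPreconnected.subset_connectedComponentIn ho S.Pin_disjoint

lemma Consec.isEdge (hc : Consec a t X x y) : IsEdgeOf (Poly a t X) s(x, y) := by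
  refine ⟨hc.2.2.1, fun v hv => ?_⟩
  have hv0 := dt_segment_zero hv
  rw [frontier_eq_closure_inter_closure]
  constructor
  · refine subset_closure ⟨chordSet_subset_closedDisk _ hv, fun x' y' hc' => ?_⟩
    obtain ⟨s, s', h1, h2, h3, h4⟩ := dt_segment (p := toC x') (q := toC y') hv
    rw [h4]
    have := hc'.dt_nonneg hc.1
    have := hc'.dt_nonneg hc.2.1
    positivity
  · obtain ⟨g, hg⟩ := exists_cyc hc.2.2.1
    refine combo_tendsto (o := toC g) fun s hs hmem => ?_
    have h1 := hmem.2 x y hc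
    rw [dt_comb _ _ _ _ (by ring), hv0] at h1
    have := mul_neg_of_pos_of_neg hs.1 (dt_neg_iff.2 hg)
    linarith

lemma Setup.consec_of_isEdge (S : Setup a t X) {l : Chord} (hl : IsEdgeOf (Poly a t X) l) :
    ∃ x y, Consec a t X x y ∧ l = s(x, y) := by
  induction l using Sym2.ind with
  | _ g h =>
    obtain ⟨hne, hsub⟩ := hl
    replace hne : g ≠ h := hne
    have hm : ∀ u ∈ chordSet s(g, h), u ∈ Poly a t X := fun u hu =>
      isClosed_Poly.frontier_subset (hsub hu)
    have hg : g ∈ Cl a t X := by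
      rw [← S.gapVerts_Poly]; exact hm _ (left_mem_segment ℝ _ _)
    have hh : h ∈ Cl a t X := by
      rw [← S.gapVerts_Poly]; exact hm _ (right_mem_segment ℝ _ _)
    by_contra! hcon
    have hmid : (1/2 : ℝ) • toC g + (1/2 : ℝ) • toC h ∈ Pin a t X := by
      refine ⟨midpoint_mem_openDisk hne, fun x y hc => ?_⟩
      rw [dt_comb _ _ _ _ (by norm_num)]
      have d₁ := hc.dt_nonneg hg
      have d₂ := hc.dt_nonneg hh
      have p₁ := hc.dt_pos hg
      have p₂ := hc.dt_pos hh
      have hxy := hcon x y hc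
      rw [ne_eq, Sym2.eq_iff] at hxy
      have : 0 < dt (toC x) (toC y) (toC g) ∨ 0 < dt (toC x) (toC y) (toC h) := by
        by_contra! hcon
        grind
      rcases this with h | h <;> linarith
    have hfr := hsub (⟨1/2, 1/2, by norm_num, by norm_num, by norm_num, rfl⟩ :
      (1/2 : ℝ) • toC g + (1/2 : ℝ) • toC h ∈ chordSet s(g, h))
    exact hfr.2 (interior_maximal Pin_subset_Poly (isOpen_Pin S.pos S.lt) hmid)

lemma Consec.edge_limit (S : Setup a t X) (hc : Consec a t X x y) {ε : ℝ} (hε : 0 < ε) :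
    ∃ d ∈ CsCL, Disjoint (chordSet d) (Poly a t X) ∧
      hausdorffDist (chordSet d) (chordSet s(x, y)) < ε := by
  obtain ⟨w, z, hm, h1, h2, -, h3, h4⟩ := hc.near S hε
  refine ⟨_, hm, Set.disjoint_left.2 fun u hu hp => ?_, hausdorffDist_segment h3 h4⟩
  exact absurd (dt_segment_neg hu (dt_neg_iff.2 h1) (dt_neg_iff.2 h2)) (not_lt.2 (hp.2 x y hc))

lemma Setup.conclusion (S : Setup a t X) (hl : Legal a t) :
    TwoSidedLimitOf CsCL s(a, a + (t : S1)) ∨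
      ∃ H : Set ℂ, IsGapOf CsCL H ∧ (gapVerts H).Finite ∧ IsEdgeOf H s(a, a + (t : S1)) ∧
        ∀ l : Chord, IsEdgeOf H l → ∀ ε : ℝ, 0 < ε →
          ∃ d ∈ CsCL, Disjoint (chordSet d) H ∧
            Metric.hausdorffDist (chordSet d) (chordSet l) < ε := by
  by_cases h3 : ∃ h ∈ Cl a t X, h ≠ a ∧ h ≠ a + (t : S1)
  · obtain ⟨h, hh, h1, h2⟩ := h3
    have hne : a ≠ a + (t : S1) := by
      rcases S.consec_of_legal hl with hc | hc
      exacts [hc.2.2.1, hc.2.2.1.symm]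
    refine .inr ⟨Poly a t X, S.isGap (Pin_nonempty S.memL S.memR hh hne h1.symm h2.symm), ?_, ?_, ?_⟩
    · rw [S.gapVerts_Poly]; exact Cl_finite S.pos S.lt X
    · rcases S.consec_of_legal hl with hc | hc
      · exact hc.isEdge
      · rw [Sym2.eq_swap]; exact hc.isEdge
    · intro l hl ε hε
      obtain ⟨x, y, hc, rfl⟩ := S.consec_of_isEdge hl
      exact hc.edge_limit S hε
  · push Not at h3
    have h2 : ∀ w ∈ Cl a t X, ¬ cyc a w (a + (t : S1)) ∧ ¬ cyc (a + (t : S1)) w a := by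
      refine fun w hw => ⟨fun h => ?_, fun h => ?_⟩
      · exact (cyc_ne h).2.1 (h3 w hw (cyc_ne h).1)
      · exact (cyc_ne h).1 (h3 w hw (cyc_ne h).2.1)
    have hne : a ≠ a + (t : S1) := by
      rcases S.consec_of_legal hl with hc | hc
      exacts [hc.2.2.1, hc.2.2.1.symm]
    exact .inl (Consec.twoSided S ⟨S.memL, S.memR, hne, fun w hw => (h2 w hw).1⟩
      ⟨S.memR, S.memL, hne.symm, fun w hw => (h2 w hw).2⟩)

lemma not_perPt_of_strictPreper {k p : ℕ} (hk : 2 ≤ k) (h : StrictPreper x k p) :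
    ¬ PerPt (s3 x) := h.2.2.2.1 1 hk

end SymLam

theorem preperiod_at_least_two :
    ∀ (L : Set Chord) (c : Chord), IsCubicSymLam L → IsComajor L c → ¬ c.IsDiag →
      (∀ x ∈ c, ∃ k p : ℕ, 2 ≤ k ∧ StrictPreper x k p) →
      TwoSidedLimitOf CsCL c ∨
      ∃ H : Set ℂ, IsGapOf CsCL H ∧ (gapVerts H).Finite ∧ IsEdgeOf H c ∧
        ∀ l : Chord, IsEdgeOf H l → ∀ ε : ℝ, 0 < ε →
          ∃ d ∈ CsCL, Disjoint (chordSet d) H ∧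
            Metric.hausdorffDist (chordSet d) (chordSet l) < ε := by
  intro L c hL hc hd hpre
  obtain ⟨a, t, hl, rfl⟩ := SymLam.exists_legal hL hc hd
  obtain ⟨k, p, hk, h⟩ := hpre a (Sym2.mem_mk_left _ _)
  obtain ⟨X, S⟩ := hl.setup (SymLam.not_perPt_of_strictPreper hk h) ⟨k, p, h.2.1, h.2.2.1⟩
  exact S.conclusion hl

end
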